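/- Let p ∈ (0,1), let μ be a non-trivial finite Borel measure on S^{n-1}, and let L = lin(supp μ) be the linear hull of its support. Assume that either supp μ spans ℝ^n, or dim L ≤ n-1 and the positive hull pos(supp μ) ≠ L. Then there exists a convex body K ∈ K_0^n with μ = S_{K,p}. Moreover, if μ is invariant under a closed subgroup G of O(n) acting as the identity on the orthogonal complement L^⊥, then K can be chosen to be invariant under G. -/

import Mathlib

open MeasureTheory Metric Set Filter
open scoped ENNReal RealInnerProductSpace NNReal

noncomputable section

abbrev Eu (n : ℕ) : Type := EuclideanSpace ℝ (Fin n)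

def IsConvexBody {n : ℕ} (K : Set (Eu n)) : Prop :=
  Convex ℝ K ∧ IsCompact K ∧ (interior K).Nonempty

def suppFn {n : ℕ} (K : Set (Eu n)) (u : Eu n) : ℝ :=
  sSup ((fun x => ⟪x, u⟫) '' K)

def IsOuterNormal {n : ℕ} (K : Set (Eu n)) (x u : Eu n) : Prop :=
  ‖u‖ = 1 ∧ ∀ y ∈ K, ⟪y, u⟫ ≤ ⟪x, u⟫

def gaussMap {n : ℕ} (K : Set (Eu n)) (x : Eu n) : Eu n :=
  open scoped Classical in
  if h : ∃ u, IsOuterNormal K x u then h.choose else 0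

def lpSurf {n : ℕ} (p : ℝ) (K : Set (Eu n)) (ω : Set (Eu n)) : ℝ≥0∞ :=
  ∫⁻ x in {x ∈ frontier K | gaussMap K x ∈ ω},
    ENNReal.ofReal (⟪x, gaussMap K x⟫ ^ (1 - p)) ∂(μH[(n:ℝ) - 1])


def measSupport {n : ℕ} (μ : Measure (Eu n)) : Set (Eu n) :=
  {x | ∀ U : Set (Eu n), IsOpen U → x ∈ U → 0 < μ U}

/-- The positive hull `pos X = {∑ λᵢ xᵢ : λᵢ ≥ 0, xᵢ ∈ X}`. -/
def posHull {n : ℕ} (X : Set (Eu n)) : Set (Eu n) :=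
  {y | ∃ (k : ℕ) (c : Fin k → ℝ) (x : Fin k → Eu n),
      (∀ i, 0 ≤ c i ∧ x i ∈ X) ∧ y = ∑ i, c i • x i}

/-- Action of an `n × n` matrix on Euclidean space. -/
def matAct {n : ℕ} (A : Matrix (Fin n) (Fin n) ℝ) (x : Eu n) : Eu n :=
  (EuclideanSpace.equiv (Fin n) ℝ).symm (A.mulVec (EuclideanSpace.equiv (Fin n) ℝ x))

open scoped Topology

/-- Coordinates along a unit vector `u` and its orthogonal complement, with Tonelli's formula. -/
lemma exists_line_coordinates {m : ℕ} (u : Eu (m + 1)) (hu : ‖u‖ = 1) :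
    ∃ (q : Eu (m + 1) →L[ℝ] Eu m) (ι : Eu m →L[ℝ] Eu (m + 1)),
      (∀ z : Eu (m + 1), ‖z‖ ^ 2 = ⟪z, u⟫ ^ 2 + ‖q z‖ ^ 2) ∧
      (∀ z : Eu (m + 1), z = ⟪z, u⟫ • u + ι (q z)) ∧
      (∀ (a : ℝ) (y : Eu m), q (a • u + ι y) = y) ∧
      (∀ S : Set (Eu (m + 1)), MeasurableSet S →
        volume S = ∫⁻ y, volume {a : ℝ | a • u + ι y ∈ S}) := by
  obtain ⟨b, hb⟩ := Orthonormal.exists_orthonormalBasis_extension_of_card_eq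
    (𝕜 := ℝ) (E := Eu (m + 1)) (ι := Fin (m + 1)) (by simp) (v := fun _ => u) (s := {0})
    (by
      refine ⟨fun i => hu, fun i j hij => ?_⟩
      exact absurd (Subsingleton.elim i j) hij)
  have hb0 : b 0 = u := hb 0 rfl
  let q : Eu (m + 1) →ₗ[ℝ] Eu m :=
    { toFun := fun z => WithLp.toLp 2 fun i => b.repr z i.succ
      map_add' := by intro x y; ext i; simp
      map_smul' := by intro c x; ext i; simp }
  let ι : Eu m →ₗ[ℝ] Eu (m + 1) :=
    { toFun := fun y => ∑ i, y i • b i.succ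
      map_add' := by intro x y; simp [add_smul, Finset.sum_add_distrib]
      map_smul' := by intro c x; simp [mul_smul, Finset.smul_sum] }
  have hq : ∀ z i, q z i = b.repr z i.succ := fun z i => rfl
  have hι : ∀ y, ι y = ∑ i, y i • b i.succ := fun y => rfl
  have hcoord : ∀ z : Eu (m + 1), b.repr z 0 = ⟪z, u⟫ := fun z => by
    rw [b.repr_apply_apply, hb0, real_inner_comm]
  have hrec : ∀ z : Eu (m + 1), z = ⟪z, u⟫ • u + ι (q z) := fun z => by
    conv_lhs => rw [← b.sum_repr z, Fin.sum_univ_succ, hcoord, hb0]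
    simp [hι, hq]
  have hreprι : ∀ (a : ℝ) (y : Eu m), b.repr (a • u + ι y) = WithLp.toLp 2 (Fin.cons a fun i => y i) := by
    intro a y
    apply b.repr.symm.injective
    rw [b.repr.symm_apply_apply, ← b.sum_repr_symm, Fin.sum_univ_succ]
    simp [hι, hb0]
  refine ⟨q.toContinuousLinearMap, ι.toContinuousLinearMap, ?_, ?_, ?_, ?_⟩
  · intro z
    rw [← b.repr.norm_map z, EuclideanSpace.norm_sq_eq, EuclideanSpace.norm_sq_eq,
      Fin.sum_univ_succ, hcoord]
    simp [hq]
  · intro z; exact hrec z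
  · intro a y
    ext i
    change q (a • u + ι y) i = y i
    rw [hq, hreprι]
    simp
  · intro S hS
    have h1 := (b.measurePreserving_repr_symm.comp
      (EuclideanSpace.volume_preserving_symm_measurableEquiv_toLp (Fin (m + 1))).symm).comp
      (volume_preserving_piFinSuccAbove (fun _ : Fin (m + 1) => ℝ) 0).symm
    have h2 := h1.comp ((MeasurePreserving.id (volume : Measure ℝ)).prod
      (EuclideanSpace.volume_preserving_symm_measurableEquiv_toLp (Fin m)))
    rw [← h2.measure_preimage hS.nullMeasurableSet, Measure.prod_apply_symm (h2.measurable hS)]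
    refine lintegral_congr fun y => congrArg _ ?_
    ext a
    simp only [mem_preimage, mem_ofPred_eq]
    have : a • u + ι y = b.repr.symm (WithLp.toLp 2 (Fin.cons a fun i => y i)) := by
      rw [← hreprι, b.repr.symm_apply_apply]
    change _ ↔ a • u + ι y ∈ S
    have hins : (MeasurableEquiv.piFinSuccAbove (fun _ : Fin (m + 1) => ℝ) 0).symm
        (a, fun i => y i) = Fin.cons a fun i => y i := by
      change Fin.insertNth (α := fun _ => ℝ) 0 a (fun i => y i) = _
      exact Fin.insertNth_zero' _ _
    rw [this, ← hins]
    rfl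

lemma exists_hausdorff_eq_smul_volume (m : ℕ) :
    ∃ γ : ℝ≥0∞, γ ≠ 0 ∧ γ ≠ ∞ ∧ (μH[(m : ℝ)] : Measure (Eu m)) = γ • volume := by
  have hfin : ((Module.finrank ℝ (Eu m) : ℕ) : ℝ) = m := by simp
  have inst : (μH[(m : ℝ)] : Measure (Eu m)).IsAddHaarMeasure := by
    rw [← hfin]; infer_instance
  refine ⟨(μH[(m : ℝ)] : Measure (Eu m)).addHaarScalarFactor volume, ?_, ENNReal.coe_ne_top, ?_⟩
  · have := Measure.addHaarScalarFactor_pos_of_isAddHaarMeasure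
      (μH[(m : ℝ)] : Measure (Eu m)) volume
    exact_mod_cast this.ne'
  · have := Measure.isAddLeftInvariant_eq_smul (μH[(m : ℝ)] : Measure (Eu m)) volume
    rw [ENNReal.smul_def] at this
    exact this

lemma hausdorffMeasure_le_of_dist_le {X Y : Type*} [MetricSpace X] [MeasurableSpace X]
    [BorelSpace X] [MetricSpace Y] [MeasurableSpace Y] [BorelSpace Y] {d : ℝ} (hd : 0 ≤ d)
    {f : X → Y} {s : Set X} {k : ℝ≥0} (h : ∀ x ∈ s, ∀ y ∈ s, dist x y ≤ k * dist (f x) (f y)) :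
    μH[d] s ≤ (k : ℝ≥0∞) ^ d * μH[d] (f '' s) := by
  rcases s.eq_empty_or_nonempty with rfl | ⟨x0, hx0⟩
  · simp
  have : Nonempty X := ⟨x0⟩
  have hinj : InjOn f s := fun x hx y hy hxy => by
    have := h x hx y hy
    rw [hxy, dist_self, mul_zero] at this
    exact dist_le_zero.1 this
  have himg : s = Function.invFunOn f s '' (f '' s) := by
    rw [hinj.invFunOn_image Subset.rfl]
  have hl : LipschitzOnWith k (Function.invFunOn f s) (f '' s) := by
    refine LipschitzOnWith.of_dist_le_mul ?_
    rintro _ ⟨x, hx, rfl⟩ _ ⟨y, hy, rfl⟩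
    rw [hinj.leftInvOn_invFunOn hx, hinj.leftInvOn_invFunOn hy]
    exact h x hx y hy
  calc μH[d] s = μH[d] (Function.invFunOn f s '' (f '' s)) := by rw [← himg]
    _ ≤ _ := hl.hausdorffMeasure_image_le hd

section SupportFunction

variable {n : ℕ} {K : Set (Eu n)}

lemma bddAbove_inner_image (hK : IsCompact K) (u : Eu n) :
    BddAbove ((fun x => ⟪x, u⟫) '' K) :=
  (hK.image (by fun_prop)).bddAbove

lemma inner_le_suppFn (hK : IsCompact K) {x : Eu n} (hx : x ∈ K) (u : Eu n) :
    ⟪x, u⟫ ≤ suppFn K u :=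
  le_csSup (bddAbove_inner_image hK u) ⟨x, hx, rfl⟩

lemma suppFn_le (hne : K.Nonempty) {u : Eu n} {a : ℝ} (h : ∀ x ∈ K, ⟪x, u⟫ ≤ a) :
    suppFn K u ≤ a :=
  csSup_le (hne.image _) (by rintro _ ⟨x, hx, rfl⟩; exact h x hx)

lemma exists_inner_eq_suppFn (hK : IsCompact K) (hne : K.Nonempty) (u : Eu n) :
    ∃ x ∈ K, ⟪x, u⟫ = suppFn K u := by
  have := (hK.image (f := fun x : Eu n => ⟪x, u⟫) (by fun_prop)).sSup_mem (hne.image _)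
  exact this

lemma suppFn_sub_le (hK : IsCompact K) (hne : K.Nonempty) {R : ℝ}
    (hR : ∀ x ∈ K, ‖x‖ ≤ R) (u v : Eu n) : suppFn K u ≤ suppFn K v + R * ‖u - v‖ := by
  refine suppFn_le hne fun x hx => ?_
  have h1 : ⟪x, u⟫ = ⟪x, v⟫ + ⟪x, u - v⟫ := by rw [inner_sub_right]; ring
  have h2 := real_inner_le_norm x (u - v)
  have h3 := mul_le_mul_of_nonneg_right (hR x hx) (norm_nonneg (u - v))
  linarith [inner_le_suppFn hK hx v]

lemma continuous_suppFn (hK : IsCompact K) (hne : K.Nonempty) : Continuous (suppFn K) := by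
  obtain ⟨R, hR⟩ := hK.isBounded.exists_norm_le
  have hR0 : 0 ≤ R := (norm_nonneg _).trans (hR _ hne.some_mem)
  refine (LipschitzWith.of_dist_le_mul (K := R.toNNReal) fun u v => ?_).continuous
  rw [Real.dist_eq, abs_le, dist_eq_norm, Real.coe_toNNReal R hR0]
  have h1 := suppFn_sub_le hK hne hR u v
  have h2 := suppFn_sub_le hK hne hR v u
  rw [norm_sub_rev] at h2
  constructor <;> linarith

lemma suppFn_nonneg (hK : IsCompact K) (h0 : (0 : Eu n) ∈ K) (u : Eu n) : 0 ≤ suppFn K u := by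
  simpa using inner_le_suppFn hK h0 u

lemma abs_suppFn_le (hK : IsCompact K) (hne : K.Nonempty) {R : ℝ}
    (hR : ∀ x ∈ K, ‖x‖ ≤ R) (u : Eu n) : |suppFn K u| ≤ R * ‖u‖ := by
  obtain ⟨x, hx, hxu⟩ := exists_inner_eq_suppFn hK hne u
  rw [← hxu]
  exact (abs_real_inner_le_norm x u).trans
    (mul_le_mul_of_nonneg_right (hR x hx) (norm_nonneg u))

lemma suppFn_smul_set {c : ℝ} (hc : 0 ≤ c) (u : Eu n) :
    suppFn ((fun x => c • x) '' K) u = c * suppFn K u := by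
  unfold suppFn
  rw [← smul_eq_mul, ← Real.sSup_smul_of_nonneg hc, image_image, ← image_smul, image_image]
  simp [inner_smul_left]

/-- A point satisfying all support inequalities of a compact convex set belongs to the set. -/
lemma mem_of_forall_inner_le_suppFn (hK : IsCompact K) (hc : Convex ℝ K) (hne : K.Nonempty)
    {z : Eu n} (h : ∀ e : Eu n, ‖e‖ = 1 → ⟪z, e⟫ ≤ suppFn K e) : z ∈ K := by
  by_contra hz
  obtain ⟨f, a, hfa, hfz⟩ := geometric_hahn_banach_closed_point hc hK.isClosed hz
  set v : Eu n := (InnerProductSpace.toDual ℝ (Eu n)).symm f with hv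
  have hf : ∀ x, f x = ⟪x, v⟫ := fun x => by
    rw [real_inner_comm, hv, InnerProductSpace.toDual_symm_apply]
  have hv0 : v ≠ 0 := by
    intro h0
    obtain ⟨x, hx⟩ := hne
    have h1 := hfa x hx
    rw [hf, h0, inner_zero_right] at h1
    rw [hf, h0, inner_zero_right] at hfz
    linarith
  have hvn : 0 < ‖v‖ := norm_pos_iff.2 hv0
  have h1 := h (‖v‖⁻¹ • v) (by rw [norm_smul, norm_inv, norm_norm, inv_mul_cancel₀ hvn.ne'])
  have h2 : suppFn K (‖v‖⁻¹ • v) ≤ ‖v‖⁻¹ * a := suppFn_le hne fun x hx => by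
    rw [inner_smul_right]
    exact mul_le_mul_of_nonneg_left (by rw [← hf]; exact (hfa x hx).le) (by positivity)
  rw [inner_smul_right] at h1
  rw [hf] at hfz
  have h3 := lt_of_mul_lt_mul_left (lt_of_le_of_lt (h1.trans h2)
    (mul_lt_mul_of_pos_left hfz (inv_pos.2 hvn))) (by positivity)
  exact lt_irrefl _ h3

lemma isOuterNormal_iff (hK : IsCompact K) {x u : Eu n} (hx : x ∈ K) :
    IsOuterNormal K x u ↔ ‖u‖ = 1 ∧ suppFn K u ≤ ⟪x, u⟫ :=
  ⟨fun h => ⟨h.1, suppFn_le ⟨x, hx⟩ h.2⟩,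
    fun h => ⟨h.1, fun _ hy => (inner_le_suppFn hK hy u).trans h.2⟩⟩

lemma IsOuterNormal.inner_eq (hK : IsCompact K) {x u : Eu n} (hx : x ∈ K)
    (h : IsOuterNormal K x u) : ⟪x, u⟫ = suppFn K u :=
  le_antisymm (inner_le_suppFn hK hx u) ((isOuterNormal_iff hK hx).1 h).2

lemma gaussMap_isOuterNormal {x : Eu n} (h : ∃ u, IsOuterNormal K x u) :
    IsOuterNormal K x (gaussMap K x) := by
  unfold gaussMap
  rw [dif_pos h]
  exact h.choose_spec

lemma exists_isOuterNormal (hc : Convex ℝ K) (hint : (interior K).Nonempty) {x : Eu n}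
    (hx : x ∈ frontier K) : ∃ u, IsOuterNormal K x u := by
  obtain ⟨f, hf⟩ := geometric_hahn_banach_open_point hc.interior isOpen_interior hx.2
  set v : Eu n := (InnerProductSpace.toDual ℝ (Eu n)).symm f with hv
  have hfv : ∀ y, f y = ⟪y, v⟫ := fun y => by
    rw [real_inner_comm, hv, InnerProductSpace.toDual_symm_apply]
  have hv0 : v ≠ 0 := by
    intro h0
    obtain ⟨y, hy⟩ := hint
    have := hf y hy
    rw [hfv, hfv, h0] at this
    simp at this
  have hvn : 0 < ‖v‖ := norm_pos_iff.2 hv0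
  refine ⟨‖v‖⁻¹ • v, by rw [norm_smul, norm_inv, norm_norm, inv_mul_cancel₀ hvn.ne'],
    fun y hy => ?_⟩
  have hcl : y ∈ closure (interior K) := by
    rw [hc.closure_interior_eq_closure_of_nonempty_interior hint]
    exact subset_closure hy
  have : f y ≤ f x := closure_minimal (fun z hz => (hf z hz).le)
    (isClosed_le f.continuous continuous_const) hcl
  rw [inner_smul_right, inner_smul_right]
  exact mul_le_mul_of_nonneg_left (by rw [← hfv, ← hfv]; exact this) (by positivity)

lemma IsOuterNormal.mem_frontier {x u : Eu n} (hx : x ∈ K)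
    (h : IsOuterNormal K x u) : x ∈ frontier K := by
  refine ⟨subset_closure hx, fun hxi => ?_⟩
  obtain ⟨ε, hε, hb⟩ := Metric.isOpen_iff.1 isOpen_interior x hxi
  have hmem : x + (ε / 2) • u ∈ K := interior_subset (hb (by
    rw [mem_ball, dist_eq_norm, add_sub_cancel_left, norm_smul, h.1, Real.norm_eq_abs,
      abs_of_pos (by positivity)]; linarith))
  have h1 := h.2 _ hmem
  rw [inner_add_left, inner_smul_left, real_inner_self_eq_norm_sq, h.1] at h1
  simp at h1
  linarith

end SupportFunction

section NormalCone

variable {n m : ℕ} {K : Set (Eu n)}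

/-- The set of points of `K` with an outer normal in `C`. -/
def normalSet (K C : Set (Eu n)) : Set (Eu n) := {x ∈ K | ∃ e ∈ C, IsOuterNormal K x e}

lemma normalSet_subset (C : Set (Eu n)) : normalSet K C ⊆ K := fun _ hx => hx.1

lemma normalSet_subset_frontier (C : Set (Eu n)) : normalSet K C ⊆ frontier K :=
  fun _ ⟨hx, _, _, he⟩ => he.mem_frontier hx

lemma isCompact_normalSet (hK : IsCompact K) {C : Set (Eu n)} (hC : IsClosed C) :
    IsCompact (normalSet K C) := by
  rcases K.eq_empty_or_nonempty with rfl | hne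
  · convert isCompact_empty
    exact subset_empty_iff.1 (normalSet_subset C)
  have hcomp : IsCompact (K ×ˢ (sphere (0 : Eu n) 1 ∩ C) ∩
      {z : Eu n × Eu n | suppFn K z.2 ≤ ⟪z.1, z.2⟫}) := by
    refine (hK.prod ((isCompact_sphere 0 1).inter_right hC)).inter_right ?_
    exact isClosed_le ((continuous_suppFn hK hne).comp continuous_snd)
      (continuous_fst.inner continuous_snd)
  convert hcomp.image continuous_fst
  ext x
  constructor
  · rintro ⟨hx, e, heC, he⟩
    exact ⟨(x, e), ⟨⟨hx, by simpa using he.1, heC⟩, ((isOuterNormal_iff hK hx).1 he).2⟩, rfl⟩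
  · rintro ⟨⟨y, e⟩, ⟨⟨hy, hes, heC⟩, hle⟩, rfl⟩
    exact ⟨hy, e, heC, (isOuterNormal_iff hK hy).2 ⟨by simpa using hes, hle⟩⟩

lemma normalSet_univ (hK : IsCompact K) (hc : Convex ℝ K) (hint : (interior K).Nonempty) :
    normalSet K univ = frontier K := by
  refine (normalSet_subset_frontier _).antisymm fun x hx => ?_
  obtain ⟨u, hu⟩ := exists_isOuterNormal hc hint hx
  exact ⟨hK.isClosed.frontier_subset hx, u, mem_univ _, hu⟩

lemma abs_inner_sub_le_of_normals {u x y e f : Eu n} {δ : ℝ} (hx : x ∈ K) (hy : y ∈ K)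
    (he : IsOuterNormal K x e) (hf : IsOuterNormal K y f) (heu : ‖e - u‖ ≤ δ)
    (hfu : ‖f - u‖ ≤ δ) : |⟪x - y, u⟫| ≤ δ * ‖x - y‖ := by
  have h1 : ⟪x - y, f⟫ ≤ 0 := by rw [inner_sub_left]; linarith [hf.2 x hx]
  have h2 : 0 ≤ ⟪x - y, e⟫ := by rw [inner_sub_left]; linarith [he.2 y hy]
  have h3 := abs_le.1 (abs_real_inner_le_norm (x - y) (f - u))
  have h4 := abs_le.1 (abs_real_inner_le_norm (x - y) (e - u))
  rw [inner_sub_right] at h3 h4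
  have h5 := mul_le_mul_of_nonneg_left heu (norm_nonneg (x - y))
  have h6 := mul_le_mul_of_nonneg_left hfu (norm_nonneg (x - y))
  rw [abs_le]
  constructor <;> linarith [h3.1, h4.2]

lemma norm_le_of_sq_eq {V : Type*} [NormedAddCommGroup V] {z : Eu n} {w : V} {a δ : ℝ} {k : ℝ≥0}
    (hk : 1 ≤ (k : ℝ) ^ 2 * (1 - δ ^ 2)) (h : ‖z‖ ^ 2 = a ^ 2 + ‖w‖ ^ 2)
    (ha : |a| ≤ δ * ‖z‖) : ‖z‖ ≤ k * ‖w‖ := by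
  have h1 : a ^ 2 ≤ δ ^ 2 * ‖z‖ ^ 2 := by
    rw [← sq_abs, ← mul_pow]
    exact pow_le_pow_left₀ (abs_nonneg a) ha 2
  have h2 : ‖z‖ ^ 2 ≤ (k * ‖w‖) ^ 2 := by
    rw [mul_pow]
    calc ‖z‖ ^ 2 ≤ (k : ℝ) ^ 2 * (1 - δ ^ 2) * ‖z‖ ^ 2 := le_mul_of_one_le_left (sq_nonneg _) hk
      _ = (k : ℝ) ^ 2 * ((1 - δ ^ 2) * ‖z‖ ^ 2) := by ring
      _ ≤ _ := by
        refine mul_le_mul_of_nonneg_left ?_ (sq_nonneg _)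
        linarith
  exact le_of_sq_le_sq h2 (by positivity)

lemma hausdorffMeasure_le_of_normals_near {K : Set (Eu (m + 1))} {u : Eu (m + 1)}
    {q : Eu (m + 1) →L[ℝ] Eu m} (hq : ∀ z : Eu (m + 1), ‖z‖ ^ 2 = ⟪z, u⟫ ^ 2 + ‖q z‖ ^ 2)
    {δ : ℝ} {k : ℝ≥0} (hk : 1 ≤ (k : ℝ) ^ 2 * (1 - δ ^ 2))
    {X : Set (Eu (m + 1))} (hX : X ⊆ normalSet K (closedBall u δ)) :
    μH[(m : ℝ)] X ≤ (k : ℝ≥0∞) ^ (m : ℝ) * μH[(m : ℝ)] (q '' X) := by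
  refine hausdorffMeasure_le_of_dist_le (by positivity) fun x hx y hy => ?_
  obtain ⟨hxK, e, heu, he⟩ := hX hx
  obtain ⟨hyK, f, hfu, hf⟩ := hX hy
  rw [mem_closedBall, dist_eq_norm] at heu hfu
  rw [dist_eq_norm, dist_eq_norm, ← map_sub]
  exact norm_le_of_sq_eq hk (hq _) (abs_inner_sub_le_of_normals hxK hyK he hf heu hfu)

lemma norm_le_of_norm_sq_eq_add {V : Type*} [NormedAddCommGroup V] {z : Eu n} {w : V} {a : ℝ}
    (h : ‖z‖ ^ 2 = a ^ 2 + ‖w‖ ^ 2) : ‖w‖ ≤ ‖z‖ :=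
  le_of_sq_le_sq (by nlinarith [sq_nonneg a]) (norm_nonneg _)

lemma hausdorffMeasure_image_le_of_coordinates {u : Eu (m + 1)}
    {q : Eu (m + 1) →L[ℝ] Eu m} (hq : ∀ z : Eu (m + 1), ‖z‖ ^ 2 = ⟪z, u⟫ ^ 2 + ‖q z‖ ^ 2)
    (X : Set (Eu (m + 1))) : μH[(m : ℝ)] (q '' X) ≤ μH[(m : ℝ)] X := by
  have hl : LipschitzOnWith 1 q X := by
    refine LipschitzOnWith.of_dist_le_mul fun x _ y _ => ?_
    rw [dist_eq_norm, dist_eq_norm, ← map_sub, NNReal.coe_one, one_mul]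
    exact norm_le_of_norm_sq_eq_add (hq _)
  simpa using hl.hausdorffMeasure_image_le (d := (m : ℝ)) (by positivity)

lemma hausdorffMeasure_frontier_lt_top {K : Set (Eu (m + 1))} (hK : IsCompact K)
    (hc : Convex ℝ K) (hint : (interior K).Nonempty) : μH[(m : ℝ)] (frontier K) < ∞ := by
  obtain ⟨γ, -, hγ, hvol⟩ := exists_hausdorff_eq_smul_volume m
  have hloc : ∀ u : Eu (m + 1), ‖u‖ = 1 →
      μH[(m : ℝ)] (normalSet K (closedBall u (1 / 2))) < ∞ := by
    intro u hu
    obtain ⟨q, -, hq, -⟩ := exists_line_coordinates u hu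
    refine (hausdorffMeasure_le_of_normals_near hq (k := 2) (by norm_num)
      Subset.rfl).trans_lt ?_
    refine ENNReal.mul_lt_top (ENNReal.rpow_lt_top_of_nonneg (by positivity) (by simp)) ?_
    rw [hvol]
    refine ENNReal.mul_lt_top hγ.lt_top ?_
    exact ((isCompact_normalSet hK isClosed_closedBall).image q.continuous).measure_lt_top
  obtain ⟨t, hts, htf, hcov⟩ := (isCompact_sphere (0 : Eu (m + 1)) 1).elim_finite_subcover_image
    (b := sphere (0 : Eu (m + 1)) 1) (c := fun u => ball u (1 / 2))
    (fun _ _ => isOpen_ball) (fun u hu => mem_iUnion₂.2 ⟨u, hu, mem_ball_self (by norm_num)⟩)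
  have hsub : frontier K ⊆ ⋃ u ∈ t, normalSet K (closedBall u (1 / 2)) := by
    intro x hx
    rw [← normalSet_univ hK hc hint] at hx
    obtain ⟨hxK, e, -, he⟩ := hx
    obtain ⟨u, hut, heu⟩ := mem_iUnion₂.1 (hcov (by simpa using he.1 : e ∈ sphere _ _))
    exact mem_iUnion₂.2 ⟨u, hut, hxK, e, ball_subset_closedBall heu, he⟩
  refine (measure_mono hsub).trans_lt ?_
  exact measure_biUnion_lt_top htf fun u hu => hloc u (by simpa using hts hu)

/-- Points with two distinct outer normals. -/
def singularSet (K : Set (Eu n)) : Set (Eu n) :=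
  {x ∈ K | ∃ e f, e ≠ f ∧ IsOuterNormal K x e ∧ IsOuterNormal K x f}

lemma not_isOuterNormal_neg (hint : (interior K).Nonempty) {x u : Eu n}
    (h : IsOuterNormal K x u) : ¬ IsOuterNormal K x (-u) := by
  intro h'
  have heq : ∀ y ∈ K, ⟪y, u⟫ = ⟪x, u⟫ := fun y hy => by
    have h1 := h.2 y hy
    have h2 := h'.2 y hy
    rw [inner_neg_right, inner_neg_right] at h2
    linarith
  obtain ⟨y, hy⟩ := hint
  obtain ⟨ε, hε, hb⟩ := Metric.isOpen_iff.1 isOpen_interior y hy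
  have hmem : y + (ε / 2) • u ∈ K := interior_subset (hb (by
    rw [mem_ball, dist_eq_norm, add_sub_cancel_left, norm_smul, h.1, Real.norm_eq_abs,
      abs_of_pos (by positivity)]; linarith))
  have h1 := heq _ hmem
  rw [inner_add_left, inner_smul_left, real_inner_self_eq_norm_sq, h.1,
    heq y (interior_subset hy)] at h1
  simp at h1
  linarith

lemma exists_null_singular_nhds (K : Set (Eu (m + 1))) {u v : Eu (m + 1)} (hu : ‖u‖ = 1)
    (hv : ‖v‖ = 1) (huv : u ≠ v) (huv' : u ≠ -v) :
    ∃ r > 0, μH[(m : ℝ)] (normalSet K (closedBall u r) ∩ normalSet K (closedBall v r)) = 0 := by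
  set W : Submodule ℝ (Eu (m + 1)) := Submodule.span ℝ (Set.range ![u, v]) with hW
  have huW : u ∈ W := Submodule.subset_span ⟨0, rfl⟩
  have hvW : v ∈ W := Submodule.subset_span ⟨1, rfl⟩
  have hli : LinearIndependent ℝ ![u, v] := by
    rw [LinearIndependent.pair_iff' (by rintro rfl; simp at hu)]
    rintro a rfl
    rw [norm_smul, hu, mul_one, Real.norm_eq_abs] at hv
    rcases eq_or_eq_neg_of_abs_eq hv with rfl | rfl
    · simp at huv
    · simp at huv'
  have hfin : Module.finrank ℝ W = 2 := by
    rw [finrank_span_eq_card hli]; simp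
  have hfin' : Module.finrank ℝ Wᗮ < m := by
    have := W.finrank_add_finrank_orthogonal
    rw [hfin] at this
    simp at this
    omega
  let A : W →ₗ[ℝ] ℝ × ℝ :=
    ((innerₛₗ ℝ u).comp W.subtype).prod ((innerₛₗ ℝ v).comp W.subtype)
  have hA : ∀ z : W, A z = (⟪u, (z : Eu (m + 1))⟫, ⟪v, (z : Eu (m + 1))⟫) := fun z => rfl
  have hker : LinearMap.ker A = ⊥ := by
    rw [LinearMap.ker_eq_bot']
    intro z hz
    rw [hA, Prod.mk_eq_zero] at hz
    have hzo : (z : Eu (m + 1)) ∈ Wᗮ := by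
      rw [Submodule.mem_orthogonal]
      intro w hw
      rw [hW] at hw
      induction hw using Submodule.span_induction with
      | mem x hx =>
        obtain ⟨i, rfl⟩ := hx
        fin_cases i
        · exact hz.1
        · exact hz.2
      | zero => simp
      | add x y _ _ hx hy => rw [inner_add_left, hx, hy, add_zero]
      | smul a x _ hx => rw [inner_smul_left, hx, mul_zero]
    have h0 := Submodule.inner_right_of_mem_orthogonal z.2 hzo
    exact Subtype.ext (inner_self_eq_zero.1 h0)
  obtain ⟨k, hk, hanti⟩ := A.exists_antilipschitzWith hker
  have hk' : (0 : ℝ) < k := by exact_mod_cast hk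
  refine ⟨1 / (2 * k), by positivity, ?_⟩
  set r : ℝ := 1 / (2 * k) with hr
  have hle : μH[(m : ℝ)] (normalSet K (closedBall u r) ∩ normalSet K (closedBall v r)) ≤
      ((2 : ℝ≥0) : ℝ≥0∞) ^ (m : ℝ) * μH[(m : ℝ)] (Wᗮ.orthogonalProjectionOnto ''
        (normalSet K (closedBall u r) ∩ normalSet K (closedBall v r))) := by
    refine hausdorffMeasure_le_of_dist_le (by positivity) ?_
    rintro x ⟨⟨hxK, e, heu, he⟩, ⟨-, e', hev, he'⟩⟩ y ⟨⟨hyK, f, hfu, hf⟩, ⟨-, f', hfv, hf'⟩⟩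
    rw [mem_closedBall, dist_eq_norm] at heu hev hfu hfv
    have h1 := abs_inner_sub_le_of_normals hxK hyK he hf heu hfu
    have h2 := abs_inner_sub_le_of_normals hxK hyK he' hf' hev hfv
    rw [dist_eq_norm, dist_eq_norm, ← map_sub]
    set z := x - y
    have hz : z = W.starProjection z + Wᗮ.starProjection z := by
      rw [W.starProjection_add_starProjection_orthogonal]
    have hin : ∀ w ∈ W, ⟪w, W.starProjection z⟫ = ⟪z, w⟫ := fun w hw => by
      conv_rhs => rw [hz, inner_add_left, real_inner_comm]
      rw [Submodule.inner_left_of_mem_orthogonal hw (Submodule.starProjection_apply_mem _ _),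
        add_zero]
    have h3 := hanti.le_mul_dist (W.orthogonalProjectionOnto z) 0
    rw [map_zero, dist_zero_right, dist_zero_right, hA, Prod.norm_mk] at h3
    have h4 : ‖W.starProjection z‖ ≤ k * (r * ‖z‖) := by
      refine h3.trans (mul_le_mul_of_nonneg_left ?_ hk'.le)
      exact max_le ((hin u huW).symm ▸ h1) ((hin v hvW).symm ▸ h2)
    have h5 : (k : ℝ) * (r * ‖z‖) = ‖z‖ / 2 := by rw [hr]; field_simp
    have h6 : ‖z‖ ≤ ‖W.starProjection z‖ + ‖Wᗮ.starProjection z‖ := by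
      conv_lhs => rw [hz]
      exact norm_add_le _ _
    have h7 : ‖Wᗮ.starProjection z‖ = ‖Wᗮ.orthogonalProjectionOnto z‖ := rfl
    rw [NNReal.coe_ofNat]
    linarith
  refine le_antisymm (hle.trans (le_of_eq ?_)) bot_le
  have hzero : μH[(m : ℝ)] (Wᗮ.orthogonalProjectionOnto ''
        (normalSet K (closedBall u r) ∩ normalSet K (closedBall v r))) = 0 := by
    refine measure_mono_null (subset_univ _) ?_
    have : (m : ℝ) = ((m : ℝ≥0) : ℝ) := by simp
    rw [this]
    refine hausdorffMeasure_of_dimH_lt ?_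
    rw [Real.dimH_univ_eq_finrank]
    exact_mod_cast hfin'
  rw [hzero, mul_zero]

lemma hausdorffMeasure_singularSet {K : Set (Eu (m + 1))} (hint : (interior K).Nonempty) :
    μH[(m : ℝ)] (singularSet K) = 0 := by
  let P : Set (Eu (m + 1) × Eu (m + 1)) :=
    {z | ‖z.1‖ = 1 ∧ ‖z.2‖ = 1 ∧ z.1 ≠ z.2 ∧ z.1 ≠ -z.2}
  have hex : ∀ z : Eu (m + 1) × Eu (m + 1), ∃ r > 0, z ∈ P →
      μH[(m : ℝ)] (normalSet K (closedBall z.1 r) ∩ normalSet K (closedBall z.2 r)) = 0 := by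
    intro z
    by_cases hz : z ∈ P
    · obtain ⟨r, hr, h⟩ := exists_null_singular_nhds K hz.1 hz.2.1 hz.2.2.1 hz.2.2.2
      exact ⟨r, hr, fun _ => h⟩
    · exact ⟨1, one_pos, fun h => absurd h hz⟩
  choose r hr hnull using hex
  obtain ⟨t, htP, htc, hcov⟩ := TopologicalSpace.countable_cover_nhdsWithin (s := P)
    (f := fun z => closedBall z (r z))
    (fun z _ => mem_nhdsWithin_of_mem_nhds (closedBall_mem_nhds z (hr z)))
  refine measure_mono_null (t := ⋃ z ∈ t,
    normalSet K (closedBall z.1 (r z)) ∩ normalSet K (closedBall z.2 (r z))) ?_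
    ((measure_biUnion_null_iff htc).2 fun z hz => hnull z (htP hz))
  rintro x ⟨hxK, e, f, hef, he, hf⟩
  have hmem : (e, f) ∈ P := by
    refine ⟨he.1, hf.1, hef, ?_⟩
    intro hef'
    exact not_isOuterNormal_neg hint hf ((show e = -f from hef') ▸ he)
  obtain ⟨z, hzt, hz⟩ := mem_iUnion₂.1 (hcov hmem)
  rw [mem_closedBall, Prod.dist_eq, max_le_iff] at hz
  exact mem_iUnion₂.2 ⟨z, hzt, ⟨hxK, e, hz.1, he⟩, ⟨hxK, f, hz.2, hf⟩⟩

lemma gaussMap_eq_of_notMem_singularSet {x e : Eu n} (hx : x ∈ K) (hs : x ∉ singularSet K)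
    (he : IsOuterNormal K x e) : gaussMap K x = e := by
  by_contra hne
  exact hs ⟨hx, _, _, hne, gaussMap_isOuterNormal ⟨e, he⟩, he⟩

lemma continuousOn_gaussMap (hK : IsCompact K) (hc : Convex ℝ K) (hint : (interior K).Nonempty)
    {N : Set (Eu n)} (hN : singularSet K ⊆ N) : ContinuousOn (gaussMap K) (frontier K \ N) := by
  rw [continuousOn_iff_isClosed]
  intro C hC
  refine ⟨normalSet K C, (isCompact_normalSet hK hC).isClosed, ?_⟩
  ext x
  constructor
  · rintro ⟨hxC, hx⟩
    exact ⟨⟨hK.isClosed.frontier_subset hx.1, _, hxC,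
      gaussMap_isOuterNormal (exists_isOuterNormal hc hint hx.1)⟩, hx⟩
  · rintro ⟨⟨hxK, e, heC, he⟩, hx⟩
    refine ⟨?_, hx⟩
    rw [mem_preimage, gaussMap_eq_of_notMem_singularSet hxK (fun h => hx.2 (hN h)) he]
    exact heC

lemma aemeasurable_gaussMap {K : Set (Eu (m + 1))} (hK : IsCompact K) (hc : Convex ℝ K)
    (hint : (interior K).Nonempty) :
    AEMeasurable (gaussMap K) ((μH[(m : ℝ)]).restrict (frontier K)) := by
  set N := toMeasurable μH[(m : ℝ)] (singularSet K)
  have hN0 : μH[(m : ℝ)] N = 0 := by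
    rw [measure_toMeasurable, hausdorffMeasure_singularSet hint]
  have hm : MeasurableSet (frontier K \ N) :=
    isClosed_frontier.measurableSet.diff (measurableSet_toMeasurable _ _)
  have h1 := (continuousOn_gaussMap hK hc hint (subset_toMeasurable _ _)).aemeasurable
    (μ := μH[(m : ℝ)]) hm
  rwa [Measure.restrict_congr_set (sdiff_null_ae_eq_self hN0)] at h1

/-- The classical surface area measure. -/
def surfMeasure (K : Set (Eu (m + 1))) : Measure (Eu (m + 1)) :=
  Measure.map (gaussMap K) ((μH[(m : ℝ)]).restrict (frontier K))

lemma surfMeasure_apply_of_isClosed {K : Set (Eu (m + 1))} (hK : IsCompact K) (hc : Convex ℝ K)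
    (hint : (interior K).Nonempty) {C : Set (Eu (m + 1))} (hC : IsClosed C) :
    surfMeasure K C = μH[(m : ℝ)] (normalSet K C) := by
  rw [surfMeasure, Measure.map_apply_of_aemeasurable (aemeasurable_gaussMap hK hc hint)
    hC.measurableSet, Measure.restrict_apply' isClosed_frontier.measurableSet]
  refine le_antisymm (measure_mono ?_) ?_
  · rintro x ⟨hxC, hx⟩
    exact ⟨hK.isClosed.frontier_subset hx, _, hxC,
      gaussMap_isOuterNormal (exists_isOuterNormal hc hint hx)⟩
  · refine (measure_mono (t := (gaussMap K ⁻¹' C ∩ frontier K) ∪ singularSet K) ?_).trans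
      ((measure_union_le _ _).trans (by rw [hausdorffMeasure_singularSet hint, add_zero]))
    rintro x ⟨hxK, e, heC, he⟩
    by_cases hs : x ∈ singularSet K
    · exact Or.inr hs
    · refine Or.inl ⟨?_, he.mem_frontier hxK⟩
      rwa [mem_preimage, gaussMap_eq_of_notMem_singularSet hxK hs he]

lemma isFiniteMeasure_surfMeasure {K : Set (Eu (m + 1))} (hK : IsCompact K) (hc : Convex ℝ K)
    (hint : (interior K).Nonempty) : IsFiniteMeasure (surfMeasure K) := by
  have : IsFiniteMeasure ((μH[(m : ℝ)]).restrict (frontier K)) :=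
    ⟨by rw [Measure.restrict_apply_univ]; exact hausdorffMeasure_frontier_lt_top hK hc hint⟩
  unfold surfMeasure
  infer_instance

end NormalCone

section CutVolume

variable {m : ℕ} {K C : Set (Eu (m + 1))}

/-- The body `K` with a layer of thickness `t` removed along the directions in `C`. -/
def cutBody {n : ℕ} (K C : Set (Eu n)) (t : ℝ) : Set (Eu n) :=
  {z ∈ K | ∀ e ∈ C, ⟪z, e⟫ ≤ suppFn K e - t}

/-- Boundary points lying within `t` of a supporting hyperplane with normal in `C`. -/
def nearSet {n : ℕ} (K C : Set (Eu n)) (t : ℝ) : Set (Eu n) :=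
  {x ∈ frontier K | ∃ e ∈ C, suppFn K e - t ≤ ⟪x, e⟫}

lemma cutBody_eq_inter {n : ℕ} (K C : Set (Eu n)) (t : ℝ) :
    cutBody K C t = K ∩ ⋂ e ∈ C, {z | ⟪z, e⟫ ≤ suppFn K e - t} := by
  ext z; simp [cutBody]

lemma isCompact_cutBody {n : ℕ} {K : Set (Eu n)} (hK : IsCompact K) (C : Set (Eu n)) (t : ℝ) :
    IsCompact (cutBody K C t) := by
  rw [cutBody_eq_inter]
  exact hK.inter_right (isClosed_biInter fun e _ => isClosed_le (by fun_prop) continuous_const)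

lemma convex_cutBody {n : ℕ} {K : Set (Eu n)} (hc : Convex ℝ K) (C : Set (Eu n)) (t : ℝ) :
    Convex ℝ (cutBody K C t) := by
  rw [cutBody_eq_inter]
  refine hc.inter (convex_iInter₂ fun e _ => ?_)
  exact convex_halfSpace_le ⟨fun x y => inner_add_left x y e,
    fun c x => by rw [inner_smul_left]; rfl⟩ _

lemma isCompact_nearSet {n : ℕ} {K C : Set (Eu n)} (hK : IsCompact K) (hne : K.Nonempty)
    (hC : IsCompact C) (t : ℝ) : IsCompact (nearSet K C t) := by
  have hf : IsCompact (frontier K) := hK.of_isClosed_subset isClosed_frontier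
    hK.isClosed.frontier_subset
  have hcomp : IsCompact ((frontier K) ×ˢ C ∩
      {z : Eu n × Eu n | suppFn K z.2 - t ≤ ⟪z.1, z.2⟫}) := by
    refine (hf.prod hC).inter_right ?_
    exact isClosed_le (((continuous_suppFn hK hne).comp continuous_snd).sub continuous_const)
      (continuous_fst.inner continuous_snd)
  convert hcomp.image continuous_fst
  ext x
  constructor
  · rintro ⟨hx, e, heC, he⟩
    exact ⟨(x, e), ⟨⟨hx, heC⟩, he⟩, rfl⟩
  · rintro ⟨⟨y, e⟩, ⟨⟨hy, heC⟩, hle⟩, rfl⟩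
    exact ⟨hy, e, heC, hle⟩

lemma volume_diff_cutBody_le {γ : ℝ≥0∞} (hγ : (μH[(m : ℝ)] : Measure (Eu m)) = γ • volume)
    (hK : IsCompact K) (hne : K.Nonempty) (hC : IsCompact C) {u : Eu (m + 1)} (hu : ‖u‖ = 1)
    {δ : ℝ} (hδ : δ < 1) (hCu : C ⊆ closedBall u δ) (t : ℝ) :
    γ * volume (K \ cutBody K C t) ≤ ENNReal.ofReal (t / (1 - δ)) * μH[(m : ℝ)] (nearSet K C t) := by
  obtain ⟨q, ι, hq, hrec, hqι, hvol⟩ := exists_line_coordinates u hu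
  have hδ' : 0 < 1 - δ := by linarith
  have hin : ∀ e ∈ C, 1 - δ ≤ ⟪u, e⟫ := fun e he => by
    have h1 := hCu he
    rw [mem_closedBall, dist_eq_norm] at h1
    have h2 := (abs_le.1 (abs_real_inner_le_norm u (e - u))).1
    rw [inner_sub_right, real_inner_self_eq_norm_sq, hu] at h2
    linarith
  have hfib : ∀ y, volume {a : ℝ | a • u + ι y ∈ K \ cutBody K C t} ≤
      (q '' nearSet K C t).indicator (fun _ => ENNReal.ofReal (t / (1 - δ))) y := by
    intro y
    rcases ({a : ℝ | a • u + ι y ∈ K \ cutBody K C t}).eq_empty_or_nonempty with h0 | ⟨a₀, ha₀⟩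
    · rw [h0, measure_empty]; exact bot_le
    have hcont : Continuous fun a : ℝ => a • u + ι y := by fun_prop
    have hcoord : ∀ a : ℝ, ⟪a • u + ι y, u⟫ = a + ⟪ι y, u⟫ := fun a => by
      rw [inner_add_left, inner_smul_left, real_inner_self_eq_norm_sq, hu]; simp
    have hFc : IsCompact {a : ℝ | a • u + ι y ∈ K} := by
      refine Metric.isCompact_of_isClosed_isBounded (hK.isClosed.preimage hcont) ?_
      obtain ⟨R, hR⟩ := hK.isBounded.exists_norm_le
      refine (Metric.isBounded_closedBall (x := (0 : ℝ)) (r := R + ‖ι y‖)).subset fun a ha => ?_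
      have h1 := hR _ ha
      have h2 : ‖a • u‖ ≤ ‖a • u + ι y‖ + ‖ι y‖ := by
        simpa using norm_sub_le (a • u + ι y) (ι y)
      rw [norm_smul, hu, mul_one] at h2
      rw [mem_closedBall_zero_iff]
      linarith
    obtain ⟨b, hbK, hb⟩ := hFc.exists_isMaxOn ⟨a₀, ha₀.1⟩ continuousOn_id
    have hb' : ∀ a : ℝ, a • u + ι y ∈ K → a ≤ b := fun a ha => hb ha
    have hkey : ∀ a : ℝ, a • u + ι y ∈ K \ cutBody K C t → ∃ e ∈ C,
        suppFn K e - t ≤ ⟪b • u + ι y, e⟫ ∧ b - a ≤ t / (1 - δ) := by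
      rintro a ⟨haK, hac⟩
      have hex : ∃ e ∈ C, suppFn K e - t < ⟪a • u + ι y, e⟫ := by
        by_contra! hcon
        exact hac ⟨haK, hcon⟩
      obtain ⟨e, heC, he⟩ := hex
      have h1 : ⟪b • u + ι y, e⟫ = ⟪a • u + ι y, e⟫ + (b - a) * ⟪u, e⟫ := by
        simp only [inner_add_left, inner_smul_left, RCLike.conj_to_real]; ring
      have h2 : (b - a) * (1 - δ) ≤ (b - a) * ⟪u, e⟫ :=
        mul_le_mul_of_nonneg_left (hin e heC) (by linarith [hb' a haK])
      have h3 : 0 ≤ (b - a) * (1 - δ) := mul_nonneg (by linarith [hb' a haK]) hδ'.le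
      have h4 := inner_le_suppFn hK hbK e
      refine ⟨e, heC, by linarith, ?_⟩
      rw [le_div_iff₀ hδ']
      linarith
    have hmem : y ∈ q '' nearSet K C t := by
      obtain ⟨e, heC, he, -⟩ := hkey a₀ ha₀
      refine ⟨b • u + ι y, ⟨⟨subset_closure hbK, fun hbi => ?_⟩, e, heC, he⟩, hqι b y⟩
      obtain ⟨ε, hε, hball⟩ := Metric.isOpen_iff.1
        (isOpen_interior.preimage hcont : IsOpen _) b hbi
      have h1 := hball (show b + ε / 2 ∈ ball b ε by
        rw [mem_ball, Real.dist_eq, add_sub_cancel_left, abs_of_pos (by positivity)]; linarith)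
      have h2 := hb' _ (interior_subset h1)
      linarith
    rw [indicator_of_mem hmem]
    calc volume {a : ℝ | a • u + ι y ∈ K \ cutBody K C t}
        ≤ volume (Icc (b - t / (1 - δ)) b) := by
          refine measure_mono fun a ha => ⟨?_, hb' a ha.1⟩
          obtain ⟨_, _, _, h⟩ := hkey a ha
          linarith
      _ = _ := by rw [Real.volume_Icc]; congr 1; ring
  have hqm : MeasurableSet (q '' nearSet K C t) :=
    ((isCompact_nearSet hK hne hC t).image q.continuous).measurableSet
  rw [hvol _ (hK.measurableSet.diff (isCompact_cutBody hK C t).measurableSet)]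
  calc γ * ∫⁻ y, volume {a : ℝ | a • u + ι y ∈ K \ cutBody K C t}
      ≤ γ * ∫⁻ y, (q '' nearSet K C t).indicator (fun _ => ENNReal.ofReal (t / (1 - δ))) y := by
        gcongr with y; exact hfib y
    _ = ENNReal.ofReal (t / (1 - δ)) * μH[(m : ℝ)] (q '' nearSet K C t) := by
        rw [lintegral_indicator_const hqm, hγ, Measure.smul_apply, smul_eq_mul]; ring
    _ ≤ _ := by gcongr; exact hausdorffMeasure_image_le_of_coordinates hq _

lemma iInter_nearSet (hK : IsCompact K) (hne : K.Nonempty) (hC : IsCompact C)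
    (hCs : C ⊆ sphere 0 1) : ⋂ t > (0 : ℝ), nearSet K C t = normalSet K C := by
  ext x
  simp only [mem_iInter]
  constructor
  · intro h
    have hxf : x ∈ frontier K := (h 1 one_pos).1
    have hxK := hK.isClosed.frontier_subset hxf
    obtain ⟨-, e₁, he₁, -⟩ := h 1 one_pos
    obtain ⟨e, heC, he⟩ := hC.exists_isMinOn (f := fun e => suppFn K e - ⟪x, e⟫) ⟨e₁, he₁⟩
      ((continuous_suppFn hK hne).sub (by fun_prop)).continuousOn
    refine ⟨hxK, e, heC, (isOuterNormal_iff hK hxK).2 ⟨by simpa using hCs heC, ?_⟩⟩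
    refine le_of_forall_pos_le_add fun t ht => ?_
    obtain ⟨-, f, hf, hft⟩ := h t ht
    have h1 : suppFn K e - ⟪x, e⟫ ≤ suppFn K f - ⟪x, f⟫ := he hf
    linarith
  · rintro ⟨hxK, e, heC, he⟩ t ht
    refine ⟨he.mem_frontier hxK, e, heC, ?_⟩
    rw [he.inner_eq hK hxK]
    linarith [show (0 : ℝ) < t from ht]

lemma tendsto_hausdorffMeasure_nearSet (hK : IsCompact K) (hc : Convex ℝ K)
    (hint : (interior K).Nonempty) (hC : IsCompact C) (hCs : C ⊆ sphere 0 1) :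
    Tendsto (fun t => μH[(m : ℝ)] (nearSet K C t)) (𝓝[>] 0) (𝓝 (μH[(m : ℝ)] (normalSet K C))) := by
  have hne := hint.mono interior_subset
  rw [← iInter_nearSet hK hne hC hCs]
  refine tendsto_measure_biInter_gt
    (fun t _ => (isCompact_nearSet hK hne hC t).measurableSet.nullMeasurableSet) ?_ ?_
  · rintro s t - hst x ⟨hx, e, heC, he⟩
    exact ⟨hx, e, heC, by linarith⟩
  · exact ⟨1, one_pos, ((measure_mono fun x hx => hx.1).trans_lt
      (hausdorffMeasure_frontier_lt_top hK hc hint)).ne⟩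

lemma eventually_volume_diff_cutBody_le {γ : ℝ≥0∞}
    (hγ : (μH[(m : ℝ)] : Measure (Eu m)) = γ • volume)
    (hK : IsCompact K) (hc : Convex ℝ K) (hint : (interior K).Nonempty)
    {δ : ℝ} (hδ0 : 0 < δ) (hδ : δ < 1) (hC : IsCompact C) (hCs : C ⊆ sphere 0 1) :
    ∀ η : ℝ≥0∞, 0 < η → ∀ᶠ t in 𝓝[>] (0 : ℝ), γ * volume (K \ cutBody K C t) ≤
      ENNReal.ofReal (t / (1 - δ)) * (surfMeasure K C + η) := by
  have hne := hint.mono interior_subset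
  have hfin := isFiniteMeasure_surfMeasure hK hc hint
  have hex : ∀ u : Eu (m + 1), ∃ r ∈ Ioo (δ / 2) δ, surfMeasure K (sphere u r) = 0 := by
    intro u
    obtain ⟨r, hr, hnull⟩ := exists_null_frontier_thickening (surfMeasure K) {u}
      (show δ / 2 < δ by linarith)
    rw [thickening_singleton, frontier_ball _ (by linarith [hr.1])] at hnull
    exact ⟨r, hr, hnull⟩
  choose r hr hnull using hex
  obtain ⟨s, hs⟩ := (isCompact_sphere (0 : Eu (m + 1)) 1).elim_finite_subcover
    (fun u : sphere (0 : Eu (m + 1)) 1 => ball (u : Eu (m + 1)) (r u)) (fun _ => isOpen_ball)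
    (fun u hu => mem_iUnion.2 ⟨⟨u, hu⟩, mem_ball_self (by linarith [(hr u).1])⟩)
  replace hs := hCs.trans hs
  induction s using Finset.induction_on generalizing C with
  | empty =>
    intro η hη
    have hC0 : C = ∅ := by simpa using hs
    refine Eventually.of_forall fun t => ?_
    have : cutBody K C t = K := by
      subst hC0; simp [cutBody]
    rw [this, sdiff_self, measure_empty, mul_zero]
    exact bot_le
  | insert u s _ ih =>
    intro η hη
    have hu : ‖(u : Eu (m + 1))‖ = 1 := by simp
    have hη2 : 0 < η / 2 := ENNReal.half_pos hη.ne'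
    set D := C \ ball (u : Eu (m + 1)) (r u) with hD
    set F := C ∩ closedBall (u : Eu (m + 1)) (r u) with hF
    have hDc : IsCompact D := hC.diff isOpen_ball
    have hFc : IsCompact F := hC.inter_right isClosed_closedBall
    have hCDF : C = D ∪ F := by
      ext z
      by_cases hz : z ∈ ball (u : Eu (m + 1)) (r u)
      · simp [hD, hF, hz, ball_subset_closedBall hz]
      · simp only [hD, hF, mem_union, Set.mem_sdiff, hz, not_false_eq_true, and_true, mem_inter_iff]
        tauto
    have h1 := ih hDc (sdiff_subset.trans hCs) (by
      rintro z ⟨hzC, hzb⟩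
      have := hs hzC
      rw [Finset.set_biUnion_insert] at this
      exact this.resolve_left hzb) (η / 2) hη2
    have hFu : F ⊆ closedBall (u : Eu (m + 1)) δ :=
      inter_subset_right.trans (closedBall_subset_closedBall (hr u).2.le)
    have h2 : ∀ᶠ t in 𝓝[>] (0 : ℝ),
        μH[(m : ℝ)] (nearSet K F t) < surfMeasure K F + η / 2 := by
      have hlim := tendsto_hausdorffMeasure_nearSet hK hc hint hFc (inter_subset_left.trans hCs)
      rw [← surfMeasure_apply_of_isClosed hK hc hint hFc.isClosed] at hlim
      exact hlim.eventually_lt_const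
        (ENNReal.lt_add_right (measure_ne_top _ _) hη2.ne')
    have hadd : surfMeasure K D + surfMeasure K F ≤ surfMeasure K C := by
      rw [← measure_union_add_inter D hFc.measurableSet, ← hCDF]
      have : surfMeasure K (D ∩ F) = 0 := by
        refine measure_mono_null ?_ (hnull u)
        rintro z ⟨⟨-, hz⟩, -, hz'⟩
        exact le_antisymm hz' (not_lt.1 hz)
      rw [this, add_zero]
    filter_upwards [h1, h2] with t h1 h2
    have hsub : K \ cutBody K C t ⊆ (K \ cutBody K D t) ∪ (K \ cutBody K F t) := by
      rintro z ⟨hzK, hz⟩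
      by_contra hcon
      simp only [mem_union, Set.mem_sdiff, hzK, true_and, not_or, not_not] at hcon
      refine hz ⟨hzK, fun e he => ?_⟩
      rw [hCDF] at he
      exact he.elim (hcon.1.2 e) (hcon.2.2 e)
    calc γ * volume (K \ cutBody K C t)
        ≤ γ * (volume (K \ cutBody K D t) + volume (K \ cutBody K F t)) := by
          gcongr; exact (measure_mono hsub).trans (measure_union_le _ _)
      _ = γ * volume (K \ cutBody K D t) + γ * volume (K \ cutBody K F t) := mul_add _ _ _
      _ ≤ ENNReal.ofReal (t / (1 - δ)) * (surfMeasure K D + η / 2) +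
          ENNReal.ofReal (t / (1 - δ)) * (surfMeasure K F + η / 2) := by
          refine add_le_add h1 ((volume_diff_cutBody_le hγ hK hne hFc hu hδ hFu t).trans ?_)
          gcongr
      _ = ENNReal.ofReal (t / (1 - δ)) * (surfMeasure K D + surfMeasure K F + (η / 2 + η / 2)) := by
          ring
      _ ≤ _ := by rw [ENNReal.add_halves]; gcongr

lemma mul_le_surfMeasure_of_eventually_le {γ : ℝ≥0∞}
    (hγ : (μH[(m : ℝ)] : Measure (Eu m)) = γ • volume)
    (hK : IsCompact K) (hc : Convex ℝ K) (hint : (interior K).Nonempty)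
    (hC : IsCompact C) (hCs : C ⊆ sphere 0 1) {a : ℝ≥0∞}
    (ha : ∀ᶠ t in 𝓝[>] (0 : ℝ), ENNReal.ofReal t * a ≤ volume (K \ cutBody K C t)) :
    γ * a ≤ surfMeasure K C := by
  have hfin := isFiniteMeasure_surfMeasure hK hc hint
  have hstep : ∀ δ : ℝ, 0 < δ → δ < 1 →
      γ * a ≤ ENNReal.ofReal (1 / (1 - δ)) * (surfMeasure K C + ENNReal.ofReal δ) := by
    intro δ hδ0 hδ
    have h1 := eventually_volume_diff_cutBody_le hγ hK hc hint hδ0 hδ hC hCs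
      (ENNReal.ofReal δ) (ENNReal.ofReal_pos.2 hδ0)
    obtain ⟨t, ⟨h1, h2⟩, ht⟩ := ((h1.and ha).and self_mem_nhdsWithin).exists
    have ht' : (0 : ℝ) < t := ht
    have ht0 : ENNReal.ofReal t ≠ 0 := by simpa using ht'
    have h3 : ENNReal.ofReal t * (γ * a) ≤ ENNReal.ofReal t *
        (ENNReal.ofReal (1 / (1 - δ)) * (surfMeasure K C + ENNReal.ofReal δ)) := by
      rw [← mul_assoc (ENNReal.ofReal t) (ENNReal.ofReal _), ← ENNReal.ofReal_mul ht'.le,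
        mul_one_div]
      calc ENNReal.ofReal t * (γ * a) = γ * (ENNReal.ofReal t * a) := by ring
        _ ≤ γ * volume (K \ cutBody K C t) := by gcongr
        _ ≤ _ := h1
    exact (ENNReal.mul_le_mul_iff_right ht0 ENNReal.ofReal_ne_top).1 h3
  have hlim : Tendsto (fun δ : ℝ => ENNReal.ofReal (1 / (1 - δ)) *
      (surfMeasure K C + ENNReal.ofReal δ)) (𝓝[>] 0) (𝓝 (surfMeasure K C)) := by
    have hA : Tendsto (fun δ : ℝ => ENNReal.ofReal (1 / (1 - δ))) (𝓝 0) (𝓝 1) := by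
      have : ContinuousAt (fun δ : ℝ => 1 / (1 - δ)) 0 :=
        continuousAt_const.div (by fun_prop) (by norm_num)
      have h := (ENNReal.continuous_ofReal.tendsto _).comp this.tendsto
      simpa [Function.comp_def] using h
    have hB : Tendsto (fun δ : ℝ => surfMeasure K C + ENNReal.ofReal δ) (𝓝 0)
        (𝓝 (surfMeasure K C)) := by
      have h := (tendsto_const_nhds (x := surfMeasure K C)).add (ENNReal.continuous_ofReal.tendsto 0)
      simpa using h
    have h := ENNReal.Tendsto.mul hA (Or.inl one_ne_zero) hB (Or.inr ENNReal.one_ne_top)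
    rw [one_mul] at h
    exact h.mono_left nhdsWithin_le_nhds
  refine ge_of_tendsto hlim ?_
  filter_upwards [Ioo_mem_nhdsGT (show (0 : ℝ) < 1 by norm_num)] with δ hδ
  exact hstep δ hδ.1 hδ.2

end CutVolume

section ConeGain

variable {m : ℕ} {K Y : Set (Eu (m + 1))}

/-- The part near `Y` of the layer between `K` and its dilate by `1 + t`. -/
def dilationLayer {n : ℕ} (K Y : Set (Eu n)) (R t : ℝ) : Set (Eu n) :=
  (((fun x => (1 + t) • x) '' K) \ K) ∩ cthickening (R * t) Y

lemma measurableSet_dilationLayer {n : ℕ} {K : Set (Eu n)} (hK : IsCompact K) (Y : Set (Eu n))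
    (R t : ℝ) : MeasurableSet (dilationLayer K Y R t) :=
  ((hK.image (continuous_const_smul (1 + t))).measurableSet.diff hK.measurableSet).inter
    isClosed_cthickening.measurableSet

lemma suppFn_gaussMap_le {n : ℕ} {K : Set (Eu n)} (hK : IsCompact K) (hc : Convex ℝ K)
    (hint : (interior K).Nonempty) {R : ℝ} (hR : ∀ x ∈ K, ‖x‖ ≤ R) {x : Eu n}
    (hx : x ∈ frontier K) : suppFn K (gaussMap K x) ≤ R := by
  have hn := gaussMap_isOuterNormal (exists_isOuterNormal hc hint hx)
  have := abs_suppFn_le hK (hint.mono interior_subset) hR (gaussMap K x)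
  rw [hn.1, mul_one] at this
  exact (le_abs_self _).trans this

lemma eventually_add_smul_mem_dilate {n : ℕ} {K Y : Set (Eu n)} (hK : IsCompact K)
    (hc : Convex ℝ K) (h0 : (0 : Eu n) ∈ K) {R : ℝ} (hR : ∀ x ∈ K, ‖x‖ ≤ R) {u : Eu n}
    (hu : ‖u‖ = 1) {δ : ℝ} (hδ0 : 0 < δ) (hY : IsCompact Y) (hYs : Y ∩ singularSet K = ∅)
    (hYu : Y ⊆ normalSet K (closedBall u δ)) :
    ∀ᶠ t in 𝓝[>] (0 : ℝ), ∀ x ∈ Y, ∀ s : ℝ, 0 ≤ s →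
      s ≤ t * max (suppFn K u - 2 * δ * R) 0 → x + s • u ∈ (fun x => (1 + t) • x) '' K := by
  have hne : K.Nonempty := ⟨0, h0⟩
  set κ := max (suppFn K u - 2 * δ * R) 0
  have hκ : 0 ≤ κ := le_max_right _ _
  have hE : IsCompact (sphere (0 : Eu n) 1 \ ball u (2 * δ)) := (isCompact_sphere 0 1).diff isOpen_ball
  obtain ⟨η, hη, hslack⟩ := (hY.prod hE).exists_forall_le'
    (f := fun z : Eu n × Eu n => suppFn K z.2 - ⟪z.1, z.2⟫) (a := 0)
    ((((continuous_suppFn hK hne).comp continuous_snd).sub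
      (continuous_fst.inner continuous_snd)).continuousOn) (by
      rintro ⟨x, e⟩ ⟨hx, he, heb⟩
      obtain ⟨hxK, f, hf, hfn⟩ := hYu hx
      by_contra hcon
      have hen : IsOuterNormal K x e := (isOuterNormal_iff hK hxK).2
        ⟨by simpa using he, by simpa using hcon⟩
      have hef : e = f := by
        by_contra hne
        exact (eq_empty_iff_forall_notMem.1 hYs x) ⟨hx, hxK, e, f, hne, hen, hfn⟩
      subst hef
      rw [mem_closedBall] at hf
      exact heb (mem_ball.2 (by linarith)))
  have hsmall : ∀ᶠ t in 𝓝[>] (0 : ℝ), t * κ < η := by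
    have : Tendsto (fun t : ℝ => t * κ) (𝓝[>] 0) (𝓝 0) := by
      have h : Continuous fun t : ℝ => t * κ := by fun_prop
      simpa using (h.tendsto 0).mono_left nhdsWithin_le_nhds
    exact this.eventually_lt_const hη
  filter_upwards [hsmall, self_mem_nhdsWithin] with t ht ht0 x hx s hs hst
  have ht0 : (0 : ℝ) < t := ht0
  refine mem_of_forall_inner_le_suppFn (hK.image (continuous_const_smul (1 + t)))
    (hc.smul (1 + t)) (hne.image _) fun e he => ?_
  rw [suppFn_smul_set (by linarith), inner_add_left, inner_smul_left]
  have hxK := (hYu hx).1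
  have hue : ⟪u, e⟫ ≤ 1 := by simpa [hu, he] using real_inner_le_norm u e
  have h1 : s * ⟪u, e⟫ ≤ s := mul_le_of_le_one_right hs hue
  have hhe := suppFn_nonneg hK h0 e
  have h2 := inner_le_suppFn hK hxK e
  simp only [RCLike.conj_to_real]
  by_cases hnear : e ∈ ball u (2 * δ)
  · rw [mem_ball, dist_eq_norm, norm_sub_rev] at hnear
    have hR0 : 0 ≤ R := (norm_nonneg _).trans (hR 0 h0)
    have h3 := suppFn_sub_le hK hne hR u e
    have h4 := mul_le_mul_of_nonneg_left hnear.le hR0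
    have h5 : κ ≤ suppFn K e := max_le (by linarith) hhe
    have h6 := mul_le_mul_of_nonneg_left h5 ht0.le
    linarith
  · have h3 := hslack (x, e) ⟨hx, by simpa using he, hnear⟩
    have h4 := mul_nonneg ht0.le hhe
    simp only at h3
    linarith

lemma eventually_le_volume_dilationLayer {γ : ℝ≥0∞}
    (hγ : (μH[(m : ℝ)] : Measure (Eu m)) = γ • volume)
    (hK : IsCompact K) (hc : Convex ℝ K) (h0 : (0 : Eu (m + 1)) ∈ K) {R : ℝ}
    (hR : ∀ x ∈ K, ‖x‖ ≤ R) {u : Eu (m + 1)} (hu : ‖u‖ = 1) {δ : ℝ} (hδ0 : 0 < δ) (hδ : δ < 1)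
    {k : ℝ≥0} (hk : 1 ≤ (k : ℝ) ^ 2 * (1 - δ ^ 2)) (hY : IsCompact Y)
    (hYs : Y ∩ singularSet K = ∅) (hYu : Y ⊆ normalSet K (closedBall u δ)) :
    ∀ᶠ t in 𝓝[>] (0 : ℝ),
      ENNReal.ofReal (t * max (suppFn K u - 2 * δ * R) 0) * μH[(m : ℝ)] Y ≤
        (k : ℝ≥0∞) ^ (m : ℝ) * (γ * volume (dilationLayer K Y R t)) := by
  have hne : K.Nonempty := ⟨0, h0⟩
  have hR0 : 0 ≤ R := (norm_nonneg _).trans (hR 0 h0)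
  obtain ⟨q, ι, hq, hrec, hqι, hvol⟩ := exists_line_coordinates u hu
  set κ := max (suppFn K u - 2 * δ * R) 0
  have hκR : κ ≤ R := by
    refine max_le ?_ hR0
    have := abs_suppFn_le hK hne hR u
    rw [hu, mul_one] at this
    have := (le_abs_self _).trans this
    nlinarith
  filter_upwards [eventually_add_smul_mem_dilate hK hc h0 hR hu hδ0 hY hYs hYu,
    self_mem_nhdsWithin] with t hmem ht0
  have ht0 : (0 : ℝ) < t := ht0
  have hqm : MeasurableSet (q '' Y) := (hY.image q.continuous).measurableSet
  have hfib : ∀ y, (q '' Y).indicator (fun _ => ENNReal.ofReal (t * κ)) y ≤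
      volume {a : ℝ | a • u + ι y ∈ dilationLayer K Y R t} := by
    intro y
    by_cases hy : y ∈ q '' Y
    · rw [indicator_of_mem hy]
      obtain ⟨x, hx, rfl⟩ := hy
      have hsub : Ioc ⟪x, u⟫ (⟪x, u⟫ + t * κ) ⊆
          {a : ℝ | a • u + ι (q x) ∈ dilationLayer K Y R t} := by
        rintro a ⟨ha1, ha2⟩
        have hax : a • u + ι (q x) = x + (a - ⟪x, u⟫) • u := by
          conv_rhs => rw [hrec x]
          have : ⟪⟪x, u⟫ • u + ι (q x), u⟫ = ⟪x, u⟫ := by rw [← hrec x]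
          rw [this, sub_smul]; abel
        rw [mem_ofPred_eq, hax]
        obtain ⟨hxK, e, heu, he⟩ := hYu hx
        refine ⟨⟨hmem x hx _ (by linarith) (by linarith), fun hK' => ?_⟩, ?_⟩
        · have h1 := he.2 _ hK'
          rw [inner_add_left, inner_smul_left] at h1
          simp only [RCLike.conj_to_real] at h1
          rw [mem_closedBall, dist_eq_norm] at heu
          have h2 := (abs_le.1 (abs_real_inner_le_norm u (e - u))).1
          rw [inner_sub_right, real_inner_self_eq_norm_sq, hu] at h2
          have h3 : 0 < (a - ⟪x, u⟫) * ⟪u, e⟫ := mul_pos (by linarith) (by linarith)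
          linarith
        · refine mem_cthickening_of_dist_le _ x _ _ hx ?_
          rw [dist_eq_norm, add_sub_cancel_left, norm_smul, hu, mul_one, Real.norm_eq_abs,
            abs_of_pos (by linarith)]
          have := mul_le_mul_of_nonneg_left hκR ht0.le
          linarith
      refine le_trans (le_of_eq ?_) (measure_mono hsub)
      rw [Real.volume_Ioc, add_sub_cancel_left]
    · rw [indicator_of_notMem hy]; exact bot_le
  calc ENNReal.ofReal (t * κ) * μH[(m : ℝ)] Y
      ≤ ENNReal.ofReal (t * κ) * ((k : ℝ≥0∞) ^ (m : ℝ) * μH[(m : ℝ)] (q '' Y)) := by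
        gcongr; exact hausdorffMeasure_le_of_normals_near hq hk hYu
    _ = (k : ℝ≥0∞) ^ (m : ℝ) *
        (γ * ∫⁻ y, (q '' Y).indicator (fun _ => ENNReal.ofReal (t * κ)) y) := by
        rw [lintegral_indicator_const hqm, hγ, Measure.smul_apply, smul_eq_mul]; ring
    _ ≤ _ := by
        rw [hvol _ (measurableSet_dilationLayer hK Y R t)]
        gcongr with y
        exact hfib y

lemma volume_dilationLayer_add_le {n : ℕ} {K Y₁ Y₂ Y : Set (Eu n)} (hK : IsCompact K)
    (h₁ : IsCompact Y₁) (h₂ : IsCompact Y₂) (hd : Disjoint Y₁ Y₂) (h₁Y : Y₁ ⊆ Y) (h₂Y : Y₂ ⊆ Y)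
    (R : ℝ) : ∀ᶠ t in 𝓝[>] (0 : ℝ), volume (dilationLayer K Y₁ R t) +
      volume (dilationLayer K Y₂ R t) ≤ volume (dilationLayer K Y R t) := by
  obtain ⟨ε, hε, hdis⟩ := hd.exists_cthickenings h₁ h₂.isClosed
  have hsmall : ∀ᶠ t in 𝓝[>] (0 : ℝ), R * t < ε := by
    have : Tendsto (fun t : ℝ => R * t) (𝓝[>] 0) (𝓝 0) := by
      have h : Continuous fun t : ℝ => R * t := by fun_prop
      simpa using (h.tendsto 0).mono_left nhdsWithin_le_nhds
    exact this.eventually_lt_const hε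
  filter_upwards [hsmall] with t ht
  have hdis' : Disjoint (dilationLayer K Y₁ R t) (dilationLayer K Y₂ R t) :=
    hdis.mono (inter_subset_right.trans (cthickening_mono ht.le _))
      (inter_subset_right.trans (cthickening_mono ht.le _))
  rw [← measure_union hdis' (measurableSet_dilationLayer hK _ _ _)]
  refine measure_mono (union_subset ?_ ?_)
  · exact inter_subset_inter_right _ (cthickening_subset_of_subset _ h₁Y)
  · exact inter_subset_inter_right _ (cthickening_subset_of_subset _ h₂Y)

lemma eventually_lintegral_le_volume_dilationLayer {γ : ℝ≥0∞}
    (hγ : (μH[(m : ℝ)] : Measure (Eu m)) = γ • volume)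
    (hK : IsCompact K) (hc : Convex ℝ K) (hint : (interior K).Nonempty)
    (h0 : (0 : Eu (m + 1)) ∈ K) {R : ℝ} (hR : ∀ x ∈ K, ‖x‖ ≤ R) {δ : ℝ} (hδ0 : 0 < δ)
    (hδ : δ < 1) {k : ℝ≥0} (hk : 1 ≤ (k : ℝ) ^ 2 * (1 - δ ^ 2)) (s : Finset (Eu (m + 1)))
    (hs : ∀ u ∈ s, ‖u‖ = 1) (hY : IsCompact Y) (hYs : Y ∩ singularSet K = ∅)
    (hYcov : Y ⊆ normalSet K (⋃ u ∈ s, closedBall u δ)) (η : ℝ≥0∞) (hη : 0 < η) :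
    ∀ᶠ t in 𝓝[>] (0 : ℝ),
      ENNReal.ofReal t * ∫⁻ x in Y, ENNReal.ofReal (suppFn K (gaussMap K x)) ∂μH[(m : ℝ)] ≤
        (k : ℝ≥0∞) ^ (m : ℝ) * (γ * volume (dilationLayer K Y R t)) +
          ENNReal.ofReal t * (ENNReal.ofReal (3 * δ * R) * μH[(m : ℝ)] Y + η) := by
  have hne : K.Nonempty := ⟨0, h0⟩
  have hR0 : 0 ≤ R := (norm_nonneg _).trans (hR 0 h0)
  induction s using Finset.induction_on generalizing Y η with
  | empty =>
    have hY0 : Y = ∅ := by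
      refine subset_empty_iff.1 fun x hx => ?_
      obtain ⟨-, e, he, -⟩ := hYcov hx
      simp at he
    subst hY0
    simp
  | insert u s _ ih =>
    have hu := hs u (Finset.mem_insert_self u s)
    have hη2 : 0 < η / 2 := ENNReal.half_pos hη.ne'
    have hYf : Y ⊆ frontier K := hYcov.trans (normalSet_subset_frontier _)
    have hYfin : μH[(m : ℝ)] Y < ∞ :=
      (measure_mono hYf).trans_lt (hausdorffMeasure_frontier_lt_top hK hc hint)
    have hNc : IsCompact (normalSet K (closedBall u δ)) := isCompact_normalSet hK isClosed_closedBall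
    set Y₁ := Y ∩ normalSet K (closedBall u δ) with hY₁
    have hY₁c : IsCompact Y₁ := hY.inter hNc
    set Z := Y \ normalSet K (closedBall u δ) with hZ
    have hZm : MeasurableSet Z := hY.measurableSet.diff hNc.measurableSet
    have : IsFiniteMeasure ((μH[(m : ℝ)] : Measure (Eu (m + 1))).restrict Y) :=
      ⟨by rwa [Measure.restrict_apply_univ]⟩
    obtain ⟨ε, hε0, hε⟩ : ∃ ε : ℝ≥0∞, ε ≠ 0 ∧ ENNReal.ofReal R * ε ≤ η / 2 := by
      refine ⟨η / 2 / (ENNReal.ofReal R + 1), ?_, ?_⟩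
      · exact (ENNReal.div_pos hη2.ne' (by simp)).ne'
      · calc ENNReal.ofReal R * (η / 2 / (ENNReal.ofReal R + 1))
            ≤ (ENNReal.ofReal R + 1) * (η / 2 / (ENNReal.ofReal R + 1)) := by
              gcongr; exact le_self_add
          _ = η / 2 := ENNReal.mul_div_cancel (by simp) (by simp)
    obtain ⟨Y₂, hY₂Z, hY₂c, hY₂⟩ := hZm.exists_isCompact_sdiff_lt
      (μ := (μH[(m : ℝ)] : Measure (Eu (m + 1))).restrict Y) (measure_ne_top _ _) hε0
    have hY₂Y : Y₂ ⊆ Y := hY₂Z.trans sdiff_subset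
    rw [Measure.restrict_apply (hZm.diff hY₂c.measurableSet),
      inter_eq_self_of_subset_left (sdiff_subset.trans sdiff_subset)] at hY₂
    have hdisj : Disjoint Y₁ Y₂ := by
      refine disjoint_left.2 fun x hx hx2 => (hY₂Z hx2).2 hx.2
    have hYsub : ∀ {Y'}, Y' ⊆ Y → Y' ∩ singularSet K = ∅ := fun h =>
      subset_empty_iff.1 (hYs ▸ inter_subset_inter_left _ h)
    have hcov₂ : Y₂ ⊆ normalSet K (⋃ u ∈ s, closedBall u δ) := by
      intro x hx
      obtain ⟨hxK, e, he, hen⟩ := hYcov (hY₂Y hx)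
      rw [Finset.set_biUnion_insert] at he
      refine ⟨hxK, e, he.resolve_left fun he' => (hY₂Z hx).2 ⟨hxK, e, he', hen⟩, hen⟩
    have hI : ∫⁻ x in Y, ENNReal.ofReal (suppFn K (gaussMap K x)) ∂μH[(m : ℝ)] ≤
        ENNReal.ofReal (max (suppFn K u - 2 * δ * R) 0 + 3 * δ * R) * μH[(m : ℝ)] Y₁ +
        ∫⁻ x in Y₂, ENNReal.ofReal (suppFn K (gaussMap K x)) ∂μH[(m : ℝ)] + η / 2 := by
      have hYeq : Y = (Y₁ ∪ Y₂) ∪ (Z \ Y₂) := by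
        ext x
        constructor
        · intro hx
          by_cases h1 : x ∈ normalSet K (closedBall u δ)
          · exact Or.inl (Or.inl ⟨hx, h1⟩)
          · by_cases h2 : x ∈ Y₂
            · exact Or.inl (Or.inr h2)
            · exact Or.inr ⟨⟨hx, h1⟩, h2⟩
        · rintro ((hx | hx) | hx)
          · exact hx.1
          · exact hY₂Y hx
          · exact hx.1.1
      conv_lhs => rw [hYeq]
      refine (lintegral_union_le _ _ _).trans (add_le_add ((lintegral_union_le _ _ _).trans
        (add_le_add ?_ le_rfl)) ?_)
      · rw [← setLIntegral_const]
        refine setLIntegral_mono' hY₁c.measurableSet fun x hx => ENNReal.ofReal_le_ofReal ?_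
        obtain ⟨hxK, e, heu, he⟩ := hx.2
        have hge : gaussMap K x = e := gaussMap_eq_of_notMem_singularSet hxK
          (fun h => eq_empty_iff_forall_notMem.1 hYs x ⟨hx.1, h⟩) he
        rw [hge]
        rw [mem_closedBall, dist_eq_norm] at heu
        have h1 := suppFn_sub_le hK hne hR e u
        have h2 := mul_le_mul_of_nonneg_left heu hR0
        have h3 := le_max_left (suppFn K u - 2 * δ * R) 0
        linarith
      · calc ∫⁻ x in Z \ Y₂, ENNReal.ofReal (suppFn K (gaussMap K x)) ∂μH[(m : ℝ)]
            ≤ ∫⁻ _ in Z \ Y₂, ENNReal.ofReal R ∂μH[(m : ℝ)] := by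
              refine setLIntegral_mono' (hZm.diff hY₂c.measurableSet) fun x hx =>
                ENNReal.ofReal_le_ofReal ?_
              exact suppFn_gaussMap_le hK hc hint hR (hYf hx.1.1)
          _ = ENNReal.ofReal R * μH[(m : ℝ)] (Z \ Y₂) := setLIntegral_const _ _
          _ ≤ _ := (mul_le_mul_right hY₂.le _).trans hε
    have hY₁Y : Y₁ ⊆ Y := inter_subset_left
    filter_upwards [eventually_le_volume_dilationLayer hγ hK hc h0 hR hu hδ0 hδ hk hY₁c
        (hYsub hY₁Y) inter_subset_right,
      ih (fun v hv => hs v (Finset.mem_insert_of_mem hv)) hY₂c (hYsub hY₂Y) hcov₂ (η / 2) hη2,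
      volume_dilationLayer_add_le hK hY₁c hY₂c hdisj hY₁Y hY₂Y R, self_mem_nhdsWithin]
      with t e1 e2 e3 ht
    have ht : (0 : ℝ) < t := ht
    have hYadd : μH[(m : ℝ)] Y₁ + μH[(m : ℝ)] Y₂ ≤ μH[(m : ℝ)] Y := by
      rw [← measure_union hdisj hY₂c.measurableSet]
      exact measure_mono (union_subset hY₁Y hY₂Y)
    set κ := max (suppFn K u - 2 * δ * R) 0
    have hκ : 0 ≤ κ := le_max_right _ _
    set I₂ := ∫⁻ x in Y₂, ENNReal.ofReal (suppFn K (gaussMap K x)) ∂μH[(m : ℝ)]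
    set T := ENNReal.ofReal t
    set A := (k : ℝ≥0∞) ^ (m : ℝ)
    set c := ENNReal.ofReal (3 * δ * R)
    rw [ENNReal.ofReal_add hκ (by positivity)] at hI
    rw [ENNReal.ofReal_mul ht.le] at e1
    calc T * _ ≤ T * ((ENNReal.ofReal κ + c) * μH[(m : ℝ)] Y₁ + I₂ + η / 2) := by gcongr
      _ = T * ENNReal.ofReal κ * μH[(m : ℝ)] Y₁ + T * I₂ + T * (c * μH[(m : ℝ)] Y₁ + η / 2) := by
        ring
      _ ≤ A * (γ * volume (dilationLayer K Y₁ R t)) + (A * (γ * volume (dilationLayer K Y₂ R t)) +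
          T * (c * μH[(m : ℝ)] Y₂ + η / 2)) + T * (c * μH[(m : ℝ)] Y₁ + η / 2) := by gcongr
      _ = A * (γ * (volume (dilationLayer K Y₁ R t) + volume (dilationLayer K Y₂ R t))) +
          T * (c * (μH[(m : ℝ)] Y₁ + μH[(m : ℝ)] Y₂) + (η / 2 + η / 2)) := by ring
      _ ≤ _ := by rw [ENNReal.add_halves]; gcongr

lemma volume_image_dilate {n : ℕ} (K : Set (Eu n)) {c : ℝ} (hc : 0 ≤ c) :
    volume ((fun x => c • x) '' K) = ENNReal.ofReal (c ^ n) * volume K := by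
  have h := Measure.addHaar_smul (volume : Measure (Eu n)) c K
  rw [finrank_euclideanSpace, Fintype.card_fin, abs_of_nonneg (pow_nonneg hc n)] at h
  exact h

lemma subset_image_dilate {n : ℕ} {K : Set (Eu n)} (hc : Convex ℝ K) (h0 : (0 : Eu n) ∈ K)
    {c : ℝ} (h1 : 1 ≤ c) : K ⊆ (fun x => c • x) '' K := by
  intro x hx
  have hc0 : 0 < c := by linarith
  refine ⟨c⁻¹ • x, ?_, smul_inv_smul₀ hc0.ne' x⟩
  exact hc.smul_mem_of_zero_mem h0 hx ⟨by positivity, inv_le_one_of_one_le₀ h1⟩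

lemma volume_dilationLayer_le {n : ℕ} {K : Set (Eu n)} (hK : IsCompact K) (hc : Convex ℝ K)
    (h0 : (0 : Eu n) ∈ K) (Y : Set (Eu n)) (R : ℝ) {t : ℝ} (ht : 0 < t) :
    volume (dilationLayer K Y R t) ≤ ENNReal.ofReal ((1 + t) ^ n - 1) * volume K := by
  refine (measure_mono inter_subset_left).trans ?_
  rw [measure_sdiff (subset_image_dilate hc h0 (by linarith)) hK.measurableSet.nullMeasurableSet
    hK.measure_lt_top.ne, volume_image_dilate K (by linarith), ENNReal.ofReal_sub _ zero_le_one,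
    ENNReal.sub_mul fun _ _ => hK.measure_lt_top.ne, ENNReal.ofReal_one, one_mul]

lemma lintegral_regular_le {γ : ℝ≥0∞} (hγ0 : γ ≠ ∞)
    (hγ : (μH[(m : ℝ)] : Measure (Eu m)) = γ • volume)
    (hK : IsCompact K) (hc : Convex ℝ K) (hint : (interior K).Nonempty)
    (h0 : (0 : Eu (m + 1)) ∈ K) {R : ℝ} (hR : ∀ x ∈ K, ‖x‖ ≤ R) {δ : ℝ} (hδ0 : 0 < δ)
    (hδ : δ < 1) {k : ℝ≥0} (hk : 1 ≤ (k : ℝ) ^ 2 * (1 - δ ^ 2)) (hY : IsCompact Y)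
    (hYs : Y ∩ singularSet K = ∅) (hYf : Y ⊆ frontier K) {η : ℝ≥0∞} (hη : 0 < η) :
    ∫⁻ x in Y, ENNReal.ofReal (suppFn K (gaussMap K x)) ∂μH[(m : ℝ)] ≤
      (k : ℝ≥0∞) ^ (m : ℝ) * (γ * ((m + 1 : ℕ) * volume K)) +
        (ENNReal.ofReal (3 * δ * R) * μH[(m : ℝ)] (frontier K) + η) := by
  obtain ⟨s, hs1, hs⟩ := (isCompact_sphere (0 : Eu (m + 1)) 1).elim_nhds_subcover
    (fun u => closedBall u δ) (fun u _ => closedBall_mem_nhds u hδ0)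
  have hcov : Y ⊆ normalSet K (⋃ u ∈ s, closedBall u δ) := by
    intro x hx
    obtain ⟨e, he⟩ := exists_isOuterNormal hc hint (hYf hx)
    exact ⟨hK.isClosed.frontier_subset (hYf hx), e, hs (by simpa using he.1), he⟩
  have hev := eventually_lintegral_le_volume_dilationLayer hγ hK hc hint h0 hR hδ0 hδ hk s
    (fun u hu => by simpa using hs1 u hu) hY hYs hcov η hη
  have hev2 : ∀ᶠ t in 𝓝[>] (0 : ℝ),
      ∫⁻ x in Y, ENNReal.ofReal (suppFn K (gaussMap K x)) ∂μH[(m : ℝ)] ≤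
      (k : ℝ≥0∞) ^ (m : ℝ) * (γ * (ENNReal.ofReal (t⁻¹ * ((1 + t) ^ (m + 1) - 1)) * volume K)) +
        (ENNReal.ofReal (3 * δ * R) * μH[(m : ℝ)] (frontier K) + η) := by
    filter_upwards [hev, self_mem_nhdsWithin] with t ht ht0
    have ht0 : (0 : ℝ) < t := ht0
    have hT : ENNReal.ofReal t ≠ 0 := by simpa using ht0
    refine (ENNReal.mul_le_mul_iff_right hT ENNReal.ofReal_ne_top).1 (ht.trans ?_)
    have hvol := volume_dilationLayer_le hK hc h0 Y R ht0
    have hpow : ENNReal.ofReal ((1 + t) ^ (m + 1) - 1) =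
        ENNReal.ofReal t * ENNReal.ofReal (t⁻¹ * ((1 + t) ^ (m + 1) - 1)) := by
      rw [← ENNReal.ofReal_mul ht0.le, mul_inv_cancel_left₀ ht0.ne']
    rw [hpow] at hvol
    calc _ ≤ (k : ℝ≥0∞) ^ (m : ℝ) * (γ * (ENNReal.ofReal t *
            ENNReal.ofReal (t⁻¹ * ((1 + t) ^ (m + 1) - 1)) * volume K)) +
          ENNReal.ofReal t * (ENNReal.ofReal (3 * δ * R) * μH[(m : ℝ)] (frontier K) + η) := by
          gcongr
      _ = _ := by ring
  refine ge_of_tendsto ?_ hev2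
  refine Tendsto.add ?_ tendsto_const_nhds
  have hd : Tendsto (fun t : ℝ => t⁻¹ * ((1 + t) ^ (m + 1) - 1)) (𝓝[>] 0) (𝓝 ((m + 1 : ℕ) : ℝ)) := by
    have h1 : HasDerivAt (fun t : ℝ => (1 + t) ^ (m + 1)) ((m + 1 : ℕ) : ℝ) 0 := by
      have := ((hasDerivAt_id (0 : ℝ)).const_add 1).fun_pow (m + 1)
      simpa using this
    have h2 := h1.tendsto_slope_zero_right
    simpa using h2
  have h3 : Tendsto (fun t : ℝ => ENNReal.ofReal (t⁻¹ * ((1 + t) ^ (m + 1) - 1)) * volume K)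
      (𝓝[>] 0) (𝓝 ((m + 1 : ℕ) * volume K)) := by
    have := (ENNReal.continuous_ofReal.tendsto _).comp hd
    rw [ENNReal.ofReal_natCast] at this
    exact ENNReal.Tendsto.mul_const this (Or.inr hK.measure_lt_top.ne)
  exact ENNReal.Tendsto.const_mul (ENNReal.Tendsto.const_mul h3 (Or.inr hγ0))
    (Or.inr (ENNReal.rpow_ne_top_of_nonneg (by positivity) ENNReal.coe_ne_top))

/-- The support function integrates against the surface area measure to at most `n` times the
volume, up to the normalisation of the Hausdorff measure. -/
lemma lintegral_suppFn_surfMeasure_le {γ : ℝ≥0∞} (hγ0 : γ ≠ ∞)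
    (hγ : (μH[(m : ℝ)] : Measure (Eu m)) = γ • volume)
    (hK : IsCompact K) (hc : Convex ℝ K) (hint : (interior K).Nonempty)
    (h0 : (0 : Eu (m + 1)) ∈ K) :
    ∫⁻ e, ENNReal.ofReal (suppFn K e) ∂surfMeasure K ≤ γ * ((m + 1 : ℕ) * volume K) := by
  obtain ⟨R, hR⟩ := hK.isBounded.exists_norm_le
  have hR0 : 0 ≤ R := (norm_nonneg _).trans (hR 0 h0)
  have hfin := hausdorffMeasure_frontier_lt_top hK hc hint
  have hfm : IsFiniteMeasure ((μH[(m : ℝ)] : Measure (Eu (m + 1))).restrict (frontier K)) :=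
    ⟨by rwa [Measure.restrict_apply_univ]⟩
  have hcont := continuous_suppFn hK (hint.mono interior_subset)
  rw [surfMeasure, lintegral_map' (by fun_prop) (aemeasurable_gaussMap hK hc hint)]
  set N := toMeasurable μH[(m : ℝ)] (singularSet K)
  have hN0 : μH[(m : ℝ)] N = 0 := by
    rw [measure_toMeasurable, hausdorffMeasure_singularSet hint]
  have hFm : MeasurableSet (frontier K \ N) :=
    isClosed_frontier.measurableSet.diff (measurableSet_toMeasurable _ _)
  have hstep : ∀ δ : ℝ, 0 < δ → δ < 1 →
      ∫⁻ x in frontier K, ENNReal.ofReal (suppFn K (gaussMap K x)) ∂μH[(m : ℝ)] ≤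
      ((√(1 - δ ^ 2))⁻¹.toNNReal : ℝ≥0∞) ^ (m : ℝ) * (γ * ((m + 1 : ℕ) * volume K)) +
        (ENNReal.ofReal (3 * δ * R) * μH[(m : ℝ)] (frontier K) + ENNReal.ofReal δ) +
        ENNReal.ofReal R * ENNReal.ofReal δ := by
    intro δ hδ0 hδ
    have hδ2 : 0 < 1 - δ ^ 2 := by nlinarith
    have hk : 1 ≤ (((√(1 - δ ^ 2))⁻¹.toNNReal : ℝ≥0) : ℝ) ^ 2 * (1 - δ ^ 2) := by
      rw [Real.coe_toNNReal _ (by positivity), inv_pow, Real.sq_sqrt hδ2.le,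
        inv_mul_cancel₀ hδ2.ne']
    obtain ⟨Y, hYF, hYc, hY⟩ := hFm.exists_isCompact_sdiff_lt
      (μ := (μH[(m : ℝ)] : Measure (Eu (m + 1))).restrict (frontier K)) (measure_ne_top _ _)
      (ENNReal.ofReal_pos.2 hδ0).ne'
    rw [Measure.restrict_apply (hFm.diff hYc.measurableSet),
      inter_eq_self_of_subset_left (sdiff_subset.trans sdiff_subset)] at hY
    have hYs : Y ∩ singularSet K = ∅ := by
      refine eq_empty_iff_forall_notMem.2 fun x hx => ?_
      exact (hYF hx.1).2 (subset_toMeasurable _ _ hx.2)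
    have hmain := lintegral_regular_le hγ0 hγ hK hc hint h0 hR hδ0 hδ hk hYc hYs
      (hYF.trans sdiff_subset) (ENNReal.ofReal_pos.2 hδ0)
    rw [← Measure.restrict_congr_set (sdiff_null_ae_eq_self hN0)]
    have hsplit : frontier K \ N = Y ∪ ((frontier K \ N) \ Y) := (union_sdiff_cancel hYF).symm
    rw [hsplit]
    refine (lintegral_union_le _ _ _).trans (add_le_add hmain ?_)
    calc ∫⁻ x in (frontier K \ N) \ Y, ENNReal.ofReal (suppFn K (gaussMap K x)) ∂μH[(m : ℝ)]
        ≤ ∫⁻ _ in (frontier K \ N) \ Y, ENNReal.ofReal R ∂μH[(m : ℝ)] := by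
          refine setLIntegral_mono' (hFm.diff hYc.measurableSet) fun x hx =>
            ENNReal.ofReal_le_ofReal ?_
          exact suppFn_gaussMap_le hK hc hint hR hx.1.1
      _ = ENNReal.ofReal R * μH[(m : ℝ)] ((frontier K \ N) \ Y) := setLIntegral_const _ _
      _ ≤ _ := mul_le_mul_right hY.le _
  have hlim : Tendsto (fun δ : ℝ =>
      ((√(1 - δ ^ 2))⁻¹.toNNReal : ℝ≥0∞) ^ (m : ℝ) * (γ * ((m + 1 : ℕ) * volume K)) +
        (ENNReal.ofReal (3 * δ * R) * μH[(m : ℝ)] (frontier K) + ENNReal.ofReal δ) +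
        ENNReal.ofReal R * ENNReal.ofReal δ) (𝓝[>] 0) (𝓝 (γ * ((m + 1 : ℕ) * volume K))) := by
    have hA : Tendsto (fun δ : ℝ => ((√(1 - δ ^ 2))⁻¹.toNNReal : ℝ≥0∞) ^ (m : ℝ) *
        (γ * ((m + 1 : ℕ) * volume K))) (𝓝 0) (𝓝 (γ * ((m + 1 : ℕ) * volume K))) := by
      have h1 : ContinuousAt (fun δ : ℝ => (√(1 - δ ^ 2))⁻¹) 0 :=
        ContinuousAt.inv₀ (by fun_prop) (by norm_num)
      have h2 := (ENNReal.continuous_rpow_const (y := (m : ℝ))).tendsto _ |>.comp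
        ((ENNReal.continuous_ofReal.tendsto _).comp h1.tendsto)
      have h3 := ENNReal.Tendsto.mul_const (b := γ * ((m + 1 : ℕ) * volume K)) h2
        (Or.inr (ENNReal.mul_ne_top hγ0 (ENNReal.mul_ne_top (by simp) hK.measure_lt_top.ne)))
      simpa [Function.comp_def, ENNReal.ofReal] using h3
    have hB : Tendsto (fun δ : ℝ => ENNReal.ofReal (3 * δ * R) * μH[(m : ℝ)] (frontier K))
        (𝓝 0) (𝓝 0) := by
      have h1 : Continuous fun δ : ℝ => ENNReal.ofReal (3 * δ * R) :=
        ENNReal.continuous_ofReal.comp (by fun_prop)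
      have h2 := ENNReal.Tendsto.mul_const (h1.tendsto 0) (Or.inr hfin.ne)
      simpa using h2
    have hC : Tendsto (fun δ : ℝ => ENNReal.ofReal δ) (𝓝 0) (𝓝 0) := by
      simpa using ENNReal.continuous_ofReal.tendsto 0
    have hD : Tendsto (fun δ : ℝ => ENNReal.ofReal R * ENNReal.ofReal δ) (𝓝 0) (𝓝 0) := by
      simpa using ENNReal.Tendsto.const_mul hC (Or.inr (ENNReal.ofReal_ne_top (r := R)))
    have := (hA.add (hB.add hC)).add hD
    simp only [add_zero] at this
    exact this.mono_left nhdsWithin_le_nhds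
  refine ge_of_tendsto hlim ?_
  filter_upwards [Ioo_mem_nhdsGT (show (0 : ℝ) < 1 by norm_num)] with δ hδ
  exact hstep δ hδ.1 hδ.2

end ConeGain

section Averaging

variable {n : ℕ} {H : Type*} [Group H] [TopologicalSpace H] [IsTopologicalGroup H] [CompactSpace H]
  {ρ : H →* (Eu n ≃ₗᵢ[ℝ] Eu n)}

/-- An inequality between finite invariant measures which holds on all invariant compact subsets
of the sphere holds on all Borel sets. -/
lemma measure_le_of_le_on_invariant_compacts (hρ : Continuous fun z : H × Eu n => ρ z.1 z.2)
    {ν τ : Measure (Eu n)} [IsFiniteMeasure ν] [IsFiniteMeasure τ]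
    (hν : ∀ g, Measure.map (ρ g) ν = ν) (hτ : ∀ g, Measure.map (ρ g) τ = τ)
    (hνs : ν (sphere (0 : Eu n) 1)ᶜ = 0)
    (h : ∀ A : Set (Eu n), IsCompact A → A ⊆ sphere 0 1 → (∀ g, ρ g '' A = A) → ν A ≤ τ A) :
    ν ≤ τ := by
  have hborel : ∀ A : Set (Eu n), MeasurableSet A → (∀ g, ρ g ⁻¹' A = A) → ν A ≤ τ A := by
    intro A hA hinv
    refine ENNReal.le_of_forall_pos_le_add fun ε hε _ => ?_
    have hAm : MeasurableSet (A ∩ sphere 0 1) := hA.inter isClosed_sphere.measurableSet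
    obtain ⟨F, hFA, hFc, hF⟩ := hAm.exists_isCompact_lt_add (μ := ν) (measure_ne_top _ _)
      (ε := ε) (by exact_mod_cast hε.ne')
    have hνA : ν A = ν (A ∩ sphere 0 1) := by
      rw [← measure_inter_add_sdiff A isClosed_sphere.measurableSet,
        measure_mono_null (s := A \ sphere 0 1) (fun x hx => hx.2) hνs, add_zero]
    set B : Set (Eu n) := (fun z : H × Eu n => ρ z.1 z.2) '' (univ ×ˢ F) with hB
    have hBc : IsCompact B := (isCompact_univ.prod hFc).image hρ
    have hFB : F ⊆ B := fun x hx => ⟨(1, x), ⟨mem_univ _, hx⟩, by simp⟩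
    have hBA : B ⊆ A := by
      rintro _ ⟨⟨g, x⟩, ⟨-, hx⟩, rfl⟩
      have : x ∈ ρ g ⁻¹' A := by rw [hinv]; exact (hFA hx).1
      exact this
    have hBs : B ⊆ sphere 0 1 := by
      rintro _ ⟨⟨g, x⟩, ⟨-, hx⟩, rfl⟩
      have := (hFA hx).2
      simpa using this
    have hsub : ∀ g, ρ g '' B ⊆ B := by
      rintro g _ ⟨_, ⟨⟨g', x⟩, ⟨-, hx⟩, rfl⟩, rfl⟩
      exact ⟨(g * g', x), ⟨mem_univ _, hx⟩, by simp [map_mul]⟩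
    have hBinv : ∀ g, ρ g '' B = B := by
      refine fun g => (hsub g).antisymm fun x hx => ?_
      refine ⟨ρ g⁻¹ x, hsub g⁻¹ ⟨x, hx, rfl⟩, ?_⟩
      change (ρ g * ρ g⁻¹) x = x
      rw [← map_mul]
      simp
    calc ν A = ν (A ∩ sphere 0 1) := hνA
      _ ≤ ν F + ε := hF.le
      _ ≤ ν B + ε := by gcongr
      _ ≤ τ B + ε := add_le_add (h B hBc hBs hBinv) le_rfl
      _ ≤ τ A + ε := by gcongr
  refine Measure.le_iff.2 fun ω hω => ?_
  borelize H
  let η : Measure H := Measure.haar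
  have hjoint : Measurable fun z : H × Eu n => ρ z.1⁻¹ z.2 :=
    (hρ.comp (continuous_fst.inv.prodMk continuous_snd)).measurable
  have hpre : MeasurableSet ((fun z : H × Eu n => ρ z.1⁻¹ z.2) ⁻¹' ω) := hjoint hω
  set f : Eu n → ℝ≥0∞ := fun e => η {g | ρ g⁻¹ e ∈ ω} with hf
  have hfm : Measurable f := measurable_measure_prodMk_right hpre
  have hfinv : ∀ g e, f (ρ g e) = f e := by
    intro g e
    have : {g' | ρ g'⁻¹ (ρ g e) ∈ ω} = (fun x => g⁻¹ * x) ⁻¹' {g' | ρ g'⁻¹ e ∈ ω} := by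
      ext g'
      simp only [mem_ofPred_eq, mem_preimage, mul_inv_rev, inv_inv, map_mul]
      exact Iff.rfl
    rw [hf]
    simp only
    rw [this, measure_preimage_mul]
  have hint : ∀ τ : Measure (Eu n), IsFiniteMeasure τ → (∀ g, Measure.map (ρ g) τ = τ) →
      ∫⁻ e, f e ∂τ = η univ * τ ω := by
    intro τ hτf hτ
    have h1 := Measure.prod_apply_symm (μ := η) (ν := τ) hpre
    have h2 := Measure.prod_apply (μ := η) (ν := τ) hpre
    have h3 : ∀ g : H, τ (Prod.mk g ⁻¹' ((fun z : H × Eu n => ρ z.1⁻¹ z.2) ⁻¹' ω)) = τ ω := by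
      intro g
      conv_rhs => rw [← hτ g⁻¹]
      rw [Measure.map_apply (ρ g⁻¹).continuous.measurable hω]
      rfl
    simp only [h3, lintegral_const] at h2
    rw [mul_comm, ← h2, h1]
    rfl
  have hmap : Measure.map f ν ≤ Measure.map f τ := by
    refine Measure.le_iff.2 fun B hB => ?_
    rw [Measure.map_apply hfm hB, Measure.map_apply hfm hB]
    refine hborel _ (hfm hB) fun g => ?_
    ext e
    simp [hfinv]
  have hle : ∫⁻ e, f e ∂ν ≤ ∫⁻ e, f e ∂τ := by
    have h1 := lintegral_map (μ := ν) (f := fun x : ℝ≥0∞ => x) measurable_id hfm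
    have h2 := lintegral_map (μ := τ) (f := fun x : ℝ≥0∞ => x) measurable_id hfm
    rw [← h1, ← h2]
    exact lintegral_mono' hmap le_rfl
  rw [hint ν inferInstance hν, hint τ inferInstance hτ] at hle
  have hη0 : η univ ≠ 0 := isOpen_univ.measure_ne_zero _ univ_nonempty
  exact (ENNReal.mul_le_mul_iff_right hη0 (measure_ne_top _ _)).1 hle

end Averaging

section Selection

variable {n : ℕ}

/-- Blaschke's selection principle. -/
lemma exists_subseq_hausdorff_limit {R : ℝ} (M : ℕ → Set (Eu n)) (hM : ∀ i, IsCompact (M i))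
    (hne : ∀ i, (M i).Nonempty) (hR : ∀ i, M i ⊆ closedBall 0 R) :
    ∃ (K : Set (Eu n)) (φ : ℕ → ℕ), IsCompact K ∧ K.Nonempty ∧ StrictMono φ ∧
      ∀ ε > 0, ∀ᶠ i in atTop, (∀ x ∈ K, ∃ y ∈ M (φ i), dist x y < ε) ∧
        ∀ y ∈ M (φ i), ∃ x ∈ K, dist x y < ε := by
  let B := closedBall (0 : Eu n) R
  have hB : IsCompact B := isCompact_closedBall _ _
  have : CompactSpace B := isCompact_iff_compactSpace.1 hB
  have himg : ∀ i, Subtype.val '' ((Subtype.val : B → Eu n) ⁻¹' M i) = M i := fun i => by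
    rw [Subtype.image_preimage_coe]; exact inter_eq_right.2 (hR i)
  let N : ℕ → TopologicalSpace.NonemptyCompacts B := fun i =>
    ⟨⟨(Subtype.val : B → Eu n) ⁻¹' M i, by
        rw [Subtype.isCompact_iff, himg]; exact hM i⟩, by
        obtain ⟨x, hx⟩ := hne i
        exact ⟨⟨x, hR i hx⟩, hx⟩⟩
  obtain ⟨L, φ, hφ, hL⟩ := CompactSpace.tendsto_subseq N
  refine ⟨Subtype.val '' (L : Set B), φ, L.isCompact.image continuous_subtype_val,
    L.nonempty.image _, hφ, fun ε hε => ?_⟩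
  filter_upwards [Metric.tendsto_nhds.1 hL ε hε] with i hi
  rw [NonemptyCompacts.dist_eq] at hi
  have hfin : hausdorffEDist (N (φ i) : Set B) (L : Set B) ≠ ⊤ :=
    hausdorffEDist_ne_top_of_nonempty_of_bounded (N (φ i)).nonempty L.nonempty
      (N (φ i)).isCompact.isBounded L.isCompact.isBounded
  constructor
  · rintro _ ⟨x, hx, rfl⟩
    obtain ⟨y, hy, hxy⟩ := exists_dist_lt_of_hausdorffDist_lt' hx hi hfin
    exact ⟨y, hy, by rw [dist_comm]; exact hxy⟩
  · intro y hy
    obtain ⟨x, hx, hxy⟩ := exists_dist_lt_of_hausdorffDist_lt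
      (x := (⟨y, hR _ hy⟩ : B)) (show _ ∈ (N (φ i) : Set B) from hy) hi hfin
    exact ⟨x, ⟨x, hx, rfl⟩, by rw [dist_comm]; exact hxy⟩

/-- The point of minimal norm of a closed convex set is fixed by every linear isometry that
preserves the set. -/
lemma exists_fixed_point_of_isometry_invariant {ι : Type*} {ρ : ι → Eu n ≃ₗᵢ[ℝ] Eu n}
    {C : Set (Eu n)} (hC : IsClosed C) (hc : Convex ℝ C) (hne : C.Nonempty)
    (hinv : ∀ g, ∀ x ∈ C, ρ g x ∈ C) : ∃ x ∈ C, ∀ g, ρ g x = x := by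
  obtain ⟨v, hv, hmin⟩ := exists_norm_eq_iInf_of_complete_convex hne hC.isComplete hc 0
  rw [norm_eq_iInf_iff_real_inner_le_zero hc hv] at hmin
  refine ⟨v, hv, fun g => ?_⟩
  have h1 := hmin _ (hinv g v hv)
  rw [zero_sub, inner_neg_left, inner_sub_right, real_inner_self_eq_norm_sq] at h1
  have h2 := norm_sub_sq_real (ρ g v) v
  rw [(ρ g).norm_map, real_inner_comm] at h2
  have h3 : ‖ρ g v - v‖ = 0 := by nlinarith [norm_nonneg (ρ g v - v)]
  exact sub_eq_zero.1 (norm_eq_zero.1 h3)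

lemma suppFn_image_sub {K : Set (Eu n)} (hK : IsCompact K) (hne : K.Nonempty) (v u : Eu n) :
    suppFn ((fun x => x - v) '' K) u = suppFn K u - ⟪v, u⟫ := by
  refine le_antisymm (suppFn_le (hne.image _) ?_) ?_
  · rintro _ ⟨x, hx, rfl⟩
    rw [inner_sub_left]
    linarith [inner_le_suppFn hK hx u]
  · obtain ⟨x, hx, hxu⟩ := exists_inner_eq_suppFn hK hne u
    rw [← hxu, ← inner_sub_left]
    exact inner_le_suppFn (hK.image (continuous_id.sub continuous_const)) ⟨x, hx, rfl⟩ u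

lemma suppFn_image_isometry {K : Set (Eu n)} (T : Eu n ≃ₗᵢ[ℝ] Eu n) (hT : T '' K = K) (u : Eu n) :
    suppFn K (T u) = suppFn K u := by
  unfold suppFn
  congr 1
  conv_lhs => rw [← hT]
  rw [image_image]
  simp

lemma suppFn_le_add_of_dist {K M : Set (Eu n)} (hne : K.Nonempty) (hM : IsCompact M) {ε : ℝ}
    (h : ∀ x ∈ K, ∃ y ∈ M, dist x y < ε) {u : Eu n} (hu : ‖u‖ = 1) :
    suppFn K u ≤ suppFn M u + ε := by
  refine suppFn_le hne fun x hx => ?_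
  obtain ⟨y, hy, hxy⟩ := h x hx
  have h1 : ⟪x - y, u⟫ ≤ ‖x - y‖ * ‖u‖ := real_inner_le_norm _ _
  rw [hu, mul_one, ← dist_eq_norm, inner_sub_left] at h1
  linarith [inner_le_suppFn hM hy u]

lemma suppFn_mono {K M : Set (Eu n)} (hne : K.Nonempty) (hM : IsCompact M) (h : K ⊆ M) (u : Eu n) :
    suppFn K u ≤ suppFn M u :=
  suppFn_le hne fun _ hx => inner_le_suppFn hM (h hx) u

end Selection

section Variational

variable {n : ℕ} {ι : Type*} {p : ℝ} {μ : Measure (Eu n)} {Ω D M K : Set (Eu n)}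
  {ρ : ι → Eu n ≃ₗᵢ[ℝ] Eu n} {T : Eu n →L[ℝ] Eu n}

/-- The data of the variational problem: convex bodies are sought inside the closed convex cone
`D`, up to translations in the range of the projection `T`. -/
structure VariationalData (p : ℝ) (μ : Measure (Eu n)) (Ω D : Set (Eu n))
    (ρ : ι → Eu n ≃ₗᵢ[ℝ] Eu n) (T : Eu n →L[ℝ] Eu n) : Prop where
  pos : 0 < p
  lt_one : p < 1
  ae_mem : ∀ᵐ u ∂μ, u ∈ Ω
  norm_eq : ∀ u ∈ Ω, ‖u‖ = 1
  isClosed : IsClosed D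
  convex : Convex ℝ D
  zero_mem : (0 : Eu n) ∈ D
  smul_mem : ∀ c : ℝ, 0 ≤ c → ∀ x ∈ D, c • x ∈ D
  interior_nonempty : (interior D).Nonempty
  add_mem : ∀ x ∈ D, ∀ y, x + T y ∈ D
  idem : ∀ x, T (T x) = T x
  inner_le : ∀ x ∈ D, ∀ u ∈ Ω, ⟪T x, u⟫ ≤ ⟪x, u⟫
  coercive : ∃ c > 0, (∀ x ∈ D, c * ‖x - T x‖ ^ p ≤ ∫ u, ⟪x - T x, u⟫ ^ p ∂μ) ∧
    ∀ x, c * ‖T x‖ ^ p ≤ ∫ u, |⟪T x, u⟫| ^ p ∂μ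
  isometry_image : ∀ g, ρ g '' D = D
  isometry_comm : ∀ g x, T (ρ g x) = ρ g (T x)
  map_eq : ∀ g, Measure.map (ρ g) μ = μ

/-- The invariant compact convex subsets of `D`. -/
structure IsCompetitor (D : Set (Eu n)) (ρ : ι → Eu n ≃ₗᵢ[ℝ] Eu n) (M : Set (Eu n)) : Prop where
  isCompact : IsCompact M
  convex : Convex ℝ M
  nonempty : M.Nonempty
  subset : M ⊆ D
  image_eq : ∀ g, ρ g '' M = M

lemma IsCompetitor.exists_fixed_point (hM : IsCompetitor D ρ M) : ∃ x ∈ M, ∀ g, ρ g x = x :=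
  exists_fixed_point_of_isometry_invariant hM.isCompact.isClosed hM.convex hM.nonempty
    fun g _ hx => (hM.image_eq g) ▸ mem_image_of_mem _ hx

/-- The energy `∫ (h_M(u) - ⟨Tx, u⟩)^p dμ(u)`. -/
def gapEnergy (p : ℝ) (μ : Measure (Eu n)) (T : Eu n →L[ℝ] Eu n) (M : Set (Eu n)) (x : Eu n) : ℝ :=
  ∫ u, (suppFn M u - ⟪T x, u⟫) ^ p ∂μ

namespace VariationalData

variable (h : VariationalData p μ Ω D ρ T)
include h

lemma restrict_sphere : μ.restrict (sphere 0 1) = μ :=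
  Measure.restrict_eq_self_of_ae_mem <| h.ae_mem.mono fun u hu => by simpa using h.norm_eq u hu

lemma integrable_of_continuous [IsFiniteMeasure μ] {f : Eu n → ℝ} (hf : Continuous f) :
    Integrable f μ := by
  have := hf.continuousOn.integrableOn_compact (μ := μ) (isCompact_sphere (0 : Eu n) 1)
  rwa [IntegrableOn, h.restrict_sphere] at this

lemma integrable_gap [IsFiniteMeasure μ] (hM : IsCompetitor D ρ M) (x : Eu n) :
    Integrable (fun u => (suppFn M u - ⟪T x, u⟫) ^ p) μ :=
  h.integrable_of_continuous <| (Real.continuous_rpow_const h.pos.le).comp <|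
    (continuous_suppFn hM.isCompact hM.nonempty).sub (by fun_prop)

lemma gap_nonneg (hM : IsCompetitor D ρ M) {x u : Eu n} (hx : x ∈ M) (hu : u ∈ Ω) :
    0 ≤ suppFn M u - ⟪T x, u⟫ := by
  linarith [inner_le_suppFn hM.isCompact hx u, h.inner_le x (hM.subset hx) u hu]

lemma continuous_gapEnergy [IsFiniteMeasure μ] (hM : IsCompetitor D ρ M) :
    Continuous (gapEnergy p μ T M) := by
  have := continuous_parametric_integral_of_continuous (μ := μ)
    (f := fun x u => (suppFn M u - ⟪T x, u⟫) ^ p)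
    ((Real.continuous_rpow_const h.pos.le).comp
      (((continuous_suppFn hM.isCompact hM.nonempty).comp continuous_snd).sub (by fun_prop)))
    (isCompact_sphere (0 : Eu n) 1)
  rwa [h.restrict_sphere] at this

lemma gapEnergy_nonneg (hM : IsCompetitor D ρ M) {x : Eu n} (hx : x ∈ M) :
    0 ≤ gapEnergy p μ T M x :=
  integral_nonneg_of_ae <| h.ae_mem.mono fun _ hu => Real.rpow_nonneg (h.gap_nonneg hM hx hu) _

lemma gapEnergy_isometry (hM : IsCompetitor D ρ M) (g : ι) (x : Eu n) :
    gapEnergy p μ T M (ρ g x) = gapEnergy p μ T M x := by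
  unfold gapEnergy
  conv_lhs => rw [← h.map_eq g]
  rw [(show MeasurableEmbedding (ρ g) from
    (ρ g).toHomeomorph.measurableEmbedding).integral_map]
  refine integral_congr_ae <| Eventually.of_forall fun u => ?_
  have : ⟪ρ g (T x), ρ g u⟫ = ⟪T x, u⟫ := (ρ g).inner_map_map _ _
  simp only [suppFn_image_isometry _ (hM.image_eq g),
    h.isometry_comm, this]

lemma isCompetitor_image_sub (hM : IsCompetitor D ρ M) {z : Eu n} (hz : ∀ g, ρ g z = z) :
    IsCompetitor D ρ ((fun x => x - T z) '' M) := by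
  refine ⟨hM.isCompact.image (by fun_prop), ?_, hM.nonempty.image _, ?_, fun g => ?_⟩
  · have := hM.convex.translate (-T z)
    simpa [sub_eq_neg_add] using this
  · rintro _ ⟨x, hx, rfl⟩
    simpa [sub_eq_add_neg] using h.add_mem x (hM.subset hx) (-z)
  · conv_rhs => rw [← hM.image_eq g]
    simp only [image_image, map_sub, ← h.isometry_comm, hz]

lemma gapEnergy_image_sub (hM : IsCompetitor D ρ M) (z x : Eu n) :
    gapEnergy p μ T ((fun x => x - T z) '' M) (x - T z) = gapEnergy p μ T M x := by
  unfold gapEnergy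
  refine integral_congr_ae <| Eventually.of_forall fun u => ?_
  simp only [suppFn_image_sub hM.isCompact hM.nonempty, map_sub, h.idem, inner_sub_left]
  congr 1
  ring

lemma exists_norm_sub_le [IsFiniteMeasure μ] (B : ℝ) : ∃ R, ∀ M, IsCompetitor D ρ M →
    (∀ x ∈ M, gapEnergy p μ T M x ≤ B) → ∀ x ∈ M, ∀ z ∈ M, ‖x - T z‖ ≤ R := by
  obtain ⟨c, hc, h1, h2⟩ := h.coercive
  refine ⟨3 * (max B 0 / c) ^ p⁻¹, fun M hM hB x hx z hz => ?_⟩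
  have key : ∀ a : ℝ, 0 ≤ a → c * a ^ p ≤ B → a ≤ (max B 0 / c) ^ p⁻¹ := fun a ha hab => by
    rw [Real.le_rpow_inv_iff_of_pos ha (by positivity) h.pos, le_div_iff₀ hc, mul_comm]
    exact hab.trans (le_max_left _ _)
  have ha : ‖x - T x‖ ≤ (max B 0 / c) ^ p⁻¹ := by
    refine key _ (norm_nonneg _) ((h1 x (hM.subset hx)).trans (le_trans ?_ (hB x hx)))
    refine integral_mono_ae (h.integrable_of_continuous <|
      (Real.continuous_rpow_const h.pos.le).comp (by fun_prop)) (h.integrable_gap hM x)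
      (h.ae_mem.mono fun u hu => ?_)
    have := h.inner_le x (hM.subset hx) u hu
    have h3 := inner_le_suppFn hM.isCompact hx u
    simp only
    rw [inner_sub_left]
    exact Real.rpow_le_rpow (by linarith) (by linarith) h.pos.le
  have hw : midpoint ℝ x z ∈ M := hM.convex.midpoint_mem hx hz
  have hTw : T (midpoint ℝ x z) = (2⁻¹ : ℝ) • (T x + T z) := by
    rw [midpoint_eq_smul_add, map_smul, map_add]; simp
  have hb : ‖T ((2⁻¹ : ℝ) • (x - z))‖ ≤ (max B 0 / c) ^ p⁻¹ := by
    refine key _ (norm_nonneg _) ((h2 _).trans (le_trans ?_ (hB _ hw)))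
    refine integral_mono_ae (h.integrable_of_continuous <|
      (Real.continuous_rpow_const h.pos.le).comp (by fun_prop)) (h.integrable_gap hM _)
      (h.ae_mem.mono fun u hu => ?_)
    have e1 := h.inner_le x (hM.subset hx) u hu
    have e2 := inner_le_suppFn hM.isCompact hx u
    have e3 := h.inner_le z (hM.subset hz) u hu
    have e4 := inner_le_suppFn hM.isCompact hz u
    simp only
    refine Real.rpow_le_rpow (abs_nonneg _) ?_ h.pos.le
    rw [hTw, map_smul, map_sub, inner_smul_left, inner_smul_left, inner_sub_left, inner_add_left]
    simp only [conj_trivial]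
    rw [abs_le]
    constructor <;> linarith
  have hb' : ‖T x - T z‖ ≤ 2 * (max B 0 / c) ^ p⁻¹ := by
    rw [map_smul, map_sub, norm_smul] at hb
    norm_num at hb
    linarith
  calc ‖x - T z‖ = ‖(x - T x) + (T x - T z)‖ := by congr 1; abel
    _ ≤ _ := norm_add_le _ _
    _ ≤ _ := by linarith

lemma concave_gapEnergy [IsFiniteMeasure μ] (hM : IsCompetitor D ρ M) :
    ConcaveOn ℝ M (gapEnergy p μ T M) := by
  refine ⟨hM.convex, fun x hx y hy a b ha hb hab => ?_⟩
  unfold gapEnergy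
  simp only [smul_eq_mul]
  rw [← integral_const_mul, ← integral_const_mul, ← integral_add
    ((h.integrable_gap hM x).const_mul a) ((h.integrable_gap hM y).const_mul b)]
  refine integral_mono_ae (((h.integrable_gap hM x).const_mul a).add
    ((h.integrable_gap hM y).const_mul b)) (h.integrable_gap hM _) (h.ae_mem.mono fun u hu => ?_)
  have := (Real.concaveOn_rpow h.pos.le h.lt_one.le).2 (mem_Ici.2 (h.gap_nonneg hM hx hu))
    (mem_Ici.2 (h.gap_nonneg hM hy hu)) ha hb hab
  simp only [smul_eq_mul] at this
  refine this.trans (le_of_eq ?_)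
  simp only
  congr 1
  rw [map_add, map_smul, map_smul, inner_add_left, inner_smul_left, inner_smul_left]
  simp only [conj_trivial]
  linear_combination (suppFn M u) * hab

/-- If invariant sets `N i` of volume at least one have energy at most `b i → b` and are contained
in a common ball, a Hausdorff limit has energy at most `b`. -/
lemma exists_limit [IsFiniteMeasure μ] {R b : ℝ} {v : ℝ≥0∞} {N : ℕ → Set (Eu n)} {β : ℕ → ℝ}
    (hN : ∀ i, IsCompetitor D ρ (N i)) (hR : ∀ i, N i ⊆ closedBall 0 R)
    (hv : ∀ i, v ≤ volume (N i)) (hβ : ∀ i, ∀ x ∈ N i, gapEnergy p μ T (N i) x ≤ β i)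
    (hb : Tendsto β atTop (𝓝 b)) :
    ∃ K, IsCompetitor D ρ K ∧ v ≤ volume K ∧ ∀ x ∈ K, gapEnergy p μ T K x ≤ b := by
  obtain ⟨K, φ, hK, hKne, hφ, hlim⟩ := exists_subseq_hausdorff_limit N
    (fun i => (hN i).isCompact) (fun i => (hN i).nonempty) hR
  have hmem : ∀ x, (∀ ε > 0, ∃ᶠ i in atTop, ∃ y ∈ N (φ i), dist x y < ε) → x ∈ K := by
    intro x hx
    rw [← hK.isClosed.closure_eq, Metric.mem_closure_iff]
    intro ε hε
    obtain ⟨i, ⟨y, hy, hxy⟩, -, hi⟩ :=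
      ((hx (ε / 2) (half_pos hε)).and_eventually (hlim (ε / 2) (half_pos hε))).exists
    obtain ⟨z, hz, hzy⟩ := hi y hy
    refine ⟨z, hz, ?_⟩
    linarith [dist_triangle_right x z y]
  have hinv : ∀ g, ∀ x ∈ K, ρ g x ∈ K := fun g x hx => by
    refine hmem _ fun ε hε => Eventually.frequently ?_
    filter_upwards [hlim ε hε] with i hi
    obtain ⟨y, hy, hxy⟩ := hi.1 x hx
    refine ⟨ρ g y, (hN _).image_eq g ▸ mem_image_of_mem _ hy, ?_⟩
    rwa [(ρ g).dist_map]
  have hinv' : ∀ g, ∀ x ∈ K, (ρ g).symm x ∈ K := fun g x hx => by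
    refine hmem _ fun ε hε => Eventually.frequently ?_
    filter_upwards [hlim ε hε] with i hi
    obtain ⟨y, hy, hxy⟩ := hi.1 x hx
    rw [← (hN _).image_eq g] at hy
    obtain ⟨w, hw, rfl⟩ := hy
    refine ⟨w, hw, ?_⟩
    rwa [← (ρ g).dist_map, (ρ g).apply_symm_apply]
  have hKc : IsCompetitor D ρ K := by
    refine ⟨hK, ?_, hKne, ?_, ?_⟩
    · intro x hx y hy s t hs ht hst
      refine hmem _ fun ε hε => Eventually.frequently ?_
      filter_upwards [hlim ε hε] with i hi
      obtain ⟨x', hx', hxx⟩ := hi.1 x hx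
      obtain ⟨y', hy', hyy⟩ := hi.1 y hy
      refine ⟨_, (hN _).convex hx' hy' hs ht hst, ?_⟩
      have : dist (s • x + t • y) (s • x' + t • y') ≤ s * dist x x' + t * dist y y' := by
        refine (dist_add_add_le _ _ _ _).trans (le_of_eq ?_)
        rw [dist_smul₀, dist_smul₀, Real.norm_of_nonneg hs, Real.norm_of_nonneg ht]
      refine this.trans_lt ?_
      have hm : max (dist x x') (dist y y') < ε := max_lt hxx hyy
      calc s * dist x x' + t * dist y y'
          ≤ s * max (dist x x') (dist y y') + t * max (dist x x') (dist y y') := by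
            gcongr
            · exact le_max_left _ _
            · exact le_max_right _ _
        _ = max (dist x x') (dist y y') := by rw [← add_mul, hst, one_mul]
        _ < ε := hm
    · intro x hx
      rw [← h.isClosed.closure_eq, Metric.mem_closure_iff]
      intro ε hε
      obtain ⟨i, hi⟩ := (hlim ε hε).exists
      obtain ⟨y, hy, hxy⟩ := hi.1 x hx
      exact ⟨y, (hN _).subset hy, hxy⟩
    · refine fun g => Subset.antisymm (image_subset_iff.2 (hinv g)) fun x hx => ?_
      exact ⟨_, hinv' g x hx, (ρ g).apply_symm_apply x⟩
  refine ⟨K, hKc, ?_, fun x hx => ?_⟩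
  · have h1 : Tendsto (fun r => volume (cthickening r K)) (𝓝[>] 0) (𝓝 (volume K)) :=
      (tendsto_measure_cthickening_of_isCompact hK).mono_left nhdsWithin_le_nhds
    refine ge_of_tendsto h1 ?_
    filter_upwards [self_mem_nhdsWithin] with r hr
    obtain ⟨i, hi⟩ := (hlim r hr).exists
    refine (hv (φ i)).trans (measure_mono fun y hy => ?_)
    obtain ⟨x, hx, hxy⟩ := hi.2 y hy
    exact mem_cthickening_of_dist_le y x r K hx (by rw [dist_comm]; exact hxy.le)
  · have hε : ∀ ε > 0, gapEnergy p μ T K x ≤ b + (ε + ‖T‖ * ε) ^ p * μ.real univ := by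
      intro ε hε
      refine ge_of_tendsto (f := fun i => β (φ i) + (ε + ‖T‖ * ε) ^ p * μ.real univ) (x := atTop)
        ((hb.comp hφ.tendsto_atTop).add_const _) ?_
      filter_upwards [hlim ε hε] with i hi
      obtain ⟨y, hy, hxy⟩ := hi.1 x hx
      refine le_trans ?_ (add_le_add_left (hβ _ y hy) _)
      have : (ε + ‖T‖ * ε) ^ p * μ.real univ = ∫ _, (ε + ‖T‖ * ε) ^ p ∂μ := by
        rw [integral_const, smul_eq_mul, mul_comm]
      rw [this, gapEnergy, gapEnergy, ← integral_add (h.integrable_gap (hN _) _)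
        (integrable_const _)]
      refine integral_mono_ae (h.integrable_gap hKc x)
        ((h.integrable_gap (hN _) _).add (integrable_const _)) (h.ae_mem.mono fun u hu => ?_)
      have e1 := suppFn_le_add_of_dist hKne (hN (φ i)).isCompact hi.1 (h.norm_eq u hu)
      have e2 : ⟪T y - T x, u⟫ ≤ ‖T‖ * ε := by
        refine (real_inner_le_norm _ _).trans ?_
        rw [h.norm_eq u hu, mul_one, ← map_sub]
        refine (T.le_opNorm _).trans ?_
        gcongr
        rw [← dist_eq_norm, dist_comm]
        exact hxy.le
      rw [inner_sub_left] at e2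
      simp only
      refine le_trans ?_ (Real.rpow_add_le_add_rpow (h.gap_nonneg (hN _) hy hu) (by positivity)
        h.pos.le h.lt_one.le)
      exact Real.rpow_le_rpow (h.gap_nonneg hKc hx hu) (by linarith) h.pos.le
    have hcont : Tendsto (fun ε : ℝ => b + (ε + ‖T‖ * ε) ^ p * μ.real univ) (𝓝[>] 0)
        (𝓝 (b + (0 + ‖T‖ * 0) ^ p * μ.real univ)) := by
      refine Tendsto.mono_left ?_ nhdsWithin_le_nhds
      refine Continuous.tendsto (f := fun ε : ℝ => b + (ε + ‖T‖ * ε) ^ p * μ.real univ) ?_ 0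
      exact continuous_const.add (((Real.continuous_rpow_const h.pos.le).comp (by fun_prop)).mul
        continuous_const)
    rw [mul_zero, add_zero, Real.zero_rpow h.pos.ne', zero_mul, add_zero] at hcont
    refine ge_of_tendsto hcont ?_
    filter_upwards [self_mem_nhdsWithin] with ε hε' using hε ε hε'

end VariationalData

end Variational

section Minimizer

variable {n : ℕ} {ι : Type*} {p : ℝ} {μ : Measure (Eu n)} {Ω D M K : Set (Eu n)}
  {ρ : ι → Eu n ≃ₗᵢ[ℝ] Eu n} {T : Eu n →L[ℝ] Eu n}

/-- `K` solves the minimax problem with value `b`, the maximum being attained at the origin. -/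
structure IsMinimax (p : ℝ) (μ : Measure (Eu n)) (D : Set (Eu n)) (ρ : ι → Eu n ≃ₗᵢ[ℝ] Eu n)
    (T : Eu n →L[ℝ] Eu n) (K : Set (Eu n)) (b : ℝ) : Prop where
  isCompetitor : IsCompetitor D ρ K
  zero_mem : (0 : Eu n) ∈ K
  one_le_volume : 1 ≤ volume K
  energy_zero : gapEnergy p μ T K 0 = b
  energy_le : ∀ x ∈ K, gapEnergy p μ T K x ≤ b
  le_energy : ∀ M, IsCompetitor D ρ M → 1 ≤ volume M → ∃ x ∈ M, b ≤ gapEnergy p μ T M x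

namespace VariationalData

variable (h : VariationalData p μ Ω D ρ T)
include h

lemma isCompetitor_smul (hM : IsCompetitor D ρ M) {c : ℝ} (hc : 0 ≤ c) :
    IsCompetitor D ρ ((fun x => c • x) '' M) := by
  refine ⟨hM.isCompact.image (by fun_prop), ?_, hM.nonempty.image _, ?_, fun g => ?_⟩
  · exact hM.convex.smul c
  · rintro _ ⟨x, hx, rfl⟩
    exact h.smul_mem c hc x (hM.subset hx)
  · conv_rhs => rw [← hM.image_eq g]
    simp only [image_image, map_smul]

lemma exists_isCompetitor_one_le_volume (hn : n ≠ 0) :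
    ∃ M, IsCompetitor D ρ M ∧ 1 ≤ volume M := by
  obtain ⟨z, hz⟩ := h.interior_nonempty
  have hM : IsCompetitor D ρ (D ∩ closedBall 0 (‖z‖ + 1)) := by
    refine ⟨(isCompact_closedBall _ _).inter_left h.isClosed, h.convex.inter
      (convex_closedBall _ _), ⟨0, h.zero_mem, by simp; positivity⟩, inter_subset_left, fun g => ?_⟩
    rw [image_inter (ρ g).injective, h.isometry_image]
    simp
  have hpos : 0 < volume (D ∩ closedBall 0 (‖z‖ + 1)) := by
    refine ((isOpen_interior.inter isOpen_ball).measure_pos volume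
      ⟨z, hz, mem_ball_zero_iff.2 (lt_add_one _)⟩).trans_le (measure_mono ?_)
    exact inter_subset_inter interior_subset ball_subset_closedBall
  have hfin := hM.isCompact.measure_lt_top (μ := volume)
  set v := volume (D ∩ closedBall (0 : Eu n) (‖z‖ + 1)) with hv
  have hvr : 0 < v.toReal := ENNReal.toReal_pos hpos.ne' hfin.ne
  set c : ℝ := max 1 v.toReal⁻¹ with hc
  have hc1 : 1 ≤ c := le_max_left _ _
  refine ⟨_, h.isCompetitor_smul hM (zero_le_one.trans hc1), ?_⟩
  rw [volume_image_dilate _ (zero_le_one.trans hc1), ← hv]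
  calc (1 : ℝ≥0∞) = ENNReal.ofReal (v.toReal⁻¹ * v.toReal) := by
        rw [inv_mul_cancel₀ hvr.ne', ENNReal.ofReal_one]
    _ = ENNReal.ofReal v.toReal⁻¹ * v := by
        rw [ENNReal.ofReal_mul (by positivity), ENNReal.ofReal_toReal hfin.ne]
    _ ≤ ENNReal.ofReal (c ^ n) * v := by
        gcongr
        exact (le_max_right _ _).trans (le_self_pow₀ hc1 hn)

lemma exists_isMaxOn_gapEnergy [IsFiniteMeasure μ] (hM : IsCompetitor D ρ M) :
    ∃ x ∈ M, ∀ y ∈ M, gapEnergy p μ T M y ≤ gapEnergy p μ T M x :=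
  hM.isCompact.exists_isMaxOn hM.nonempty (h.continuous_gapEnergy hM).continuousOn

omit h in
lemma volume_image_sub_const (M : Set (Eu n)) (v : Eu n) :
    volume ((fun x => x - v) '' M) = volume M := by
  simp [sub_eq_add_neg]

theorem exists_isMinimax [IsFiniteMeasure μ] (hn : n ≠ 0) :
    ∃ K b, IsMinimax p μ D ρ T K b := by
  set S : Set ℝ := {b | ∃ M, IsCompetitor D ρ M ∧ 1 ≤ volume M ∧ ∀ x ∈ M, gapEnergy p μ T M x ≤ b}
    with hS
  have hSne : S.Nonempty := by
    obtain ⟨M, hM, hv⟩ := h.exists_isCompetitor_one_le_volume hn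
    obtain ⟨x, -, hx⟩ := h.exists_isMaxOn_gapEnergy hM
    exact ⟨_, M, hM, hv, hx⟩
  have hSb : BddBelow S := by
    refine ⟨0, ?_⟩
    rintro b ⟨M, hM, -, hb⟩
    obtain ⟨x, hx⟩ := hM.nonempty
    exact (h.gapEnergy_nonneg hM hx).trans (hb x hx)
  have hlow : ∀ M, IsCompetitor D ρ M → 1 ≤ volume M → ∃ x ∈ M, sInf S ≤ gapEnergy p μ T M x := by
    intro M hM hv
    obtain ⟨x, hx, hmax⟩ := h.exists_isMaxOn_gapEnergy hM
    exact ⟨x, hx, csInf_le hSb ⟨M, hM, hv, hmax⟩⟩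
  obtain ⟨β, hβa, hβ, hβS⟩ := exists_seq_tendsto_sInf hSne hSb
  choose N hN hNv hNβ using hβS
  obtain ⟨R, hR⟩ := h.exists_norm_sub_le (β 0)
  choose z hz hzfix using fun i => (hN i).exists_fixed_point
  obtain ⟨K₀, hK₀, hK₀v, hK₀b⟩ := h.exists_limit (R := R) (v := 1)
    (fun i => h.isCompetitor_image_sub (hN i) (hzfix i))
    (by
      rintro i _ ⟨x, hx, rfl⟩
      simpa using hR _ (hN i) (fun y hy => (hNβ i y hy).trans (hβa (Nat.zero_le i))) x hx _ (hz i))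
    (fun i => by rw [volume_image_sub_const]; exact hNv i)
    (by
      rintro i _ ⟨x, hx, rfl⟩
      rw [h.gapEnergy_image_sub (hN i)]
      exact hNβ i x hx)
    hβ
  set b := sInf S with hb
  have hC : IsCompetitor D ρ {x ∈ K₀ | b ≤ gapEnergy p μ T K₀ x} := by
    refine ⟨hK₀.isCompact.inter_right
      (isClosed_le continuous_const (h.continuous_gapEnergy hK₀)),
      (h.concave_gapEnergy hK₀).convex_ge b, hlow K₀ hK₀ hK₀v,
      fun x hx => hK₀.subset hx.1, fun g => ?_⟩
    ext x
    constructor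
    · rintro ⟨y, ⟨hy, hyb⟩, rfl⟩
      exact ⟨hK₀.image_eq g ▸ mem_image_of_mem _ hy, by rwa [h.gapEnergy_isometry hK₀]⟩
    · rintro ⟨hx, hxb⟩
      rw [← hK₀.image_eq g] at hx
      obtain ⟨y, hy, rfl⟩ := hx
      exact ⟨y, ⟨hy, by rwa [h.gapEnergy_isometry hK₀] at hxb⟩, rfl⟩
  obtain ⟨x₀, ⟨hx₀, hx₀b⟩, hfix⟩ := hC.exists_fixed_point
  have hK₁ := h.isCompetitor_image_sub hK₀ hfix
  set K₁ := (fun x => x - T x₀) '' K₀ with hK₁def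
  have hK₁b : ∀ x ∈ K₁, gapEnergy p μ T K₁ x ≤ b := by
    rintro _ ⟨x, hx, rfl⟩
    rw [h.gapEnergy_image_sub hK₀]
    exact hK₀b x hx
  set y₀ := x₀ - T x₀ with hy₀
  have hy₀K : y₀ ∈ K₁ := ⟨x₀, hx₀, rfl⟩
  have hTy₀ : T y₀ = 0 := by rw [hy₀, map_sub, h.idem, sub_self]
  have hy₀b : gapEnergy p μ T K₁ y₀ = b :=
    (hK₁b _ hy₀K).antisymm (by rw [hy₀, h.gapEnergy_image_sub hK₀]; exact hx₀b)
  set K : Set (Eu n) := (fun z : ℝ × Eu n => z.1 • z.2) '' (Icc 0 1 ×ˢ K₁) with hKdef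
  have hKjoin : K = convexJoin ℝ {0} K₁ := by
    ext x
    simp only [hKdef, mem_image, Prod.exists, mem_prod, mem_convexJoin, mem_singleton_iff,
      exists_eq_left, segment_eq_image]
    constructor
    · rintro ⟨t, y, ⟨ht, hy⟩, rfl⟩
      exact ⟨y, hy, t, ht, by simp⟩
    · rintro ⟨y, hy, t, ht, rfl⟩
      exact ⟨t, y, ⟨ht, hy⟩, by simp⟩
  have hsub : K₁ ⊆ K := fun x hx => ⟨(1, x), ⟨by simp, hx⟩, by simp⟩
  have hK : IsCompetitor D ρ K := by
    refine ⟨(isCompact_Icc.prod hK₁.isCompact).image (by fun_prop), ?_, hK₁.nonempty.mono hsub,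
      ?_, fun g => ?_⟩
    · rw [hKjoin]
      exact (convex_singleton 0).convexJoin hK₁.convex
    · rintro _ ⟨⟨t, x⟩, ⟨ht, hx⟩, rfl⟩
      exact h.smul_mem t ht.1 x (hK₁.subset hx)
    · ext x
      constructor
      · rintro ⟨_, ⟨⟨t, y⟩, ⟨ht, hy⟩, rfl⟩, rfl⟩
        exact ⟨(t, ρ g y), ⟨ht, hK₁.image_eq g ▸ mem_image_of_mem _ hy⟩, by simp⟩
      · rintro ⟨⟨t, y⟩, ⟨ht, hy⟩, rfl⟩
        rw [← hK₁.image_eq g] at hy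
        obtain ⟨w, hw, rfl⟩ := hy
        exact ⟨t • w, ⟨(t, w), ⟨ht, hw⟩, rfl⟩, by simp⟩
  have hsupp : ∀ u ∈ Ω, suppFn K u = suppFn K₁ u := by
    intro u hu
    have h0 : 0 ≤ suppFn K₁ u := by
      have := h.gap_nonneg hK₁ hy₀K hu
      rwa [hTy₀, inner_zero_left, sub_zero] at this
    refine le_antisymm (suppFn_le hK.nonempty ?_) (suppFn_mono hK₁.nonempty hK.isCompact hsub u)
    rintro _ ⟨⟨t, x⟩, ⟨ht, hx⟩, rfl⟩
    have := inner_le_suppFn hK₁.isCompact hx u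
    simp only [inner_smul_left, conj_trivial]
    nlinarith [ht.1, ht.2]
  have hgap : ∀ x y, T x = T y → gapEnergy p μ T K x = gapEnergy p μ T K₁ y := by
    intro x y hxy
    refine integral_congr_ae (h.ae_mem.mono fun u hu => ?_)
    simp only [hsupp u hu, hxy]
  refine ⟨K, b, hK, ⟨(0, y₀), ⟨by simp, hy₀K⟩, by simp⟩,
    (by
      rw [← volume_image_sub_const K₀ (T x₀)] at hK₀v
      exact hK₀v.trans (measure_mono hsub)), ?_, ?_, hlow⟩
  · rw [hgap 0 y₀ (by simp [hTy₀]), hy₀b]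
  · rintro _ ⟨⟨t, x⟩, ⟨ht, hx⟩, rfl⟩
    rw [hgap _ (t • x + (1 - t) • y₀) (by simp [hTy₀])]
    exact hK₁b _ (hK₁.convex hx hy₀K ht.1 (by linarith [ht.2]) (by ring))

end VariationalData

end Minimizer

section EulerLagrange

variable {n : ℕ} {ι : Type*} {p b : ℝ} {μ : Measure (Eu n)} {Ω D M K : Set (Eu n)}
  {ρ : ι → Eu n ≃ₗᵢ[ℝ] Eu n} {T : Eu n →L[ℝ] Eu n}

/-- The tangent line inequality for the concave function `t ↦ t ^ p`. -/
lemma rpow_le_tangent (hp0 : 0 ≤ p) (hp1 : p ≤ 1) {x y : ℝ} (hx : 0 < x) (hy : 0 ≤ y) :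
    y ^ p ≤ x ^ p + p * (x ^ (p - 1) * (y - x)) := by
  have h1 : (1 + (y / x - 1)) ^ p ≤ 1 + p * (y / x - 1) :=
    rpow_one_add_le_one_add_mul_self (by linarith [div_nonneg hy hx.le]) hp0 hp1
  have h2 : y ^ p = x ^ p * (1 + (y / x - 1)) ^ p := by
    rw [← Real.mul_rpow hx.le (by linarith [div_nonneg hy hx.le])]
    congr 1
    field_simp
    ring
  have h3 : x ^ p = x ^ (p - 1) * x := by
    rw [← Real.rpow_add_one hx.ne', sub_add_cancel]
  calc y ^ p = x ^ p * (1 + (y / x - 1)) ^ p := h2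
    _ ≤ x ^ p * (1 + p * (y / x - 1)) := by gcongr
    _ = x ^ p + p * (x ^ p * (y / x - 1)) := by ring
    _ = x ^ p + p * (x ^ (p - 1) * (y - x)) := by
      congr 2
      rw [h3]
      field_simp

namespace IsMinimax

variable (hd : VariationalData p μ Ω D ρ T) (h : IsMinimax p μ D ρ T K b)
include h

omit h in
lemma interior_nonempty_of_volume_ne_zero (hc : Convex ℝ K) (hv : volume K ≠ 0) :
    (interior K).Nonempty := by
  by_contra hne
  rw [not_nonempty_iff_eq_empty] at hne
  refine hv (measure_mono_null (subset_closure.trans ?_) (hc.addHaar_frontier volume))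
  rw [frontier, hne, sdiff_empty]

lemma isCompact : IsCompact K := h.isCompetitor.isCompact

lemma convex : Convex ℝ K := h.isCompetitor.convex

lemma interior_nonempty : (interior K).Nonempty :=
  interior_nonempty_of_volume_ne_zero h.convex
    (zero_lt_one.trans_le h.one_le_volume).ne'

lemma continuous_suppFn : Continuous (suppFn K) :=
  _root_.continuous_suppFn h.isCompact ⟨0, h.zero_mem⟩

lemma suppFn_nonneg (u : Eu n) : 0 ≤ suppFn K u := _root_.suppFn_nonneg h.isCompact h.zero_mem u

lemma smul_mem {x : Eu n} (hx : x ∈ K) {ε : ℝ} (h0 : 0 ≤ ε) (h1 : ε ≤ 1) : ε • x ∈ K :=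
  h.convex.smul_mem_of_zero_mem h.zero_mem hx ⟨h0, h1⟩

lemma integral_suppFn_rpow : ∫ u, suppFn K u ^ p ∂μ = b := by
  rw [← h.energy_zero]
  simp [gapEnergy]

include hd

variable [IsFiniteMeasure μ]

lemma lintegral_rpow_sub_one_lt_top :
    ∫⁻ u, ENNReal.ofReal (suppFn K u) ^ (p - 1) ∂μ < ∞ := by
  obtain ⟨v, hv⟩ := h.interior_nonempty
  obtain ⟨r, hr, hball⟩ := Metric.nhds_basis_closedBall.mem_iff.1 (mem_interior_iff_mem_nhds.1 hv)
  set Y : ℕ → Eu n → ℝ := fun k u =>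
    (1 - 1 / ((k : ℝ) + 2)) * suppFn K u + 1 / ((k : ℝ) + 2) * r with hY
  have hYc : ∀ k, Continuous (Y k) := fun k =>
    (continuous_const.mul h.continuous_suppFn).add continuous_const
  have hε : ∀ k : ℕ, 0 < 1 / ((k : ℝ) + 2) ∧ 1 / ((k : ℝ) + 2) ≤ 1 / 2 := fun k => by
    refine ⟨by positivity, ?_⟩
    gcongr
    linarith [(Nat.cast_nonneg k : (0 : ℝ) ≤ k)]
  have hYpos : ∀ k u, 0 < Y k u := fun k u => by
    have := hε k
    have h1 := h.suppFn_nonneg u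
    have h2 : 0 ≤ (1 - 1 / ((k : ℝ) + 2)) * suppFn K u := mul_nonneg (by linarith) h1
    have h3 := mul_pos this.1 hr
    simp only [hY]
    linarith
  have hYpc : ∀ (k : ℕ) (q : ℝ), Continuous fun u => Y k u ^ q := fun k q =>
    (hYc k).rpow_const fun u => Or.inl (hYpos k u).ne'
  have hsr : ∀ u ∈ Ω, ⟪T v, u⟫ + r ≤ suppFn K u := by
    intro u hu
    have h1 : v + r • u ∈ K := hball (by
      rw [mem_closedBall, dist_eq_norm, add_sub_cancel_left, norm_smul, hd.norm_eq u hu,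
        mul_one, Real.norm_of_nonneg hr.le])
    have h2 := inner_le_suppFn h.isCompact h1 u
    rw [inner_add_left, inner_smul_left, real_inner_self_eq_norm_sq, hd.norm_eq u hu] at h2
    have h3 := hd.inner_le v (h.isCompetitor.subset (interior_subset hv)) u hu
    simp only [conj_trivial] at h2
    linarith
  have hI : ∀ k, ∫ u, Y k u ^ p ∂μ ≤ b := by
    intro k
    refine le_trans ?_ (h.energy_le _ (h.smul_mem (interior_subset hv) (hε k).1.le
      ((hε k).2.trans (by norm_num))))
    refine integral_mono_ae (hd.integrable_of_continuous (hYpc k p))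
      (hd.integrable_gap h.isCompetitor _) (hd.ae_mem.mono fun u hu => ?_)
    refine Real.rpow_le_rpow (hYpos k u).le ?_ hd.pos.le
    simp only [hY, map_smul, inner_smul_left, conj_trivial]
    nlinarith [hsr u hu, (hε k).1]
  have hJ : ∀ k, r * ∫ u, Y k u ^ (p - 1) ∂μ ≤ 2 * b := by
    intro k
    have e1 : ∫ u, suppFn K u ^ p ∂μ ≤ ∫ u, (Y k u ^ p + p * (Y k u ^ (p - 1) *
        (suppFn K u - Y k u))) ∂μ := by
      refine integral_mono (hd.integrable_of_continuous (h.continuous_suppFn.rpow_const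
        fun _ => Or.inr hd.pos.le)) (hd.integrable_of_continuous ((hYpc k p).add
          (continuous_const.mul ((hYpc k _).mul (h.continuous_suppFn.sub (hYc k)))))) fun u => ?_
      exact rpow_le_tangent hd.pos.le hd.lt_one.le (hYpos k u) (h.suppFn_nonneg u)
    have e2 : ∀ u, Y k u ^ p + p * (Y k u ^ (p - 1) * (suppFn K u - Y k u)) ≤
        Y k u ^ p + p * (1 / ((k : ℝ) + 2)) * (2 * Y k u ^ p - r * Y k u ^ (p - 1)) := by
      intro u
      have e3 : Y k u ^ p = Y k u ^ (p - 1) * Y k u := by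
        rw [← Real.rpow_add_one (hYpos k u).ne', sub_add_cancel]
      have e4 : suppFn K u - Y k u = 1 / ((k : ℝ) + 2) * (suppFn K u - r) := by
        simp only [hY]; ring
      have e5 : suppFn K u ≤ 2 * Y k u := by
        have := hε k
        have h1 := h.suppFn_nonneg u
        simp only [hY]
        nlinarith
      have e6 : 0 ≤ p * (1 / ((k : ℝ) + 2)) * Y k u ^ (p - 1) :=
        mul_nonneg (mul_nonneg hd.pos.le (hε k).1.le) (Real.rpow_nonneg (hYpos k u).le _)
      rw [e4, e3]
      nlinarith [mul_le_mul_of_nonneg_left e5 e6]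
    have i1 := hd.integrable_of_continuous (hYpc k p)
    have i2 := hd.integrable_of_continuous (hYpc k (p - 1))
    have i3 : Integrable (fun u => p * (1 / ((k : ℝ) + 2)) *
        (2 * Y k u ^ p - r * Y k u ^ (p - 1))) μ :=
      ((i1.const_mul _).sub (i2.const_mul _)).const_mul _
    have e7 : ∫ u, (Y k u ^ p + p * (Y k u ^ (p - 1) * (suppFn K u - Y k u))) ∂μ ≤
        ∫ u, Y k u ^ p ∂μ + p * (1 / ((k : ℝ) + 2)) *
          (2 * ∫ u, Y k u ^ p ∂μ - r * ∫ u, Y k u ^ (p - 1) ∂μ) := by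
      rw [← integral_const_mul, ← integral_const_mul, ← integral_sub (i1.const_mul _)
        (i2.const_mul _), ← integral_const_mul, ← integral_add i1 i3]
      refine integral_mono (hd.integrable_of_continuous ((hYpc k p).add
          (continuous_const.mul ((hYpc k _).mul (h.continuous_suppFn.sub (hYc k))))))
        (i1.add i3) e2
    rw [h.integral_suppFn_rpow] at e1
    have e8 : 0 ≤ p * (1 / ((k : ℝ) + 2)) *
          (2 * ∫ u, Y k u ^ p ∂μ - r * ∫ u, Y k u ^ (p - 1) ∂μ) := by linarith [hI k]
    have e9 := nonneg_of_mul_nonneg_right e8 (mul_pos hd.pos (hε k).1)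
    linarith [hI k]
  have hL : ∀ k, ∫⁻ u, ENNReal.ofReal (Y k u) ^ (p - 1) ∂μ ≤ ENNReal.ofReal (2 * b / r) := by
    intro k
    have : ∫⁻ u, ENNReal.ofReal (Y k u) ^ (p - 1) ∂μ =
        ENNReal.ofReal (∫ u, Y k u ^ (p - 1) ∂μ) := by
      rw [ofReal_integral_eq_lintegral_ofReal (hd.integrable_of_continuous (hYpc k _))
        (Eventually.of_forall fun u => Real.rpow_nonneg (hYpos k u).le _)]
      exact lintegral_congr fun u => ENNReal.ofReal_rpow_of_pos (hYpos k u)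
    rw [this]
    refine ENNReal.ofReal_le_ofReal ?_
    rw [le_div_iff₀ hr, mul_comm]
    exact hJ k
  have hlim : ∀ u, Tendsto (fun k => ENNReal.ofReal (Y k u) ^ (p - 1)) atTop
      (𝓝 (ENNReal.ofReal (suppFn K u) ^ (p - 1))) := by
    intro u
    have h1 : Tendsto (fun k : ℕ => 1 / ((k : ℝ) + 2)) atTop (𝓝 0) := by
      refine tendsto_const_nhds.div_atTop ?_
      exact tendsto_atTop_add_const_right _ _ tendsto_natCast_atTop_atTop
    have h2 : Tendsto (fun k => Y k u) atTop (𝓝 ((1 - 0) * suppFn K u + 0 * r)) :=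
      ((tendsto_const_nhds.sub h1).mul_const _).add (h1.mul_const _)
    rw [sub_zero, one_mul, zero_mul, add_zero] at h2
    exact ((ENNReal.continuous_rpow_const.comp ENNReal.continuous_ofReal).tendsto _).comp h2
  calc ∫⁻ u, ENNReal.ofReal (suppFn K u) ^ (p - 1) ∂μ
      = ∫⁻ u, liminf (fun k => ENNReal.ofReal (Y k u) ^ (p - 1)) atTop ∂μ :=
        lintegral_congr fun u => (hlim u).liminf_eq.symm
    _ ≤ liminf (fun k => ∫⁻ u, ENNReal.ofReal (Y k u) ^ (p - 1) ∂μ) atTop :=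
        lintegral_liminf_le fun k => (ENNReal.continuous_rpow_const.comp
          (ENNReal.continuous_ofReal.comp (hYc k))).measurable
    _ ≤ ENNReal.ofReal (2 * b / r) :=
        liminf_le_of_le (by isBoundedDefault) fun c hc => by
          obtain ⟨k, hk⟩ := hc.exists
          exact hk.trans (hL k)
    _ < ∞ := ENNReal.ofReal_lt_top

lemma suppFn_pos : ∀ᵐ u ∂μ, 0 < suppFn K u := by
  have hm : Measurable fun u => ENNReal.ofReal (suppFn K u) ^ (p - 1) :=
    (ENNReal.continuous_rpow_const.comp
      (ENNReal.continuous_ofReal.comp h.continuous_suppFn)).measurable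
  filter_upwards [ae_lt_top hm (h.lintegral_rpow_sub_one_lt_top hd).ne] with u hu
  by_contra hneg
  rw [ENNReal.ofReal_of_nonpos (not_lt.1 hneg), ENNReal.zero_rpow_of_neg
    (by linarith [hd.lt_one])] at hu
  exact lt_irrefl _ hu

lemma integrable_rpow_sub_one : Integrable (fun u => suppFn K u ^ (p - 1)) μ := by
  refine ⟨(h.continuous_suppFn.measurable.pow_const _).aestronglyMeasurable, ?_⟩
  rw [hasFiniteIntegral_iff_ofReal
    (Eventually.of_forall fun u => Real.rpow_nonneg (h.suppFn_nonneg u) _)]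
  refine lt_of_eq_of_lt (lintegral_congr_ae ?_) (h.lintegral_rpow_sub_one_lt_top hd)
  filter_upwards [h.suppFn_pos hd] with u hu using (ENNReal.ofReal_rpow_of_pos hu).symm

lemma integrable_rpow_sub_one_mul {f : Eu n → ℝ} (hf : Continuous f) :
    Integrable (fun u => suppFn K u ^ (p - 1) * f u) μ := by
  obtain ⟨C, hC⟩ := (isCompact_sphere (0 : Eu n) 1).exists_bound_of_continuousOn hf.continuousOn
  exact (h.integrable_rpow_sub_one hd).mul_bdd (c := C) hf.aestronglyMeasurable
    (hd.ae_mem.mono fun u hu => hC u (by simpa using hd.norm_eq u hu))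

lemma integral_rpow_sub_one_mul_suppFn : ∫ u, suppFn K u ^ (p - 1) * suppFn K u ∂μ = b := by
  rw [← h.integral_suppFn_rpow]
  refine integral_congr_ae ?_
  filter_upwards [h.suppFn_pos hd] with u hu
  rw [← Real.rpow_add_one hu.ne', sub_add_cancel]

lemma value_pos (hμ : μ ≠ 0) : 0 < b := by
  rw [← h.integral_suppFn_rpow, integral_pos_iff_support_of_nonneg
    (fun u => Real.rpow_nonneg (h.suppFn_nonneg u) _)
    (hd.integrable_of_continuous (h.continuous_suppFn.rpow_const fun _ => Or.inr hd.pos.le))]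
  rw [pos_iff_ne_zero]
  intro h0
  refine hμ (Measure.measure_univ_eq_zero.1 (measure_mono_null ?_
    (measure_union_null h0 (ae_iff.1 (h.suppFn_pos hd)))))
  intro u _
  by_cases hu : 0 < suppFn K u
  · exact Or.inl (Real.rpow_pos_of_pos hu _).ne'
  · exact Or.inr hu

lemma integral_rpow_sub_one_mul_inner_nonneg {x : Eu n} (hx : x ∈ K) :
    0 ≤ ∫ u, suppFn K u ^ (p - 1) * ⟪T x, u⟫ ∂μ := by
  set Z : ℕ → Eu n → ℝ := fun k u => suppFn K u - 1 / ((k : ℝ) + 2) * ⟪T x, u⟫ with hZ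
  have hZc : ∀ k, Continuous (Z k) := fun k => h.continuous_suppFn.sub (by fun_prop)
  have hε : ∀ k : ℕ, 0 < 1 / ((k : ℝ) + 2) ∧ 1 / ((k : ℝ) + 2) ≤ 1 / 2 := fun k => by
    refine ⟨by positivity, ?_⟩
    gcongr
    linarith [(Nat.cast_nonneg k : (0 : ℝ) ≤ k)]
  have hZlow : ∀ k, ∀ u ∈ Ω, 1 / 2 * suppFn K u ≤ Z k u := by
    intro k u hu
    have := hd.gap_nonneg h.isCompetitor hx hu
    have h1 := h.suppFn_nonneg u
    have h2 := hε k
    simp only [hZ]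
    nlinarith
  have hdom : ∀ k, ∀ᵐ u ∂μ, ‖Z k u ^ (p - 1) * ⟪T x, u⟫‖ ≤
      (1 / 2 : ℝ) ^ (p - 1) * (suppFn K u ^ (p - 1) * |⟪T x, u⟫|) := by
    intro k
    filter_upwards [hd.ae_mem, h.suppFn_pos hd] with u hu hpos
    have hz : 0 < Z k u := lt_of_lt_of_le (by positivity) (hZlow k u hu)
    rw [norm_mul, Real.norm_of_nonneg (Real.rpow_nonneg hz.le _), Real.norm_eq_abs, ← mul_assoc,
      ← Real.mul_rpow (by norm_num) hpos.le]
    gcongr ?_ * _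
    exact Real.rpow_le_rpow_of_nonpos (by positivity) (hZlow k u hu) (by linarith [hd.lt_one])
  have hint := (h.integrable_rpow_sub_one_mul hd
    (f := fun u => |⟪T x, u⟫|) (by fun_prop)).const_mul ((1 / 2 : ℝ) ^ (p - 1))
  have hmeas : ∀ k, AEStronglyMeasurable (fun u => Z k u ^ (p - 1) * ⟪T x, u⟫) μ := fun k =>
    (((hZc k).measurable.pow_const _).mul (by fun_prop)).aestronglyMeasurable
  have hnonneg : ∀ k, 0 ≤ ∫ u, Z k u ^ (p - 1) * ⟪T x, u⟫ ∂μ := by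
    intro k
    have e0 := h.energy_le _ (h.smul_mem hx (hε k).1.le ((hε k).2.trans (by norm_num)))
    have e1 : gapEnergy p μ T K ((1 / ((k : ℝ) + 2)) • x) = ∫ u, Z k u ^ p ∂μ := by
      simp only [gapEnergy, hZ, map_smul, inner_smul_left, conj_trivial]
    have i1 : Integrable (fun u => Z k u ^ p) μ :=
      hd.integrable_of_continuous ((hZc k).rpow_const fun _ => Or.inr hd.pos.le)
    have i2 : Integrable (fun u => Z k u ^ (p - 1) * ⟪T x, u⟫) μ := hint.mono' (hmeas k) (hdom k)
    have e2 : ∫ u, suppFn K u ^ p ∂μ ≤ ∫ u, (Z k u ^ p + p * (1 / ((k : ℝ) + 2)) *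
        (Z k u ^ (p - 1) * ⟪T x, u⟫)) ∂μ := by
      refine integral_mono_ae (hd.integrable_of_continuous (h.continuous_suppFn.rpow_const
        fun _ => Or.inr hd.pos.le)) (i1.add (i2.const_mul _)) ?_
      filter_upwards [hd.ae_mem, h.suppFn_pos hd] with u hu hpos
      have hz : 0 < Z k u := lt_of_lt_of_le (by positivity) (hZlow k u hu)
      refine (rpow_le_tangent hd.pos.le hd.lt_one.le hz hpos.le).trans (le_of_eq ?_)
      simp only [hZ]
      ring
    rw [integral_add i1 (i2.const_mul _), integral_const_mul, h.integral_suppFn_rpow] at e2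
    rw [e1] at e0
    exact nonneg_of_mul_nonneg_right (by linarith) (mul_pos hd.pos (hε k).1)
  have hlim : Tendsto (fun k => ∫ u, Z k u ^ (p - 1) * ⟪T x, u⟫ ∂μ) atTop
      (𝓝 (∫ u, suppFn K u ^ (p - 1) * ⟪T x, u⟫ ∂μ)) := by
    refine tendsto_integral_of_dominated_convergence _ hmeas hint hdom ?_
    filter_upwards [h.suppFn_pos hd] with u hpos
    have h1 : Tendsto (fun k : ℕ => 1 / ((k : ℝ) + 2)) atTop (𝓝 0) := by
      refine tendsto_const_nhds.div_atTop ?_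
      exact tendsto_atTop_add_const_right _ _ tendsto_natCast_atTop_atTop
    have h2 : Tendsto (fun k => Z k u) atTop (𝓝 (suppFn K u - 0 * ⟪T x, u⟫)) :=
      tendsto_const_nhds.sub (h1.mul_const _)
    rw [zero_mul, sub_zero] at h2
    exact ((h2.rpow_const (Or.inl hpos.ne')).mul_const _)
  exact ge_of_tendsto' hlim hnonneg

lemma le_mul_integral (hM : IsCompetitor D ρ M) (hMK : M ⊆ K) {l : ℝ} (hl : 0 ≤ l)
    (hv : 1 ≤ volume ((fun x => l • x) '' M)) :
    b ≤ l * ∫ u, suppFn K u ^ (p - 1) * suppFn M u ∂μ := by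
  have hlM := hd.isCompetitor_smul hM hl
  obtain ⟨_, ⟨x, hx, rfl⟩, hb⟩ := h.le_energy _ hlM hv
  have hMc := _root_.continuous_suppFn hM.isCompact hM.nonempty
  have i0 := h.integrable_rpow_sub_one_mul hd h.continuous_suppFn
  have i1 := h.integrable_rpow_sub_one_mul hd hMc
  have i2 := h.integrable_rpow_sub_one_mul hd (f := fun u => ⟪T x, u⟫) (by fun_prop)
  have i3 : Integrable (fun u => suppFn K u ^ p) μ :=
    hd.integrable_of_continuous (h.continuous_suppFn.rpow_const fun _ => Or.inr hd.pos.le)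
  have i4 : Integrable (fun u => l * (suppFn K u ^ (p - 1) * suppFn M u) -
      l * (suppFn K u ^ (p - 1) * ⟪T x, u⟫)) μ := (i1.const_mul l).sub (i2.const_mul l)
  have i5 : Integrable (fun u => p * (l * (suppFn K u ^ (p - 1) * suppFn M u) -
      l * (suppFn K u ^ (p - 1) * ⟪T x, u⟫) - suppFn K u ^ (p - 1) * suppFn K u)) μ :=
    (i4.sub i0).const_mul p
  have hle : gapEnergy p μ T ((fun x => l • x) '' M) (l • x) ≤
      ∫ u, (suppFn K u ^ p + p * ((l * (suppFn K u ^ (p - 1) * suppFn M u) -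
        l * (suppFn K u ^ (p - 1) * ⟪T x, u⟫)) - suppFn K u ^ (p - 1) * suppFn K u)) ∂μ := by
    refine integral_mono_ae (hd.integrable_gap hlM _)
      (i3.add i5) ?_
    filter_upwards [hd.ae_mem, h.suppFn_pos hd] with u hu hpos
    refine (rpow_le_tangent hd.pos.le hd.lt_one.le hpos
      (hd.gap_nonneg hlM ⟨x, hx, rfl⟩ hu)).trans (le_of_eq ?_)
    rw [suppFn_smul_set hl, map_smul, inner_smul_left]
    simp only [conj_trivial]
    ring
  rw [integral_add i3 i5,
    integral_const_mul, integral_sub i4 i0,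
    integral_sub (i1.const_mul l) (i2.const_mul l), integral_const_mul, integral_const_mul,
    h.integral_suppFn_rpow, h.integral_rpow_sub_one_mul_suppFn hd] at hle
  have h1 := mul_nonneg hl (h.integral_rpow_sub_one_mul_inner_nonneg hd (hMK hx))
  have h2 : 0 ≤ p * ((l * ∫ u, suppFn K u ^ (p - 1) * suppFn M u ∂μ -
    l * ∫ u, suppFn K u ^ (p - 1) * ⟪T x, u⟫ ∂μ) - b) := by linarith
  have h3 := nonneg_of_mul_nonneg_right h2 hd.pos
  linarith

end IsMinimax

end EulerLagrange

section Invariance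

variable {m n : ℕ}

lemma IsOuterNormal.map {K : Set (Eu n)} {T : Eu n ≃ₗᵢ[ℝ] Eu n} (hT : T '' K = K) {x u : Eu n}
    (h : IsOuterNormal K x u) : IsOuterNormal K (T x) (T u) := by
  refine ⟨by rw [T.norm_map, h.1], fun y hy => ?_⟩
  rw [← hT] at hy
  obtain ⟨z, hz, rfl⟩ := hy
  rw [T.inner_map_map, T.inner_map_map]
  exact h.2 z hz

lemma map_isometry_withDensity {μ : Measure (Eu n)} {T : Eu n ≃ₗᵢ[ℝ] Eu n}
    (hμ : Measure.map T μ = μ) {f : Eu n → ℝ≥0∞} (hf : Measurable f) (hfT : ∀ x, f (T x) = f x) :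
    Measure.map T (μ.withDensity f) = μ.withDensity f := by
  have hT : Measurable T := T.continuous.measurable
  ext s hs
  rw [Measure.map_apply hT hs, withDensity_apply _ (hT hs), withDensity_apply _ hs]
  conv_rhs => rw [← hμ, setLIntegral_map hs hf hT]
  simp only [hfT]

lemma map_isometry_restrict_frontier {K : Set (Eu (m + 1))} {T : Eu (m + 1) ≃ₗᵢ[ℝ] Eu (m + 1)}
    (hT : T '' K = K) : Measure.map T ((μH[(m : ℝ)]).restrict (frontier K)) =
      (μH[(m : ℝ)]).restrict (frontier K) := by
  have h1 : T ⁻¹' frontier K = frontier K := by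
    have h2 : T ⁻¹' K = K := by
      conv_lhs => rw [← hT]
      exact T.injective.preimage_image K
    have h3 := T.toHomeomorph.preimage_frontier K
    change T ⁻¹' frontier K = frontier (T ⁻¹' K) at h3
    rw [h3, h2]
  have h4 : Measure.map T (μH[(m : ℝ)] : Measure (Eu (m + 1))) = μH[(m : ℝ)] :=
    T.toIsometryEquiv.map_hausdorffMeasure _
  conv_lhs => rw [← h1]
  rw [← Measure.restrict_map T.continuous.measurable isClosed_frontier.measurableSet, h4]

lemma map_isometry_surfMeasure {K : Set (Eu (m + 1))} (hK : IsCompact K) (hc : Convex ℝ K)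
    (hint : (interior K).Nonempty) {T : Eu (m + 1) ≃ₗᵢ[ℝ] Eu (m + 1)} (hT : T '' K = K) :
    Measure.map T (surfMeasure K) = surfMeasure K := by
  have hTm : Measurable T := T.continuous.measurable
  set τ := (μH[(m : ℝ)] : Measure (Eu (m + 1))).restrict (frontier K) with hτ
  have hτT : Measure.map T τ = τ := map_isometry_restrict_frontier hT
  have hg : AEMeasurable (gaussMap K) τ := aemeasurable_gaussMap hK hc hint
  have hreg : ∀ᵐ x ∂τ, x ∈ frontier K ∧ x ∉ singularSet K := by
    refine (ae_restrict_mem isClosed_frontier.measurableSet).and (ae_restrict_of_ae ?_)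
    exact measure_eq_zero_iff_ae_notMem.1 (hausdorffMeasure_singularSet hint)
  have hreg' : ∀ᵐ x ∂τ, T x ∈ frontier K ∧ T x ∉ singularSet K :=
    ae_of_ae_map hTm.aemeasurable (by rw [hτT]; exact hreg)
  have hcomm : (T ∘ gaussMap K) =ᵐ[τ] gaussMap K ∘ T := by
    filter_upwards [hreg, hreg'] with x hx hTx
    exact (gaussMap_eq_of_notMem_singularSet (hK.isClosed.frontier_subset hTx.1) hTx.2
      ((gaussMap_isOuterNormal (exists_isOuterNormal hc hint hx.1)).map hT)).symm
  calc Measure.map T (surfMeasure K) = Measure.map (T ∘ gaussMap K) τ :=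
        AEMeasurable.map_map_of_aemeasurable hTm.aemeasurable hg
    _ = Measure.map (gaussMap K ∘ T) τ := Measure.map_congr hcomm
    _ = Measure.map (gaussMap K) (Measure.map T τ) :=
        (AEMeasurable.map_map_of_aemeasurable (by rwa [hτT]) hTm.aemeasurable).symm
    _ = surfMeasure K := by rw [hτT]; rfl

end Invariance

section FirstVariation

variable {m : ℕ} {p b : ℝ} {μ : Measure (Eu (m + 1))} {Ω D K C : Set (Eu (m + 1))}
  {T : Eu (m + 1) →L[ℝ] Eu (m + 1)}

section Cut

variable {ι : Type*} {ρ : ι → Eu (m + 1) ≃ₗᵢ[ℝ] Eu (m + 1)}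

lemma isCompetitor_cutBody (hK : IsCompetitor D ρ K) (hCi : ∀ g, ρ g '' C = C) {t : ℝ}
    (hne : (cutBody K C t).Nonempty) : IsCompetitor D ρ (cutBody K C t) := by
  refine ⟨isCompact_cutBody hK.isCompact C t, convex_cutBody hK.convex C t, hne,
    fun x hx => hK.subset hx.1, fun g => Subset.antisymm ?_ ?_⟩
  · rintro _ ⟨z, ⟨hz, hzC⟩, rfl⟩
    refine ⟨hK.image_eq g ▸ mem_image_of_mem _ hz, fun e he => ?_⟩
    rw [← hCi g] at he
    obtain ⟨e', he', rfl⟩ := he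
    rw [(ρ g).inner_map_map, suppFn_image_isometry _ (hK.image_eq g)]
    exact hzC e' he'
  · rintro x ⟨hx, hxC⟩
    rw [← hK.image_eq g] at hx
    obtain ⟨z, hz, rfl⟩ := hx
    refine ⟨z, ⟨hz, fun e he => ?_⟩, rfl⟩
    have := hxC (ρ g e) (hCi g ▸ mem_image_of_mem _ he)
    rwa [(ρ g).inner_map_map, suppFn_image_isometry _ (hK.image_eq g)] at this

lemma ball_subset_cutBody (hK : IsCompact K) (hCs : C ⊆ sphere 0 1) {v : Eu (m + 1)} {r t : ℝ}
    (hr : 0 < r) (ht : 0 ≤ t) (hball : closedBall v r ⊆ K) : ball v (r - t) ⊆ cutBody K C t := by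
  intro z hz
  rw [mem_ball, dist_eq_norm] at hz
  refine ⟨hball (by rw [mem_closedBall, dist_eq_norm]; linarith), fun e he => ?_⟩
  have hen : ‖e‖ = 1 := by simpa using hCs he
  have h1 : v + r • e ∈ K := hball (by
    rw [mem_closedBall, dist_eq_norm, add_sub_cancel_left, norm_smul, hen, mul_one,
      Real.norm_of_nonneg hr.le])
  have h2 := inner_le_suppFn hK h1 e
  rw [inner_add_left, inner_smul_left, real_inner_self_eq_norm_sq, hen] at h2
  simp only [conj_trivial] at h2
  have h3 : ⟪z - v, e⟫ ≤ ‖z - v‖ * ‖e‖ := real_inner_le_norm _ _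
  rw [inner_sub_left, hen] at h3
  linarith

variable (hd : VariationalData p μ Ω D ρ T) (h : IsMinimax p μ D ρ T K b)
include hd h

/-- Cutting slices of width `t` off the minimizer costs at least the expected volume. -/
lemma IsMinimax.eventually_le_volume_diff_cutBody [IsFiniteMeasure μ] (hμ : μ ≠ 0)
    (hC : IsCompact C) (hCs : C ⊆ sphere 0 1) (hCi : ∀ g, ρ g '' C = C) {a : ℝ}
    (ha : a < (volume K).toReal * ((m + 1 : ℕ) * ((∫ u in C, suppFn K u ^ (p - 1) ∂μ) / b))) :
    ∀ᶠ t in 𝓝[>] (0 : ℝ), ENNReal.ofReal t * ENNReal.ofReal a ≤ volume (K \ cutBody K C t) := by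
  set N := ∫ u in C, suppFn K u ^ (p - 1) ∂μ with hN
  set V := (volume K).toReal with hV
  have hb := h.value_pos hd hμ
  have hfin := h.isCompact.measure_lt_top (μ := volume)
  have hVpos : 0 < V :=
    ENNReal.toReal_pos (zero_lt_one.trans_le h.one_le_volume).ne' hfin.ne
  obtain ⟨v, hv⟩ := h.interior_nonempty
  obtain ⟨r, hr, hball⟩ := Metric.nhds_basis_closedBall.mem_iff.1 (mem_interior_iff_mem_nhds.1 hv)
  have hderiv : HasDerivAt (fun t : ℝ => V * (1 - (1 - t * (N / b)) ^ (m + 1)))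
      (V * ((m + 1 : ℕ) * (N / b))) 0 := by
    have h1 : HasDerivAt (fun t : ℝ => 1 - t * (N / b)) (-(N / b)) 0 := by
      simpa using ((hasDerivAt_id (0 : ℝ)).mul_const (N / b)).const_sub 1
    have h2 := ((h1.fun_pow (m + 1)).const_sub 1).const_mul V
    simpa using h2
  have hslope := (hasDerivAt_iff_tendsto_slope.1 hderiv).mono_left
    (nhdsWithin_mono (0 : ℝ) (fun t (ht : 0 < t) => ht.ne'))
  filter_upwards [hslope.eventually (lt_mem_nhds ha), self_mem_nhdsWithin,
    Ioo_mem_nhdsGT hr] with t hts ht0 htr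
  rw [mem_Ioi] at ht0
  rw [slope_def_field, sub_zero, lt_div_iff₀ ht0] at hts
  norm_num at hts
  have hsubM : ball v (r - t) ⊆ cutBody K C t :=
    ball_subset_cutBody h.isCompact hCs hr ht0.le hball
  have hne : (cutBody K C t).Nonempty := ⟨v, hsubM (mem_ball_self (by linarith [htr.2]))⟩
  have hM := isCompetitor_cutBody h.isCompetitor hCi hne
  have hMK : cutBody K C t ⊆ K := fun x hx => hx.1
  set M := cutBody K C t with hMdef
  have hMfin := hM.isCompact.measure_lt_top (μ := volume)
  have hMpos : 0 < volume M :=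
    (measure_ball_pos volume v (by linarith [htr.2])).trans_le (measure_mono hsubM)
  set W := (volume M).toReal with hW
  have hWpos : 0 < W := ENNReal.toReal_pos hMpos.ne' hMfin.ne
  set l : ℝ := (V / W) ^ (((m + 1 : ℕ) : ℝ)⁻¹) with hl
  have hl0 : 0 ≤ l := by positivity
  have hlpow : l ^ (m + 1) = V / W := Real.rpow_inv_natCast_pow (by positivity) (by simp)
  have hlv : 1 ≤ volume ((fun x => l • x) '' M) := by
    rw [volume_image_dilate _ hl0, hlpow, ← ENNReal.ofReal_toReal hMfin.ne,
      ← ENNReal.ofReal_mul (by positivity), ← hW, div_mul_cancel₀ _ hWpos.ne',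
      ENNReal.ofReal_toReal hfin.ne]
    exact h.one_le_volume
  have hkey := h.le_mul_integral hd hM hMK hl0 hlv
  have hMc := _root_.continuous_suppFn hM.isCompact hM.nonempty
  have hint := h.integrable_rpow_sub_one_mul hd h.continuous_suppFn
  have hind : Integrable (C.indicator fun u => suppFn K u ^ (p - 1)) μ :=
    (h.integrable_rpow_sub_one hd).indicator hC.measurableSet
  have hle : ∫ u, suppFn K u ^ (p - 1) * suppFn M u ∂μ ≤ b - t * N := by
    rw [← h.integral_rpow_sub_one_mul_suppFn hd, hN, ← integral_indicator hC.measurableSet,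
      ← integral_const_mul, ← integral_sub hint (hind.const_mul t)]
    refine integral_mono (h.integrable_rpow_sub_one_mul hd hMc)
      (hint.sub (hind.const_mul t)) fun u => ?_
    have hw : 0 ≤ suppFn K u ^ (p - 1) := Real.rpow_nonneg (h.suppFn_nonneg u) _
    simp only
    by_cases hu : u ∈ C
    · rw [indicator_of_mem hu]
      have : suppFn M u ≤ suppFn K u - t := suppFn_le hne fun z hz => hz.2 u hu
      nlinarith
    · rw [indicator_of_notMem hu, mul_zero, sub_zero]
      exact mul_le_mul_of_nonneg_left (suppFn_mono hne h.isCompact hMK u) hw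
  have hkey' : b ≤ l * (b - t * N) := hkey.trans (mul_le_mul_of_nonneg_left hle hl0)
  have hlpos : 0 < l := by positivity
  have hrat : 0 ≤ 1 - t * (N / b) := by
    have : 0 ≤ b - t * N := by
      by_contra hneg
      nlinarith [mul_neg_of_pos_of_neg hlpos (not_le.1 hneg)]
    have := div_nonneg this hb.le
    rwa [sub_div, div_self hb.ne', mul_div_assoc] at this
  have h1 : 1 ≤ l * (1 - t * (N / b)) := by
    have := div_le_div_of_nonneg_right hkey' hb.le
    rwa [div_self hb.ne', mul_div_assoc, sub_div, div_self hb.ne', mul_div_assoc] at this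
  have h2 : 1 ≤ V / W * (1 - t * (N / b)) ^ (m + 1) := by
    rw [← hlpow, ← mul_pow]
    exact one_le_pow₀ h1
  have h3 : W ≤ V * (1 - t * (N / b)) ^ (m + 1) := by
    rw [div_mul_eq_mul_div, le_div_iff₀ hWpos, one_mul] at h2
    exact h2
  rw [measure_sdiff hMK hM.isCompact.measurableSet.nullMeasurableSet hMfin.ne,
    ← ENNReal.ofReal_mul ht0.le, ← ENNReal.ofReal_toReal hfin.ne,
    ← ENNReal.ofReal_toReal hMfin.ne, ← ENNReal.ofReal_sub _ ENNReal.toReal_nonneg]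
  refine ENNReal.ofReal_le_ofReal ?_
  linarith

lemma IsMinimax.mul_integral_le_surfMeasure [IsFiniteMeasure μ] (hμ : μ ≠ 0) {γ : ℝ≥0∞}
    (hγ0 : γ ≠ ∞) (hγ : (μH[(m : ℝ)] : Measure (Eu m)) = γ • volume)
    (hC : IsCompact C) (hCs : C ⊆ sphere 0 1) (hCi : ∀ g, ρ g '' C = C) :
    γ * ENNReal.ofReal ((volume K).toReal *
      ((m + 1 : ℕ) * ((∫ u in C, suppFn K u ^ (p - 1) ∂μ) / b))) ≤ surfMeasure K C := by
  set A := (volume K).toReal * ((m + 1 : ℕ) * ((∫ u in C, suppFn K u ^ (p - 1) ∂μ) / b)) with hA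
  have hlim : Tendsto (fun a => γ * ENNReal.ofReal a) (𝓝[<] A) (𝓝 (γ * ENNReal.ofReal A)) :=
    ENNReal.Tendsto.const_mul
      ((ENNReal.continuous_ofReal.tendsto A).mono_left nhdsWithin_le_nhds) (Or.inr hγ0)
  refine le_of_tendsto hlim ?_
  filter_upwards [self_mem_nhdsWithin] with a ha
  exact mul_le_surfMeasure_of_eventually_le hγ h.isCompact h.convex h.interior_nonempty hC hCs
    (h.eventually_le_volume_diff_cutBody hd hμ hC hCs hCi ha)

end Cut

end FirstVariation

section Conclusion

variable {m n : ℕ} {p : ℝ}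

lemma withDensity_eq_of_le_of_lintegral_le {α : Type*} [MeasurableSpace α] {ν σ : Measure α}
    (hνσ : ν ≤ σ) {f : α → ℝ≥0∞} (hf : ∫⁻ x, f x ∂ν ≠ ∞)
    (h : ∫⁻ x, f x ∂σ ≤ ∫⁻ x, f x ∂ν) : ν.withDensity f = σ.withDensity f := by
  have : IsFiniteMeasure (ν.withDensity f) := isFiniteMeasure_withDensity hf
  have hle : ν.withDensity f ≤ σ.withDensity f := by
    refine Measure.le_iff.2 fun s hs => ?_
    rw [withDensity_apply _ hs, withDensity_apply _ hs]
    exact lintegral_mono' (Measure.restrict_mono_measure hνσ s) le_rfl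
  refine Measure.eq_of_le_of_measure_univ_eq hle (le_antisymm (hle univ) ?_)
  simpa using h

lemma measure_eq_setLIntegral_rpow {α : Type*} [MeasurableSpace α] {μ σ : Measure α} {f : α → ℝ}
    (hp : p < 1) (hf : Measurable f) (hf0 : ∀ x, 0 ≤ f x) (hpos : ∀ᵐ x ∂μ, 0 < f x)
    (h : (μ.withDensity fun x => ENNReal.ofReal (f x ^ (p - 1))).withDensity
        (fun x => ENNReal.ofReal (f x)) = σ.withDensity fun x => ENNReal.ofReal (f x))
    {s : Set α} (hs : MeasurableSet s) :
    μ s = ∫⁻ x in s, ENNReal.ofReal (f x ^ (1 - p)) ∂σ := by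
  have hm : ∀ q : ℝ, Measurable fun x => ENNReal.ofReal (f x ^ q) := fun q =>
    (hf.pow_const q).ennreal_ofReal
  have h1 : ∀ x, ENNReal.ofReal (f x) * ENNReal.ofReal (f x ^ (-p)) =
      ENNReal.ofReal (f x ^ (1 - p)) := by
    intro x
    rw [← ENNReal.ofReal_mul (hf0 x)]
    congr 1
    rcases (hf0 x).eq_or_lt with h0 | h0
    · rw [← h0, zero_mul, Real.zero_rpow (by linarith)]
    · rw [sub_eq_add_neg, Real.rpow_add h0, Real.rpow_one]
  have h2 : ∀ᵐ x ∂μ.restrict s, ENNReal.ofReal (f x ^ (p - 1)) *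
      ENNReal.ofReal (f x ^ (1 - p)) = 1 := by
    filter_upwards [ae_restrict_of_ae hpos] with x hx
    rw [← ENNReal.ofReal_mul (Real.rpow_nonneg hx.le _), ← Real.rpow_add hx]
    simp
  have h3 : ∀ τ : Measure α, ∫⁻ x in s, ENNReal.ofReal (f x ^ (-p))
      ∂(τ.withDensity fun x => ENNReal.ofReal (f x)) =
      ∫⁻ x in s, ENNReal.ofReal (f x ^ (1 - p)) ∂τ := by
    intro τ
    rw [setLIntegral_withDensity_eq_setLIntegral_mul _ hf.ennreal_ofReal (hm _) hs]
    simp only [Pi.mul_apply, h1]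
  rw [← h3, ← h, h3, setLIntegral_withDensity_eq_setLIntegral_mul _ (hm _) (hm _) hs]
  simp only [Pi.mul_apply]
  rw [lintegral_congr_ae h2]
  simp

lemma setLIntegral_surfMeasure {K : Set (Eu (m + 1))} (hK : IsCompact K)
    (hc : Convex ℝ K) (hint : (interior K).Nonempty) {ω : Set (Eu (m + 1))}
    (hω : MeasurableSet ω) :
    ∫⁻ u in ω, ENNReal.ofReal (suppFn K u ^ (1 - p)) ∂surfMeasure K = lpSurf p K ω := by
  have hg := aemeasurable_gaussMap hK hc hint
  have hcont : Continuous (suppFn K) :=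
    continuous_suppFn hK (hint.mono interior_subset)
  have hm : Measurable fun u => ENNReal.ofReal (suppFn K u ^ (1 - p)) :=
    (hcont.measurable.pow_const _).ennreal_ofReal
  have hcast : (((m + 1 : ℕ) : ℝ) - 1) = (m : ℝ) := by push_cast; ring
  rw [lpSurf, hcast, surfMeasure, Measure.restrict_map_of_aemeasurable hg hω,
    lintegral_map' hm.aemeasurable hg.restrict,
    Measure.restrict_restrict₀ (hg.nullMeasurable hω)]
  have hset : gaussMap K ⁻¹' ω ∩ frontier K = {x ∈ frontier K | gaussMap K x ∈ ω} := by
    ext x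
    exact and_comm
  rw [hset]
  have hmem : ∀ᵐ x ∂(μH[(m : ℝ)]).restrict {x ∈ frontier K | gaussMap K x ∈ ω},
      x ∈ frontier K := by
    rw [← hset, ← Measure.restrict_restrict₀ (hg.nullMeasurable hω)]
    exact ae_restrict_of_ae (ae_restrict_mem isClosed_frontier.measurableSet)
  refine lintegral_congr_ae ?_
  filter_upwards [hmem] with x hx
  rw [(gaussMap_isOuterNormal (exists_isOuterNormal hc hint hx)).inner_eq hK
    (hK.isClosed.frontier_subset hx)]

lemma frontier_image_dilate {K : Set (Eu n)} {c : ℝ} (hc : 0 < c) :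
    frontier ((fun x => c • x) '' K) = (fun x => c • x) '' frontier K :=
  ((Homeomorph.smulOfNeZero c hc.ne').image_frontier K).symm

lemma gaussMap_image_dilate {K : Set (Eu n)} {c : ℝ} (hc : 0 < c) (x : Eu n) :
    gaussMap ((fun x => c • x) '' K) (c • x) = gaussMap K x := by
  have h : IsOuterNormal ((fun x => c • x) '' K) (c • x) = IsOuterNormal K x := by
    ext u
    simp only [IsOuterNormal, forall_mem_image, real_inner_smul_left,
      mul_le_mul_iff_right₀ hc]
  rw [gaussMap, gaussMap, h]

open scoped Pointwise in
lemma lpSurf_image_dilate {K : Set (Eu (m + 1))} (hK : IsCompact K) (hKc : Convex ℝ K)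
    (hint : (interior K).Nonempty) (h0 : 0 ∈ K) {c : ℝ} (hc : 0 < c)
    {ω : Set (Eu (m + 1))} (hω : MeasurableSet ω) :
    lpSurf p ((fun x => c • x) '' K) ω =
      ENNReal.ofReal (c ^ ((m + 1 : ℕ) - p)) * lpSurf p K ω := by
  have hcast : (((m + 1 : ℕ) : ℝ) - 1) = (m : ℝ) := by push_cast; ring
  have hg := aemeasurable_gaussMap hK hKc hint
  let e : Eu (m + 1) ≃ₜ Eu (m + 1) := Homeomorph.smulOfNeZero c hc.ne'
  have he : ∀ x, e x = c • x := fun x => rfl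
  have hmap : (μH[(m : ℝ)] : Measure (Eu (m + 1))) =
      ENNReal.ofReal (c ^ (m : ℝ)) • Measure.map e μH[(m : ℝ)] := by
    ext s hs
    rw [Measure.smul_apply, e.measurableEmbedding.map_apply, smul_eq_mul]
    have h1 : s = c • (e ⁻¹' s) := by
      change s = e '' (e ⁻¹' s)
      rw [image_preimage_eq _ e.surjective]
    conv_lhs => rw [h1, Measure.hausdorffMeasure_smul₀ (by positivity) hc.ne']
    rw [ENNReal.smul_def, smul_eq_mul]
    congr 1
    rw [ENNReal.ofReal, Real.toNNReal_rpow_of_nonneg hc.le, Real.nnnorm_of_nonneg hc.le,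
      Real.toNNReal_of_nonneg hc.le]
  have hpre : e ⁻¹' {x ∈ frontier ((fun x => c • x) '' K) |
      gaussMap ((fun x => c • x) '' K) x ∈ ω} = {x ∈ frontier K | gaussMap K x ∈ ω} := by
    ext x
    have h1 : e x ∈ frontier ((fun x => c • x) '' K) ↔ x ∈ frontier K := by
      rw [frontier_image_dilate hc]
      exact e.injective.mem_set_image
    simp only [mem_preimage, mem_sep_iff, h1]
    rw [he, gaussMap_image_dilate hc]
  rw [lpSurf, lpSurf, hcast]
  conv_lhs => rw [hmap]
  rw [Measure.restrict_smul, lintegral_smul_measure, e.measurableEmbedding.restrict_map,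
    e.measurableEmbedding.lintegral_map, hpre, smul_eq_mul]
  have h1 : ∀ x, ENNReal.ofReal (⟪e x, gaussMap ((fun x => c • x) '' K) (e x)⟫ ^ (1 - p)) =
      ENNReal.ofReal ((c * ⟪x, gaussMap K x⟫) ^ (1 - p)) := fun x => by
    rw [he, gaussMap_image_dilate hc, real_inner_smul_left]
  have hset : gaussMap K ⁻¹' ω ∩ frontier K = {x ∈ frontier K | gaussMap K x ∈ ω} := by
    ext x
    exact and_comm
  have hmem : ∀ᵐ x ∂(μH[(m : ℝ)]).restrict {x ∈ frontier K | gaussMap K x ∈ ω},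
      x ∈ frontier K := by
    rw [← hset, ← Measure.restrict_restrict₀ (hg.nullMeasurable hω)]
    exact ae_restrict_of_ae (ae_restrict_mem isClosed_frontier.measurableSet)
  have h2 : ∫⁻ x in {x ∈ frontier K | gaussMap K x ∈ ω},
      ENNReal.ofReal ((c * ⟪x, gaussMap K x⟫) ^ (1 - p)) ∂μH[(m : ℝ)] =
      ∫⁻ x in {x ∈ frontier K | gaussMap K x ∈ ω}, ENNReal.ofReal (c ^ (1 - p)) *
        ENNReal.ofReal (⟪x, gaussMap K x⟫ ^ (1 - p)) ∂μH[(m : ℝ)] := by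
    refine lintegral_congr_ae ?_
    filter_upwards [hmem] with x hx
    have hx0 : 0 ≤ ⟪x, gaussMap K x⟫ := by
      rw [(gaussMap_isOuterNormal (exists_isOuterNormal hKc hint hx)).inner_eq hK
        (hK.isClosed.frontier_subset hx)]
      exact suppFn_nonneg hK h0 _
    rw [Real.mul_rpow hc.le hx0, ENNReal.ofReal_mul (by positivity)]
  simp only [h1]
  rw [h2, lintegral_const_mul' _ _ ENNReal.ofReal_ne_top, ← mul_assoc,
    ← ENNReal.ofReal_mul (by positivity), ← Real.rpow_add hc]
  congr 3
  push_cast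
  ring

variable {b : ℝ} {H : Type*} [Group H] [TopologicalSpace H] [IsTopologicalGroup H] [CompactSpace H]
  {ρ : H →* (Eu (m + 1) ≃ₗᵢ[ℝ] Eu (m + 1))} {μ : Measure (Eu (m + 1))}
  {Ω D K : Set (Eu (m + 1))} {T : Eu (m + 1) →L[ℝ] Eu (m + 1)}

lemma IsMinimax.exists_measure_eq_smul_lpSurf [IsFiniteMeasure μ] (hμ : μ ≠ 0)
    (hρ : Continuous fun z : H × Eu (m + 1) => ρ z.1 z.2)
    (hd : VariationalData p μ Ω D ρ T) (h : IsMinimax p μ D ρ T K b) :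
    ∃ c : ℝ, 0 < c ∧ ∀ ω, MeasurableSet ω → μ ω = ENNReal.ofReal c * lpSurf p K ω := by
  have hK := h.isCompact
  have hc := h.convex
  have hint := h.interior_nonempty
  obtain ⟨γ, hγ0, hγt, hγ⟩ := exists_hausdorff_eq_smul_volume m
  have hγ' : 0 < γ.toReal := ENNReal.toReal_pos hγ0 hγt
  have hb := h.value_pos hd hμ
  set V := (volume K).toReal with hV
  have hKfin := hK.measure_lt_top (μ := volume)
  have hVpos : 0 < V :=
    ENNReal.toReal_pos (zero_lt_one.trans_le h.one_le_volume).ne' hKfin.ne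
  set c : ℝ := b / (γ.toReal * ((m + 1 : ℕ) * V)) with hcdef
  have hcpos : 0 < c := by positivity
  have hm : Measurable fun u => ENNReal.ofReal (suppFn K u ^ (p - 1)) :=
    (h.continuous_suppFn.measurable.pow_const _).ennreal_ofReal
  have hm1 : Measurable fun u => ENNReal.ofReal (suppFn K u) :=
    h.continuous_suppFn.measurable.ennreal_ofReal
  set ν := μ.withDensity fun u => ENNReal.ofReal (suppFn K u ^ (p - 1)) with hν
  have hwint := h.integrable_rpow_sub_one hd
  have hw0 : ∀ u, 0 ≤ suppFn K u ^ (p - 1) := fun u => Real.rpow_nonneg (h.suppFn_nonneg u) _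
  have : IsFiniteMeasure ν := isFiniteMeasure_withDensity_ofReal hwint.2
  have : IsFiniteMeasure (surfMeasure K) := isFiniteMeasure_surfMeasure hK hc hint
  have : IsFiniteMeasure (ENNReal.ofReal c • surfMeasure K) :=
    Measure.smul_finite _ ENNReal.ofReal_ne_top
  have hle : ν ≤ ENNReal.ofReal c • surfMeasure K := by
    refine measure_le_of_le_on_invariant_compacts hρ (fun g => ?_) (fun g => ?_) ?_ ?_
    · refine map_isometry_withDensity (hd.map_eq g) hm fun x => ?_
      rw [suppFn_image_isometry _ (h.isCompetitor.image_eq g)]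
    · rw [Measure.map_smul, map_isometry_surfMeasure hK hc hint (h.isCompetitor.image_eq g)]
    · refine withDensity_absolutelyContinuous _ _ ?_
      exact measure_eq_zero_iff_ae_notMem.2 <| hd.ae_mem.mono fun u hu =>
        not_not.2 (by simpa using hd.norm_eq u hu)
    · intro C hC hCs hCi
      rw [hν, withDensity_apply _ hC.measurableSet,
        ← ofReal_integral_eq_lintegral_ofReal hwint.integrableOn (ae_of_all _ hw0),
        Measure.smul_apply, smul_eq_mul]
      refine le_trans (le_of_eq ?_)
        (mul_le_mul_right (h.mul_integral_le_surfMeasure hd hμ hγt hγ hC hCs hCi) _)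
      have hN0 : 0 ≤ ∫ u in C, suppFn K u ^ (p - 1) ∂μ := integral_nonneg fun u => hw0 u
      rw [← ENNReal.ofReal_toReal hγt, ← ENNReal.ofReal_mul hγ'.le, ← ENNReal.ofReal_mul hcpos.le]
      congr 1
      rw [hcdef, ← hV]
      field_simp
  have hlint : ∫⁻ u, ENNReal.ofReal (suppFn K u) ∂ν = ENNReal.ofReal b := by
    rw [hν, lintegral_withDensity_eq_lintegral_mul _ hm hm1,
      ← h.integral_rpow_sub_one_mul_suppFn hd, ofReal_integral_eq_lintegral_ofReal
        (h.integrable_rpow_sub_one_mul hd h.continuous_suppFn)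
        (ae_of_all _ fun u => mul_nonneg (hw0 u) (h.suppFn_nonneg u))]
    simp only [Pi.mul_apply, ENNReal.ofReal_mul (hw0 _)]
  have heq := withDensity_eq_of_le_of_lintegral_le hle (f := fun u => ENNReal.ofReal (suppFn K u))
    (by rw [hlint]; exact ENNReal.ofReal_ne_top) (by
      rw [hlint, lintegral_smul_measure, smul_eq_mul]
      refine (mul_le_mul_right
        (lintegral_suppFn_surfMeasure_le hγt hγ hK hc hint h.zero_mem) _).trans (le_of_eq ?_)
      rw [← ENNReal.ofReal_toReal hγt, ← ENNReal.ofReal_toReal hKfin.ne, ← hV,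
        ← ENNReal.ofReal_natCast, ← ENNReal.ofReal_mul (by positivity),
        ← ENNReal.ofReal_mul hγ'.le, ← ENNReal.ofReal_mul hcpos.le]
      congr 1
      rw [hcdef]
      field_simp)
  refine ⟨c, hcpos, fun ω hω => ?_⟩
  rw [measure_eq_setLIntegral_rpow hd.lt_one h.continuous_suppFn.measurable h.suppFn_nonneg
    (h.suppFn_pos hd) heq hω, Measure.restrict_smul, lintegral_smul_measure, smul_eq_mul,
    setLIntegral_surfMeasure hK hc hint hω]

lemma VariationalData.exists_lpSurf_eq [IsFiniteMeasure μ] (hμ : μ ≠ 0)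
    (hρ : Continuous fun z : H × Eu (m + 1) => ρ z.1 z.2) (hd : VariationalData p μ Ω D ρ T) :
    ∃ K : Set (Eu (m + 1)), IsConvexBody K ∧ 0 ∈ K ∧
      (∀ ω, MeasurableSet ω → μ ω = lpSurf p K ω) ∧ ∀ g, ρ g '' K = K := by
  obtain ⟨K, b, h⟩ := hd.exists_isMinimax m.succ_ne_zero
  obtain ⟨c, hc, hcK⟩ := h.exists_measure_eq_smul_lpSurf hμ hρ hd
  have hq : (0 : ℝ) < (m + 1 : ℕ) - p := by
    push_cast
    linarith [hd.lt_one, (m.cast_nonneg : (0 : ℝ) ≤ m)]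
  set l : ℝ := c ^ ((((m + 1 : ℕ) : ℝ) - p)⁻¹) with hl
  have hl0 : 0 < l := by positivity
  have hlc : l ^ (((m + 1 : ℕ) : ℝ) - p) = c := by
    rw [hl, ← Real.rpow_mul hc.le, inv_mul_cancel₀ hq.ne', Real.rpow_one]
  refine ⟨(fun x => l • x) '' K, ⟨?_, ?_, ?_⟩, ⟨0, h.zero_mem, smul_zero _⟩, fun ω hω => ?_,
    fun g => ?_⟩
  · exact h.convex.smul l
  · exact h.isCompact.image (by fun_prop)
  · have h1 := (Homeomorph.smulOfNeZero (α := Eu (m + 1)) l hl0.ne').image_interior K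
    change (fun x => l • x) '' interior K = interior ((fun x => l • x) '' K) at h1
    rw [← h1]
    exact h.interior_nonempty.image _
  · rw [lpSurf_image_dilate h.isCompact h.convex h.interior_nonempty h.zero_mem hl0 hω,
      hlc, hcK ω hω]
  · conv_rhs => rw [← h.isCompetitor.image_eq g]
    rw [image_image, image_image]
    simp only [map_smul]

end Conclusion

section Support

variable {n : ℕ} {p : ℝ} {μ : Measure (Eu n)}

lemma ae_mem_measSupport (μ : Measure (Eu n)) : ∀ᵐ u ∂μ, u ∈ measSupport μ := by
  refine measure_null_of_locally_null _ fun x hx => ?_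
  obtain ⟨U, hU, hxU, hμU⟩ : ∃ U : Set (Eu n), IsOpen U ∧ x ∈ U ∧ ¬ 0 < μ U := by
    by_contra! hne
    exact hx fun U hU hxU => hne U hU hxU
  exact ⟨U, mem_nhdsWithin_of_mem_nhds (hU.mem_nhds hxU), by simpa using hμU⟩

lemma measSupport_subset_of_isClosed {F : Set (Eu n)} (hF : IsClosed F) (h : μ Fᶜ = 0) :
    measSupport μ ⊆ F := by
  intro x hx
  by_contra hxF
  exact (hx _ hF.isOpen_compl hxF).ne' h

lemma restrict_sphere_eq_self (hμ : μ (sphere (0 : Eu n) 1)ᶜ = 0) :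
    μ.restrict (sphere 0 1) = μ :=
  Measure.restrict_eq_self_of_ae_mem (mem_ae_iff.2 hμ)

lemma integrable_of_continuous_of_sphere [IsFiniteMeasure μ] (hμ : μ (sphere (0 : Eu n) 1)ᶜ = 0)
    {f : Eu n → ℝ} (hf : Continuous f) : Integrable f μ := by
  have := hf.continuousOn.integrableOn_compact (μ := μ) (isCompact_sphere (0 : Eu n) 1)
  rwa [IntegrableOn, restrict_sphere_eq_self hμ] at this

lemma integral_pos_of_mem_measSupport [IsFiniteMeasure μ] (hμ : μ (sphere (0 : Eu n) 1)ᶜ = 0)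
    {f : Eu n → ℝ} (hf : Continuous f) (hf0 : ∀ u ∈ measSupport μ, 0 ≤ f u) {u : Eu n}
    (hu : u ∈ measSupport μ) (hfu : f u ≠ 0) : 0 < ∫ u, f u ∂μ := by
  rw [integral_pos_iff_support_of_nonneg_ae ((ae_mem_measSupport μ).mono hf0)
    (integrable_of_continuous_of_sphere hμ hf)]
  exact hu _ (isOpen_ne_fun hf continuous_const) hfu

lemma exists_inner_ne_zero_of_mem_span {S : Set (Eu n)} {y : Eu n}
    (hy : y ∈ Submodule.span ℝ S) (hy0 : y ≠ 0) : ∃ u ∈ S, ⟪y, u⟫ ≠ 0 := by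
  by_contra! hS
  have h : Submodule.span ℝ S ≤ (ℝ ∙ y)ᗮ :=
    Submodule.span_le.2 fun u hu => Submodule.mem_orthogonal_singleton_iff_inner_right.2 (hS u hu)
  exact hy0 (inner_self_eq_zero.1 (Submodule.mem_orthogonal_singleton_iff_inner_right.1 (h hy)))

lemma exists_mul_norm_rpow_le_integral [IsFiniteMeasure μ] (hμ : μ (sphere (0 : Eu n) 1)ᶜ = 0)
    (hp : 0 < p) {L : Submodule ℝ (Eu n)} (hL : L = Submodule.span ℝ (measSupport μ)) :
    ∃ c > 0, ∀ y ∈ L, c * ‖y‖ ^ p ≤ ∫ u, |⟪y, u⟫| ^ p ∂μ := by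
  have hcont : Continuous fun y : Eu n => ∫ u, |⟪y, u⟫| ^ p ∂μ := by
    have := continuous_parametric_integral_of_continuous (μ := μ)
      (f := fun (y u : Eu n) => |⟪y, u⟫| ^ p)
      ((Real.continuous_rpow_const hp.le).comp (by fun_prop)) (isCompact_sphere (0 : Eu n) 1)
    rwa [restrict_sphere_eq_self hμ] at this
  have hpos : ∀ y ∈ L, y ≠ 0 → 0 < ∫ u, |⟪y, u⟫| ^ p ∂μ := by
    intro y hy hy0
    obtain ⟨u, hu, hyu⟩ := exists_inner_ne_zero_of_mem_span (hL ▸ hy) hy0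
    refine integral_pos_of_mem_measSupport hμ
      ((Real.continuous_rpow_const hp.le).comp (by fun_prop)) (fun u _ => by positivity) hu ?_
    exact (Real.rpow_pos_of_pos (abs_pos.2 hyu) _).ne'
  have hcomp : IsCompact (sphere (0 : Eu n) 1 ∩ L) :=
    (isCompact_sphere _ _).inter_right L.closed_of_finiteDimensional
  rcases (sphere (0 : Eu n) 1 ∩ (L : Set (Eu n))).eq_empty_or_nonempty with he | hne
  · refine ⟨1, one_pos, fun y hy => ?_⟩
    rcases eq_or_ne y 0 with rfl | hy0
    · simp [hp.ne']
    · refine absurd (?_ : ‖y‖⁻¹ • y ∈ sphere (0 : Eu n) 1 ∩ (L : Set (Eu n)))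
        (by simp [he])
      exact ⟨by simp [norm_smul, hy0], L.smul_mem _ hy⟩
  · obtain ⟨y₀, ⟨hy₀, hy₀L⟩, hmin⟩ := hcomp.exists_isMinOn hne hcont.continuousOn
    refine ⟨_, hpos y₀ hy₀L (ne_zero_of_mem_unit_sphere ⟨y₀, hy₀⟩), fun y hy => ?_⟩
    rcases eq_or_ne y 0 with rfl | hy0
    · simp [hp.ne']
    have hny : 0 < ‖y‖ := norm_pos_iff.2 hy0
    have h1 := hmin (show ‖y‖⁻¹ • y ∈ sphere (0 : Eu n) 1 ∩ (L : Set (Eu n)) from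
      ⟨by simp [norm_smul, hy0], L.smul_mem _ hy⟩)
    simp only [Set.mem_ofPred_eq] at h1
    refine (mul_le_mul_of_nonneg_right h1 (by positivity)).trans (le_of_eq ?_)
    rw [← integral_mul_const]
    refine integral_congr_ae (ae_of_all _ fun u => ?_)
    simp only
    rw [← Real.mul_rpow (abs_nonneg _) hny.le, real_inner_smul_left, abs_mul, abs_inv,
      abs_norm]
    congr 1
    field_simp

lemma isometry_symm_mem_measSupport {T : Eu n ≃ₗᵢ[ℝ] Eu n} (hT : Measure.map T μ = μ) {u : Eu n}
    (hu : u ∈ measSupport μ) : T.symm u ∈ measSupport μ := by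
  intro U hU huU
  have h1 := hu (T.symm ⁻¹' U) (hU.preimage T.symm.continuous) huU
  rw [← hT, (show MeasurableEmbedding T from T.toHomeomorph.measurableEmbedding).map_apply] at h1
  have h2 : T ⁻¹' (T.symm ⁻¹' U) = U := by
    ext x
    simp
  rwa [h2] at h1

end Support

section Cases

variable {n : ℕ} {ι : Type*} {p : ℝ} {μ : Measure (Eu n)} {ρ : ι → Eu n ≃ₗᵢ[ℝ] Eu n}
  {L : Submodule ℝ (Eu n)}

lemma isometry_mem_of_fixes_orthogonal {T : Eu n ≃ₗᵢ[ℝ] Eu n} (hT : ∀ x ∈ Lᗮ, T x = x) {x : Eu n}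
    (hx : x ∈ L) : T x ∈ L := by
  rw [← L.orthogonal_orthogonal, Submodule.mem_orthogonal]
  intro y hy
  rw [← hT y hy, T.inner_map_map]
  exact (Submodule.mem_orthogonal' L y).1 hy x hx

lemma starProjection_isometry_of_fixes_orthogonal {T : Eu n ≃ₗᵢ[ℝ] Eu n}
    (hT : ∀ x ∈ Lᗮ, T x = x) (x : Eu n) : L.starProjection (T x) = T (L.starProjection x) := by
  refine Submodule.eq_starProjection_of_mem_orthogonal
    (isometry_mem_of_fixes_orthogonal hT (L.starProjection_apply_mem x)) ?_
  have h := L.sub_starProjection_mem_orthogonal x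
  rwa [← map_sub, hT _ h]

lemma image_isometry_eq_of_mem_iff {T : Eu n ≃ₗᵢ[ℝ] Eu n} {D : Set (Eu n)}
    (h : ∀ x, T x ∈ D ↔ x ∈ D) : T '' D = D := by
  have h1 : T ⁻¹' D = D := by
    ext x
    exact h x
  conv_lhs => rw [← h1]
  exact image_preimage_eq _ T.surjective

lemma variationalData_of_span_eq_top [IsFiniteMeasure μ] (hp0 : 0 < p) (hp1 : p < 1)
    (hμ : μ (sphere (0 : Eu n) 1)ᶜ = 0) (hL : Submodule.span ℝ (measSupport μ) = ⊤)
    (hρ : ∀ g, Measure.map (ρ g) μ = μ) :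
    VariationalData p μ (measSupport μ) univ ρ (ContinuousLinearMap.id ℝ (Eu n)) where
  pos := hp0
  lt_one := hp1
  ae_mem := ae_mem_measSupport μ
  norm_eq u hu := by simpa using measSupport_subset_of_isClosed isClosed_sphere hμ hu
  isClosed := isClosed_univ
  convex := convex_univ
  zero_mem := mem_univ _
  smul_mem _ _ _ _ := mem_univ _
  interior_nonempty := by simp
  add_mem _ _ _ := mem_univ _
  idem _ := rfl
  inner_le _ _ _ _ := le_rfl
  coercive := by
    obtain ⟨c, hc, h⟩ := exists_mul_norm_rpow_le_integral hμ hp0 hL.symm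
    exact ⟨c, hc, fun x _ => by simp [hp0.ne'], fun x => h x trivial⟩
  isometry_image g := by simp [(ρ g).surjective.range_eq]
  isometry_comm _ _ := rfl
  map_eq := hρ

lemma variationalData_of_halfspace [IsFiniteMeasure μ] (hp0 : 0 < p) (hp1 : p < 1)
    (hμ : μ (sphere (0 : Eu n) 1)ᶜ = 0) (hL : L = Submodule.span ℝ (measSupport μ))
    (hρ : ∀ g, Measure.map (ρ g) μ = μ) (hfix : ∀ g, ∀ x ∈ Lᗮ, ρ g x = x) {w : Eu n}
    (hwL : w ∈ L) (hw : ‖w‖ = 1) (hρw : ∀ g, ρ g w = w)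
    (hwS : ∀ u ∈ measSupport μ, 0 ≤ ⟪w, u⟫) :
    VariationalData p μ (measSupport μ) {z | ‖z - L.starProjection z‖ ≤ ⟪z, w⟫} ρ
      (L.starProjection - (innerSL ℝ w).smulRight w) := by
  set P := L.starProjection with hP
  have hT : ∀ x, (P - (innerSL ℝ w).smulRight w) x = P x - ⟪x, w⟫ • w := fun x => by
    simp [real_inner_comm]
  have hPL : ∀ x ∈ L, P x = x := fun x hx => Submodule.starProjection_eq_self_iff.2 hx
  have hPm : ∀ x, P x ∈ L := L.starProjection_apply_mem
  have hPi : ∀ x, ∀ y ∈ L, ⟪P x, y⟫ = ⟪x, y⟫ := fun x y hy => by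
    rw [Submodule.inner_starProjection_left_eq_right, ← hP, hPL y hy]
  have hww : ⟪w, w⟫ = 1 := by rw [real_inner_self_eq_norm_sq, hw, one_pow]
  have hSL : ∀ u ∈ measSupport μ, u ∈ L := fun u hu => hL ▸ Submodule.subset_span hu
  have hTL : ∀ x, (P - (innerSL ℝ w).smulRight w) x ∈ L := fun x => by
    rw [hT]
    exact L.sub_mem (hPm x) (L.smul_mem _ hwL)
  have hTw : ∀ x, ⟪(P - (innerSL ℝ w).smulRight w) x, w⟫ = 0 := fun x => by
    rw [hT, inner_sub_left, hPi x w hwL, real_inner_smul_left, hww]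
    ring
  have hρP : ∀ g x, P (ρ g x) = ρ g (P x) := fun g =>
    starProjection_isometry_of_fixes_orthogonal (hfix g)
  have hρi : ∀ g x, ⟪ρ g x, w⟫ = ⟪x, w⟫ := fun g x => by
    conv_lhs => rw [← hρw g, (ρ g).inner_map_map]
  have hD0 : ∀ x ∈ {z | ‖z - P z‖ ≤ ⟪z, w⟫}, 0 ≤ ⟪x, w⟫ := fun x hx => (norm_nonneg _).trans hx
  have hsmul : ∀ c : ℝ, 0 ≤ c → ∀ x ∈ {z | ‖z - P z‖ ≤ ⟪z, w⟫},
      c • x ∈ {z | ‖z - P z‖ ≤ ⟪z, w⟫} := by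
    intro c hc x hx
    rw [Set.mem_ofPred_eq] at hx ⊢
    rw [map_smul, ← smul_sub, norm_smul, Real.norm_of_nonneg hc, real_inner_smul_left]
    exact mul_le_mul_of_nonneg_left hx hc
  have hadd : ∀ x ∈ {z | ‖z - P z‖ ≤ ⟪z, w⟫}, ∀ y ∈ {z | ‖z - P z‖ ≤ ⟪z, w⟫},
      x + y ∈ {z | ‖z - P z‖ ≤ ⟪z, w⟫} := by
    intro x hx y hy
    rw [Set.mem_ofPred_eq] at hx hy ⊢
    rw [map_add, inner_add_left, add_sub_add_comm]
    exact (norm_add_le _ _).trans (add_le_add hx hy)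
  exact
  { pos := hp0
    lt_one := hp1
    ae_mem := ae_mem_measSupport μ
    norm_eq := fun u hu => by simpa using measSupport_subset_of_isClosed isClosed_sphere hμ hu
    isClosed := isClosed_le (by fun_prop) (by fun_prop)
    convex := fun x hx y hy a b ha hb _ => hadd _ (hsmul a ha x hx) _ (hsmul b hb y hy)
    zero_mem := by simp
    smul_mem := hsmul
    interior_nonempty := by
      have hsub : {z | ‖z - P z‖ < ⟪z, w⟫} ⊆ {z | ‖z - P z‖ ≤ ⟪z, w⟫} :=
        fun z (hz : ‖z - P z‖ < ⟪z, w⟫) => hz.le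
      refine ⟨w, interior_maximal hsub (isOpen_lt (by fun_prop) (by fun_prop)) ?_⟩
      simp [hPL w hwL, hw]
    add_mem := fun x hx y => hadd x hx _ <| by
      rw [Set.mem_ofPred_eq, hPL _ (hTL y), sub_self, norm_zero, hTw]
    idem := fun x => by
      rw [hT, hTw, hPL _ (hTL x), zero_smul, sub_zero]
    inner_le := fun x hx u hu => by
      rw [hT, inner_sub_left, hPi x u (hSL u hu), real_inner_smul_left]
      linarith [mul_nonneg (hD0 x hx) (hwS u hu)]
    coercive := by
      obtain ⟨c, hc, h⟩ := exists_mul_norm_rpow_le_integral hμ hp0 hL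
      obtain ⟨u₀, hu₀, hwu₀⟩ := exists_inner_ne_zero_of_mem_span (hL ▸ hwL)
        (norm_ne_zero_iff.1 (hw ▸ one_ne_zero))
      set I := ∫ u, ⟪w, u⟫ ^ p ∂μ with hI
      have hIpos : 0 < I := by
        refine integral_pos_of_mem_measSupport hμ
          ((Real.continuous_rpow_const hp0.le).comp (by fun_prop))
          (fun u hu => Real.rpow_nonneg (hwS u hu) _) hu₀ ?_
        exact (Real.rpow_pos_of_pos ((hwS u₀ hu₀).lt_of_ne' hwu₀) _).ne'
      refine ⟨min (I / 2 ^ p) c, lt_min (by positivity) hc, fun x hx => ?_, fun x => ?_⟩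
      · have hxw := hD0 x hx
        have hsub : x - (P - (innerSL ℝ w).smulRight w) x = ⟪x, w⟫ • w + (x - P x) := by
          rw [hT]
          abel
        have hnorm : ‖x - (P - (innerSL ℝ w).smulRight w) x‖ ≤ 2 * ⟪x, w⟫ := by
          rw [hsub]
          refine (norm_add_le _ _).trans ?_
          rw [norm_smul, hw, Real.norm_of_nonneg hxw]
          have : ‖x - P x‖ ≤ ⟪x, w⟫ := hx
          linarith
        have hint : ∫ u, ⟪x - (P - (innerSL ℝ w).smulRight w) x, u⟫ ^ p ∂μ = ⟪x, w⟫ ^ p * I := by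
          rw [hI, ← integral_const_mul]
          refine integral_congr_ae ?_
          filter_upwards [ae_mem_measSupport μ] with u hu
          rw [hsub, inner_add_left, inner_sub_left, hPi x u (hSL u hu), sub_self, add_zero,
            real_inner_smul_left, Real.mul_rpow hxw (hwS u hu)]
        rw [hint]
        calc _ ≤ I / 2 ^ p * (2 * ⟪x, w⟫) ^ p := by
              gcongr
              exact min_le_left _ _
          _ = ⟪x, w⟫ ^ p * I := by
              rw [Real.mul_rpow zero_le_two hxw]
              field_simp
      · refine le_trans ?_ (h _ (hTL x))
        gcongr
        exact min_le_right _ _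
    isometry_image := fun g => image_isometry_eq_of_mem_iff fun x => by
      rw [Set.mem_ofPred_eq, Set.mem_ofPred_eq, hρP, ← map_sub, (ρ g).norm_map, hρi]
    isometry_comm := fun g x => by
      rw [hT, hT, hρP, hρi, map_sub, map_smul, hρw]
    map_eq := hρ }

end Cases

section Separation

variable {n : ℕ} {μ : Measure (Eu n)} {L : Submodule ℝ (Eu n)}

lemma exists_inner_nonneg_of_posHull_ne {S : Set (Eu n)}
    (h : posHull S ≠ (Submodule.span ℝ S : Set (Eu n))) :
    ∃ v ∈ Submodule.span ℝ S, v ≠ 0 ∧ ∀ u ∈ S, 0 ≤ ⟪v, u⟫ := by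
  set L := Submodule.span ℝ S with hL
  obtain ⟨y, hyL, hy⟩ : ∃ y ∈ L, y ∉ posHull S := by
    by_contra! hne
    refine h (Subset.antisymm ?_ hne)
    rintro _ ⟨k, c, x, hcx, rfl⟩
    exact L.sum_mem fun i _ => L.smul_mem _ (Submodule.subset_span (hcx i).2)
  let C : PointedCone ℝ (Eu n) :=
    Submodule.span {c : ℝ // 0 ≤ c} S ⊔ Lᗮ.restrictScalars {c : ℝ // 0 ≤ c}
  have hSC : S ⊆ C := fun u hu => Submodule.mem_sup_left (Submodule.subset_span hu)
  have hLC : (Lᗮ : Set (Eu n)) ⊆ C := fun u hu => Submodule.mem_sup_right hu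
  have hyC : y ∉ C := by
    intro hyC
    obtain ⟨a, ha, b, hb, hab⟩ := Submodule.mem_sup.1 hyC
    obtain ⟨k, c, x, hsum⟩ := Submodule.mem_span_set'.1 ha
    have haL : a ∈ L := by
      rw [← hsum]
      exact L.sum_mem fun i _ => L.smul_mem (c i : ℝ) (Submodule.subset_span (x i).2)
    have hb0 : b = 0 := by
      have hbL : b ∈ L := by
        rw [← add_sub_cancel_left a b, hab]
        exact L.sub_mem hyL haL
      exact inner_self_eq_zero.1 ((Submodule.mem_orthogonal L b).1 hb b hbL)
    refine hy ⟨k, fun i => c i, fun i => x i, fun i => ⟨(c i).2, (x i).2⟩, ?_⟩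
    rw [← hab, hb0, add_zero, ← hsum]
    rfl
  have hspan : Submodule.span ℝ (C : Set (Eu n)) = ⊤ := by
    rw [eq_top_iff, ← L.sup_orthogonal_of_hasOrthogonalProjection]
    exact sup_le (Submodule.span_mono hSC) (hLC.trans Submodule.subset_span)
  have hint : (interior (C : Set (Eu n))).Nonempty := by
    rw [C.convex.interior_nonempty_iff_affineSpan_eq_top,
      ← insert_eq_of_mem (show (0 : Eu n) ∈ (C : Set (Eu n)) from C.zero_mem)]
    refine SetLike.coe_injective ?_
    rw [affineSpan_insert_zero, hspan]
    rfl
  obtain ⟨f, a, hf0, hfC, hfy⟩ := geometric_hahn_banach_of_nonempty_interior C.convex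
    (convex_singleton y) (disjoint_singleton_right.2 fun hyi => hyC (interior_subset hyi))
    hint (singleton_nonempty y)
  have hfneg : ∀ x ∈ C, f x ≤ 0 := by
    intro x hx
    by_contra! hpos
    have hc : 0 ≤ (|a| + 1) / f x := by positivity
    have h1 := hfC _ (C.smul_mem hc hx)
    rw [map_smul, smul_eq_mul, div_mul_cancel₀ _ hpos.ne'] at h1
    linarith [le_abs_self a]
  have hfv : ∀ x, ⟪(InnerProductSpace.toDual ℝ (Eu n)).symm f, x⟫ = f x := fun x =>
    InnerProductSpace.toDual_symm_apply
  refine ⟨-(InnerProductSpace.toDual ℝ (Eu n)).symm f, ?_, by simpa using hf0, fun u hu => ?_⟩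
  · rw [← L.orthogonal_orthogonal, Submodule.mem_orthogonal']
    intro x hx
    rw [inner_neg_left, hfv, neg_eq_zero]
    refine le_antisymm (hfneg x (hLC hx)) ?_
    have := hfneg (-x) (hLC (Lᗮ.neg_mem hx))
    rwa [map_neg, neg_nonpos] at this
  · rw [inner_neg_left, hfv]
    exact neg_nonneg.2 (hfneg u (hSC hu))

lemma exists_invariant_unit_inner_nonneg {ι : Type*} {ρ : ι → Eu n ≃ₗᵢ[ℝ] Eu n}
    [IsFiniteMeasure μ] (hμ : μ (sphere (0 : Eu n) 1)ᶜ = 0)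
    (hL : L = Submodule.span ℝ (measSupport μ)) (hρ : ∀ g, Measure.map (ρ g) μ = μ)
    (hfix : ∀ g, ∀ x ∈ Lᗮ, ρ g x = x) (hpos : posHull (measSupport μ) ≠ (L : Set (Eu n))) :
    ∃ w ∈ L, ‖w‖ = 1 ∧ (∀ g, ρ g w = w) ∧ ∀ u ∈ measSupport μ, 0 ≤ ⟪w, u⟫ := by
  have hint : ∀ w : Eu n, ∫ u, ⟪w, u⟫ ∂μ = ⟪w, ∫ u, u ∂μ⟫ := by
    intro w
    have hid : Integrable (fun u : Eu n => u) μ := by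
      have := continuous_id.continuousOn.integrableOn_compact (μ := μ)
        (isCompact_sphere (0 : Eu n) 1)
      rwa [IntegrableOn, restrict_sphere_eq_self hμ] at this
    exact integral_inner hid w
  set Z : Set (Eu n) := {w | w ∈ L ∧ (∀ u ∈ measSupport μ, 0 ≤ ⟪w, u⟫) ∧ 1 ≤ ∫ u, ⟪w, u⟫ ∂μ}
    with hZ
  have hZ' : Z = (L : Set (Eu n)) ∩ ((⋂ u ∈ measSupport μ, {w | 0 ≤ ⟪w, u⟫}) ∩ {w | 1 ≤ ⟪w, ∫ u, u ∂μ⟫}) := by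
    ext w
    simp [hZ, hint]
  have hclosed : IsClosed Z := by
    rw [hZ']
    exact L.closed_of_finiteDimensional.inter <| IsClosed.inter
      (isClosed_biInter fun u _ => isClosed_le (by fun_prop) (by fun_prop))
      (isClosed_le (by fun_prop) (by fun_prop))
  have hconv : Convex ℝ Z := by
    rintro x ⟨hx1, hx2, hx3⟩ y ⟨hy1, hy2, hy3⟩ a b ha hb hab
    refine ⟨L.add_mem (L.smul_mem a hx1) (L.smul_mem b hy1), fun u hu => ?_, ?_⟩
    · rw [inner_add_left, real_inner_smul_left, real_inner_smul_left]
      exact add_nonneg (mul_nonneg ha (hx2 u hu)) (mul_nonneg hb (hy2 u hu))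
    · rw [hint] at hx3 hy3 ⊢
      rw [inner_add_left, real_inner_smul_left, real_inner_smul_left]
      nlinarith
  have hne : Z.Nonempty := by
    obtain ⟨v, hv, hv0, hvS⟩ := exists_inner_nonneg_of_posHull_ne (hL ▸ hpos)
    obtain ⟨u₀, hu₀, hvu₀⟩ := exists_inner_ne_zero_of_mem_span hv hv0
    have hI : 0 < ∫ u, ⟪v, u⟫ ∂μ :=
      integral_pos_of_mem_measSupport hμ (by fun_prop) hvS hu₀ hvu₀
    refine ⟨(∫ u, ⟪v, u⟫ ∂μ)⁻¹ • v, L.smul_mem _ (hL ▸ hv), fun u hu => ?_, ?_⟩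
    · rw [real_inner_smul_left]
      exact mul_nonneg (by positivity) (hvS u hu)
    · simp only [real_inner_smul_left]
      rw [integral_const_mul, inv_mul_cancel₀ hI.ne']
  obtain ⟨w, ⟨hwL, hwS, hw1⟩, hρw⟩ := exists_fixed_point_of_isometry_invariant (ρ := ρ)
    hclosed hconv hne (by
      rintro g x ⟨hx1, hx2, hx3⟩
      refine ⟨isometry_mem_of_fixes_orthogonal (hfix g) hx1, fun u hu => ?_, ?_⟩
      · have h := hx2 _ (isometry_symm_mem_measSupport (hρ g) hu)
        rwa [← (ρ g).inner_map_map, (ρ g).apply_symm_apply] at h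
      · conv_rhs => rw [← hρ g]
        rw [(show MeasurableEmbedding (ρ g) from
          (ρ g).toHomeomorph.measurableEmbedding).integral_map]
        simpa only [(ρ g).inner_map_map] using hx3)
  have hw0 : w ≠ 0 := by
    rintro rfl
    simp at hw1
    linarith
  refine ⟨‖w‖⁻¹ • w, L.smul_mem _ hwL, by simp [norm_smul, hw0], fun g => ?_, fun u hu => ?_⟩
  · rw [map_smul, hρw]
  · rw [real_inner_smul_left]
    exact mul_nonneg (by positivity) (hwS u hu)

end Separation

section OrthogonalAction

variable {n : ℕ}

/-- The action of the orthogonal group on Euclidean space by linear isometries. -/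
def orthogonalAction (n : ℕ) : Matrix.orthogonalGroup (Fin n) ℝ →* (Eu n ≃ₗᵢ[ℝ] Eu n) :=
  (Unitary.linearIsometryEquiv (𝕜 := ℝ) (H := Eu n)).toMonoidHom.comp
    (Unitary.map (⟨(Matrix.toEuclideanCLM (n := Fin n) (𝕜 := ℝ) : _ →* _), map_star _⟩ :
      Matrix (Fin n) (Fin n) ℝ →⋆* (Eu n →L[ℝ] Eu n))).toMonoidHom

lemma orthogonalAction_apply (A : Matrix.orthogonalGroup (Fin n) ℝ) (x : Eu n) :
    orthogonalAction n A x = matAct (A : Matrix (Fin n) (Fin n) ℝ) x :=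
  rfl

lemma continuous_matAct :
    Continuous fun z : Matrix (Fin n) (Fin n) ℝ × Eu n => matAct z.1 z.2 := by
  unfold matAct
  fun_prop

lemma exists_isometry_action (G : Subgroup (Matrix.orthogonalGroup (Fin n) ℝ)) :
    ∃ ρ : G →* (Eu n ≃ₗᵢ[ℝ] Eu n), ∀ g : G,
      ⇑(ρ g) = matAct ((g : Matrix.orthogonalGroup (Fin n) ℝ) : Matrix (Fin n) (Fin n) ℝ) :=
  ⟨(orthogonalAction n).comp G.subtype, fun g => funext (orthogonalAction_apply g.1)⟩

lemma isCompact_orthogonalGroup (n : ℕ) :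
    IsCompact (Matrix.orthogonalGroup (Fin n) ℝ : Set (Matrix (Fin n) (Fin n) ℝ)) := by
  have hbox : IsCompact (univ.pi fun _ : Fin n => univ.pi fun _ : Fin n => Icc (-1 : ℝ) 1) :=
    isCompact_univ_pi fun _ => isCompact_univ_pi fun _ => isCompact_Icc
  refine hbox.of_isClosed_subset ?_ fun A hA i _ j _ => ?_
  · have h : (Matrix.orthogonalGroup (Fin n) ℝ : Set (Matrix (Fin n) (Fin n) ℝ)) =
        {A | A * star A = 1} := by
      ext A
      exact Matrix.mem_unitaryGroup_iff
    rw [h]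
    exact isClosed_eq (by fun_prop) continuous_const
  · exact abs_le.1 (by simpa using entry_norm_bound_of_unitary hA i j)

end OrthogonalAction

/-- For `p ∈ (0,1)` and a non-trivial finite Borel measure `μ` on the unit
sphere with `L = lin (supp μ)` such that either `supp μ` spans `ℝⁿ`, or `dim L ≤ n-1` and
`pos (supp μ) ≠ L`, the measure `μ` is the `L_p`-surface area measure of a convex body
containing the origin; moreover if `μ` is invariant under a closed subgroup `G` of `O(n)`
acting as the identity on `L^⊥`, then the body can be chosen `G`-invariant. -/
theorem lp_minkowski_existence_zero_one_general
    (n : ℕ) (p : ℝ) (hp : p ∈ Set.Ioo (0:ℝ) 1)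
    (μ : Measure (Eu n)) [IsFiniteMeasure μ] (hμ0 : μ ≠ 0)
    (hμsphere : μ (sphere (0 : Eu n) 1)ᶜ = 0)
    (L : Submodule ℝ (Eu n)) (hL : L = Submodule.span ℝ (measSupport μ))
    (hcase : L = ⊤ ∨
      (Module.finrank ℝ L ≤ n - 1 ∧ posHull (measSupport μ) ≠ (L : Set (Eu n))))
    (G : Subgroup (Matrix.orthogonalGroup (Fin n) ℝ))
    (hGclosed : IsClosed (G : Set (Matrix.orthogonalGroup (Fin n) ℝ)))
    (hGfix : ∀ A ∈ G, ∀ x ∈ (Lᗮ : Set (Eu n)),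
      matAct (A : Matrix (Fin n) (Fin n) ℝ) x = x)
    (hGμ : ∀ A ∈ G, Measure.map (matAct (A : Matrix (Fin n) (Fin n) ℝ)) μ = μ) :
    ∃ K : Set (Eu n), IsConvexBody K ∧ (0 : Eu n) ∈ K ∧
      (∀ ω : Set (Eu n), MeasurableSet ω → μ ω = lpSurf p K ω) ∧
      (∀ A ∈ G, matAct (A : Matrix (Fin n) (Fin n) ℝ) '' K = K) := by
  obtain _ | m := n
  · refine absurd (Measure.measure_univ_eq_zero.1 ?_) hμ0
    rwa [sphere_eq_empty_of_subsingleton one_ne_zero, compl_empty] at hμsphere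
  have : CompactSpace (Matrix.orthogonalGroup (Fin (m + 1)) ℝ) :=
    isCompact_iff_compactSpace.1 (isCompact_orthogonalGroup (m + 1))
  have : CompactSpace G := isCompact_iff_compactSpace.1 hGclosed.isCompact
  obtain ⟨ρ, hρA⟩ := exists_isometry_action G
  have hρ : Continuous fun z : G × Eu (m + 1) => ρ z.1 z.2 := by
    simp only [hρA]
    have hcont : Continuous fun z : G × Eu (m + 1) =>
        (((z.1 : Matrix.orthogonalGroup (Fin (m + 1)) ℝ) : Matrix (Fin (m + 1)) (Fin (m + 1)) ℝ),
          z.2) := by fun_prop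
    exact continuous_matAct.comp hcont
  have hρμ : ∀ g, Measure.map (ρ g) μ = μ := fun g => by
    rw [hρA]
    exact hGμ g g.2
  have hρfix : ∀ g, ∀ x ∈ Lᗮ, ρ g x = x := fun g x hx => by
    rw [hρA]
    exact hGfix g g.2 x hx
  obtain ⟨D, T, hd⟩ : ∃ D T, VariationalData p μ (measSupport μ) D ρ T := by
    rcases hcase with htop | ⟨-, hpos⟩
    · exact ⟨_, _, variationalData_of_span_eq_top hp.1 hp.2 hμsphere (hL ▸ htop) hρμ⟩
    · obtain ⟨w, hwL, hw, hρw, hwS⟩ :=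
        exists_invariant_unit_inner_nonneg hμsphere hL hρμ hρfix hpos
      exact ⟨_, _, variationalData_of_halfspace hp.1 hp.2 hμsphere hL hρμ hρfix hwL hw hρw hwS⟩
  obtain ⟨K, hK, h0, hμK, hKρ⟩ := hd.exists_lpSurf_eq hμ0 hρ
  refine ⟨K, hK, h0, hμK, fun A hA => ?_⟩
  have h := hKρ ⟨A, hA⟩
  rwa [hρA] at h

end
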